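/- Let m ≥ 1 be an integer, Ω ⊂ ℝ^{2m} a bounded domain with smooth boundary, Γ ⊂ ∂Ω a proper closed subset, and (V_k)_{k∈ℕ} a bounded sequence in L^∞(Ω). Then there exist φ ∈ K(Ω,∅) with φ < 0 in Ω (so S_φ = ∅) and S_φ^* = Γ, and a sequence (u_k)_{k∈ℕ} of functions u_k ∈ C^{2m−1}(Ω), each extending continuously to Ω ∪ Γ, solving (−Δ)^m u_k = V_k e^{2m u_k} in Ω in the distributional sense, such that ∫_Ω e^{2m u_k} dx → 0 as k → ∞, u_k → −∞ locally uniformly in Ω, and u_k → +∞ locally uniformly on Γ. -/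

import Mathlib

noncomputable section

open MeasureTheory Real Filter Topology Metric Set Bornology

/-- Euclidean space `ℝ^{2m}`. -/
abbrev Euc (m : ℕ) : Type := EuclideanSpace ℝ (Fin (2*m))

/-- Pointwise Laplacian `Δ f (x) = ∑ ∂²f/∂xᵢ²`. -/
def lap {m : ℕ} (f : Euc m → ℝ) (x : Euc m) : ℝ :=
  ∑ i : Fin (2*m),
    fderiv ℝ (fun y => fderiv ℝ f y (EuclideanSpace.single i (1:ℝ))) x
      (EuclideanSpace.single i (1:ℝ))

/-- `(−Δ)^j f`, pointwise. -/
def negLapPow {m : ℕ} (j : ℕ) (f : Euc m → ℝ) : Euc m → ℝ :=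
  (fun g x => -(lap g x))^[j] f

/-- Smooth test functions compactly supported inside `Ω`. -/
def IsTestOn {m : ℕ} (Ω : Set (Euc m)) (ψ : Euc m → ℝ) : Prop :=
  ContDiff ℝ (⊤ : ℕ∞) ψ ∧ HasCompactSupport ψ ∧ tsupport ψ ⊆ Ω

/-- `u` solves `(−Δ)^m u = V e^{2mu}` on `Ω` in the distributional sense. -/
def SolvesQ {m : ℕ} (Ω : Set (Euc m)) (V u : Euc m → ℝ) : Prop :=
  ∀ ψ : Euc m → ℝ, IsTestOn Ω ψ →
    ∫ x in Ω, u x * negLapPow m ψ x = ∫ x in Ω, V x * Real.exp ((2*m : ℝ) * u x) * ψ x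

/-- Volume of the standard unit `n`-sphere: `2 π^{(n+1)/2} / Γ((n+1)/2)`. -/
def sphereVol (n : ℕ) : ℝ :=
  2 * Real.pi ^ (((n : ℝ) + 1)/2) / Real.Gamma (((n : ℝ) + 1)/2)

/-- `Λ₁ = (2m−1)! vol(S^{2m})`. -/
def Lambda1 (m : ℕ) : ℝ := (Nat.factorial (2*m - 1) : ℝ) * sphereVol (2*m)

/-- `γ_{2m} = Λ₁/2`. -/
def gamma2m (m : ℕ) : ℝ := Lambda1 m / 2

/-- The class `K(Ω,∅)`: smooth, nonpositive, not identically zero, `Δ^m φ ≡ 0` on `Ω`. -/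
def memK {m : ℕ} (Ω : Set (Euc m)) (φ : Euc m → ℝ) : Prop :=
  ContDiffOn ℝ (⊤ : ℕ∞) φ Ω ∧ (∀ x ∈ Ω, φ x ≤ 0) ∧ (∃ x ∈ Ω, φ x ≠ 0) ∧
    ∀ x ∈ Ω, negLapPow m φ x = 0

/-- `S_φ = {x ∈ Ω : φ(x) = 0}`. -/
def Sphi {m : ℕ} (Ω : Set (Euc m)) (φ : Euc m → ℝ) : Set (Euc m) :=
  {x | x ∈ Ω ∧ φ x = 0}

/-- `S_φ^* = S_φ ∪ {x ∈ ∂Ω : lim_{Ω ∋ y → x} φ(y) = 0}`. -/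
def SphiStar {m : ℕ} (Ω : Set (Euc m)) (φ : Euc m → ℝ) : Set (Euc m) :=
  Sphi Ω φ ∪ {x | x ∈ frontier Ω ∧ Tendsto φ (𝓝[Ω] x) (𝓝 0)}

/-- `u_k → +∞` locally uniformly on `S`. -/
def LocUnifTop {m : ℕ} (u : ℕ → Euc m → ℝ) (S : Set (Euc m)) : Prop :=
  ∀ K : Set (Euc m), K ⊆ S → IsCompact K → ∀ C : ℝ,
    ∀ᶠ k in atTop, ∀ x ∈ K, C ≤ u k x

/-- `u_k → −∞` locally uniformly on `S`. -/
def LocUnifBot {m : ℕ} (u : ℕ → Euc m → ℝ) (S : Set (Euc m)) : Prop :=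
  ∀ K : Set (Euc m), K ⊆ S → IsCompact K → ∀ C : ℝ,
    ∀ᶠ k in atTop, ∀ x ∈ K, u k x ≤ C

/-- A bounded connected open set with smooth boundary, described by a global smooth
defining function. -/
def SmoothBoundedDomain {m : ℕ} (Ω : Set (Euc m)) : Prop :=
  IsOpen Ω ∧ IsConnected Ω ∧ Bornology.IsBounded Ω ∧
    ∃ f : Euc m → ℝ, ContDiff ℝ (⊤ : ℕ∞) f ∧ Ω = {x | f x < 0} ∧
      frontier Ω = {x | f x = 0} ∧ ∀ x ∈ frontier Ω, fderiv ℝ f x ≠ 0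




/-! ### Part 1: partial derivatives, Laplacian, integration by parts -/

/-- Partial derivative. -/
def pd {m : ℕ} (i : Fin (2*m)) (f : Euc m → ℝ) (x : Euc m) : ℝ :=
  fderiv ℝ f x (EuclideanSpace.single i (1:ℝ))

theorem lap_eq {m : ℕ} (f : Euc m → ℝ) : lap f = fun x => ∑ i, pd i (pd i f) x := rfl

theorem pd_contDiffOn {m : ℕ} (i : Fin (2*m)) {f : Euc m → ℝ} {U : Set (Euc m)} (hU : IsOpen U)
    (hf : ContDiffOn ℝ (⊤ : ℕ∞) f U) : ContDiffOn ℝ (⊤ : ℕ∞) (pd i f) U := by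
  have h : ContDiffOn ℝ (⊤ : ℕ∞) (fderiv ℝ f) U :=
    hf.fderiv_of_isOpen hU (by norm_cast)
  exact h.clm_apply contDiffOn_const

theorem lap_contDiffOn {m : ℕ} {f : Euc m → ℝ} {U : Set (Euc m)} (hU : IsOpen U)
    (hf : ContDiffOn ℝ (⊤ : ℕ∞) f U) : ContDiffOn ℝ (⊤ : ℕ∞) (lap f) U := by
  rw [lap_eq]
  exact ContDiffOn.sum fun i _ => pd_contDiffOn i hU (pd_contDiffOn i hU hf)

theorem lap_contDiff {m : ℕ} {f : Euc m → ℝ}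
    (hf : ContDiff ℝ (⊤ : ℕ∞) f) : ContDiff ℝ (⊤ : ℕ∞) (lap f) := by
  rw [← contDiffOn_univ] at *
  exact lap_contDiffOn isOpen_univ hf

theorem pd_contDiff {m : ℕ} (i : Fin (2*m)) {f : Euc m → ℝ}
    (hf : ContDiff ℝ (⊤ : ℕ∞) f) : ContDiff ℝ (⊤ : ℕ∞) (pd i f) := by
  rw [← contDiffOn_univ] at *
  exact pd_contDiffOn i isOpen_univ hf

theorem pd_test {m : ℕ} (i : Fin (2*m)) {ψ : Euc m → ℝ} {U : Set (Euc m)}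
    (h : IsTestOn U ψ) : IsTestOn U (pd i ψ) := by
  obtain ⟨h1, h2, h3⟩ := h
  refine ⟨pd_contDiff i h1, h2.fderiv_apply (𝕜 := ℝ) _, ?_⟩
  exact (tsupport_fderiv_apply_subset ℝ _).trans h3

theorem test_add {m : ℕ} {ψ χ : Euc m → ℝ} {U : Set (Euc m)}
    (h : IsTestOn U ψ) (h' : IsTestOn U χ) : IsTestOn U (fun x => ψ x + χ x) := by
  refine ⟨h.1.add h'.1, h.2.1.add h'.2.1, (tsupport_add _ _).trans (union_subset h.2.2 h'.2.2)⟩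

theorem test_zero {m : ℕ} {U : Set (Euc m)} : IsTestOn U (fun _ : Euc m => (0:ℝ)) := by
  refine ⟨contDiff_const, HasCompactSupport.zero, ?_⟩
  have : tsupport (fun _ : Euc m => (0:ℝ)) = ∅ := by
    rw [tsupport_eq_empty_iff]; rfl
  rw [this]; exact empty_subset _

theorem test_neg {m : ℕ} {ψ : Euc m → ℝ} {U : Set (Euc m)}
    (h : IsTestOn U ψ) : IsTestOn U (fun x => - ψ x) := by
  have e : Function.support (fun x => - ψ x) = Function.support ψ := by ext; simp
  refine ⟨h.1.neg, ?_, ?_⟩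
  · have := h.2.1
    rw [HasCompactSupport, tsupport] at *
    rwa [e]
  · have := h.2.2
    rw [tsupport] at *
    rwa [e]

theorem lap_test {m : ℕ} {ψ : Euc m → ℝ} {U : Set (Euc m)}
    (h : IsTestOn U ψ) : IsTestOn U (lap ψ) := by
  rw [lap_eq]
  have : ∀ s : Finset (Fin (2*m)), IsTestOn U (fun x => ∑ i ∈ s, pd i (pd i ψ) x) := by
    intro s
    induction s using Finset.induction_on with
    | empty => simpa using test_zero
    | insert a s ha ih =>
      simp only [Finset.sum_insert ha]
      exact test_add (pd_test a (pd_test a h)) ih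
  exact this _

theorem negLapPow_succ {m : ℕ} (j : ℕ) (f : Euc m → ℝ) :
    negLapPow (j+1) f = negLapPow j (fun x => -(lap f x)) := by
  simp [negLapPow, Function.iterate_succ]

theorem negLapPow_succ' {m : ℕ} (j : ℕ) (f : Euc m → ℝ) :
    negLapPow (j+1) f = fun x => - lap (negLapPow j f) x := by
  unfold negLapPow
  rw [Function.iterate_succ']; rfl

theorem negLapPow_zero {m : ℕ} (f : Euc m → ℝ) : negLapPow 0 f = f := by
  simp [negLapPow]

theorem negLapPow_test {m : ℕ} (j : ℕ) {ψ : Euc m → ℝ} {U : Set (Euc m)}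
    (h : IsTestOn U ψ) : IsTestOn U (negLapPow j ψ) := by
  induction j with
  | zero => simpa [negLapPow_zero] using h
  | succ j ih => rw [negLapPow_succ']; exact test_neg (lap_test ih)

theorem mul_test_continuous {m : ℕ} {f ψ : Euc m → ℝ} {U : Set (Euc m)} (hU : IsOpen U)
    (hf : ContinuousOn f U) (h : IsTestOn U ψ) :
    Continuous (fun x => f x * ψ x) := by
  rw [continuous_iff_continuousAt]
  intro x
  by_cases hx : x ∈ U
  · exact (hf.continuousAt (hU.mem_nhds hx)).mul h.1.continuous.continuousAt
  · have hx' : x ∉ tsupport ψ := fun h' => hx (h.2.2 h')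
    have : (fun x => f x * ψ x) =ᶠ[𝓝 x] fun _ => 0 := by
      have := notMem_tsupport_iff_eventuallyEq.1 hx'
      filter_upwards [this] with y hy
      simp [hy]
    exact (continuousAt_const).congr this.symm

theorem mul_test_integrable {m : ℕ} {f ψ : Euc m → ℝ} {U : Set (Euc m)} (hU : IsOpen U)
    (hf : ContinuousOn f U) (h : IsTestOn U ψ) :
    Integrable (fun x => f x * ψ x) :=
  (mul_test_continuous hU hf h).integrable_of_hasCompactSupport h.2.1.mul_left

theorem ibp {m : ℕ} (i : Fin (2*m)) {f ψ : Euc m → ℝ} {U : Set (Euc m)} (hU : IsOpen U)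
    (hf : ContDiffOn ℝ (⊤ : ℕ∞) f U) (h : IsTestOn U ψ) :
    ∫ x, f x * pd i ψ x = - ∫ x, pd i f x * ψ x := by
  apply integral_mul_fderiv_eq_neg_fderiv_mul_of_integrable
  · exact mul_test_integrable hU (pd_contDiffOn i hU hf).continuousOn h
  · exact mul_test_integrable hU hf.continuousOn (pd_test i h)
  · exact mul_test_integrable hU hf.continuousOn h
  · intro x hx
    exact (hf.differentiableOn (by norm_num)).differentiableAt (hU.mem_nhds (h.2.2 hx))
  · intro x _
    exact h.1.differentiable (by norm_num) x

theorem ibp_lap {m : ℕ} {f ψ : Euc m → ℝ} {U : Set (Euc m)} (hU : IsOpen U)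
    (hf : ContDiffOn ℝ (⊤ : ℕ∞) f U) (h : IsTestOn U ψ) :
    ∫ x, f x * lap ψ x = ∫ x, lap f x * ψ x := by
  rw [lap_eq, lap_eq]
  simp only [Finset.mul_sum, Finset.sum_mul]
  rw [integral_finsetSum, integral_finsetSum]
  · refine Finset.sum_congr rfl fun i _ => ?_
    rw [ibp i hU hf (pd_test i h), ibp i hU (pd_contDiffOn i hU hf) h, neg_neg]
  · intro i _
    exact mul_test_integrable hU (pd_contDiffOn i hU (pd_contDiffOn i hU hf)).continuousOn h
  · intro i _
    exact mul_test_integrable hU hf.continuousOn (pd_test i (pd_test i h))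

theorem negLapPow_contDiffOn {m : ℕ} (j : ℕ) {f : Euc m → ℝ} {U : Set (Euc m)} (hU : IsOpen U)
    (hf : ContDiffOn ℝ (⊤ : ℕ∞) f U) : ContDiffOn ℝ (⊤ : ℕ∞) (negLapPow j f) U := by
  induction j with
  | zero => simpa [negLapPow_zero] using hf
  | succ j ih => rw [negLapPow_succ']; exact (lap_contDiffOn hU ih).neg

theorem ibp_pow {m : ℕ} (j : ℕ) {f ψ : Euc m → ℝ} {U : Set (Euc m)} (hU : IsOpen U)
    (hf : ContDiffOn ℝ (⊤ : ℕ∞) f U) (h : IsTestOn U ψ) :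
    ∫ x, f x * negLapPow j ψ x = ∫ x, negLapPow j f x * ψ x := by
  induction j generalizing ψ with
  | zero => simp [negLapPow_zero]
  | succ j ih =>
    rw [negLapPow_succ, ih (test_neg (lap_test h)), negLapPow_succ']
    simp only [mul_neg, neg_mul, integral_neg]
    rw [ibp_lap hU (negLapPow_contDiffOn j hU hf) h]

theorem lap_congr {m : ℕ} {f g : Euc m → ℝ} {x : Euc m} (h : f =ᶠ[𝓝 x] g) :
    lap f x = lap g x := by
  rw [lap_eq, lap_eq]
  refine Finset.sum_congr rfl fun i _ => ?_
  have h1 : pd i f =ᶠ[𝓝 x] pd i g := by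
    filter_upwards [h.fderiv (𝕜 := ℝ)] with y hy
    simp [pd, hy]
  simp only [pd]
  have := h1.fderiv_eq (𝕜 := ℝ)
  rw [show fderiv ℝ (pd i f) x = fderiv ℝ (pd i g) x from this]

theorem lap_zero_of_zero_on {m : ℕ} {f : Euc m → ℝ} {U : Set (Euc m)} (hU : IsOpen U)
    (hf : ∀ x ∈ U, f x = 0) : ∀ x ∈ U, lap f x = 0 := by
  intro x hx
  have : f =ᶠ[𝓝 x] fun _ => 0 := by
    filter_upwards [hU.mem_nhds hx] with y hy using hf y hy
  have h0 : ∀ i : Fin (2*m), pd i (fun _ : Euc m => (0:ℝ)) = fun _ => 0 := by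
    intro i; funext y; simp [pd]
  rw [lap_congr this, lap_eq]
  simp [h0]

/-- `(-Δ)^j f` vanishes for `j ≥ 1` if `f` is harmonic. -/
theorem negLapPow_zero_of_harmonic {m : ℕ} {f : Euc m → ℝ} {U : Set (Euc m)} (hU : IsOpen U)
    (hf : ∀ x ∈ U, lap f x = 0) (j : ℕ) (hj : 1 ≤ j) : ∀ x ∈ U, negLapPow j f x = 0 := by
  induction j, hj using Nat.le_induction with
  | base =>
    intro x hx
    rw [negLapPow_succ', negLapPow_zero]
    simp [hf x hx]
  | succ j hj ih =>
    intro x hx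
    rw [negLapPow_succ']
    simp [lap_zero_of_zero_on hU ih x hx]

theorem lap_neg {m : ℕ} (f : Euc m → ℝ) (x : Euc m) : lap (fun y => - f y) x = - lap f x := by
  have h1 : ∀ i : Fin (2*m), ∀ g : Euc m → ℝ, pd i (fun y => - g y) = fun y => - pd i g y := by
    intro i g; funext y
    have : fderiv ℝ (fun y => - g y) y = - fderiv ℝ g y := fderiv_fun_neg
    simp [pd, this]
  simp only [lap_eq, h1, Finset.sum_neg_distrib]

theorem lap_const_mul {m : ℕ} {f : Euc m → ℝ} (hf : ContDiff ℝ (⊤ : ℕ∞) f) (c : ℝ) (x : Euc m) :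
    lap (fun y => c * f y) x = c * lap f x := by
  have h1 : ∀ i : Fin (2*m), ∀ g : Euc m → ℝ, ContDiff ℝ (⊤ : ℕ∞) g →
      pd i (fun y => c * g y) = fun y => c * pd i g y := by
    intro i g hg; funext y
    have : fderiv ℝ (fun y => c * g y) y = c • fderiv ℝ g y :=
      fderiv_const_mul (hg.differentiable (by norm_num) y) c
    simp [pd, this]
  simp only [lap_eq, Finset.mul_sum]
  refine Finset.sum_congr rfl fun i _ => ?_
  rw [h1 i f hf, h1 i _ (pd_contDiff i hf)]

theorem lap_add {m : ℕ} {f g : Euc m → ℝ} (hf : ContDiff ℝ (⊤ : ℕ∞) f)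
    (hg : ContDiff ℝ (⊤ : ℕ∞) g) (x : Euc m) :
    lap (fun y => f y + g y) x = lap f x + lap g x := by
  have h1 : ∀ i : Fin (2*m), ∀ f g : Euc m → ℝ, ContDiff ℝ (⊤ : ℕ∞) f → ContDiff ℝ (⊤ : ℕ∞) g →
      pd i (fun y => f y + g y) = fun y => pd i f y + pd i g y := by
    intro i f g hf hg; funext y
    have : fderiv ℝ (fun y => f y + g y) y = fderiv ℝ f y + fderiv ℝ g y :=
      fderiv_fun_add (hf.differentiable (by norm_num) y) (hg.differentiable (by norm_num) y)
    simp [pd, this]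
  simp only [lap_eq, ← Finset.sum_add_distrib]
  refine Finset.sum_congr rfl fun i _ => ?_
  rw [h1 i f g hf hg, h1 i _ _ (pd_contDiff i hf) (pd_contDiff i hg)]

/-- Chain rule for affine substitutions. -/
theorem pd_comp_affine {m : ℕ} (i : Fin (2*m)) {f : Euc m → ℝ} (hf : Differentiable ℝ f)
    (a : Euc m) (t : ℝ) : pd i (fun y => f (a + t • y)) = fun y => t * pd i f (a + t • y) := by
  funext y
  have h1 : HasFDerivAt (fun y : Euc m => a + t • y) (t • ContinuousLinearMap.id ℝ (Euc m)) y :=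
    ((hasFDerivAt_id y).const_smul t).const_add a
  have h2 := (hf (a + t • y)).hasFDerivAt.comp y h1
  have h3 : fderiv ℝ (fun y => f (a + t • y)) y = _ := h2.fderiv
  simp [pd, h3]

theorem lap_comp_affine {m : ℕ} {f : Euc m → ℝ} (hf : ContDiff ℝ (⊤ : ℕ∞) f)
    (a : Euc m) (t : ℝ) (y : Euc m) :
    lap (fun y => f (a + t • y)) y = t^2 * lap f (a + t • y) := by
  rw [lap_eq, lap_eq]
  simp only [Finset.mul_sum]
  refine Finset.sum_congr rfl fun i _ => ?_
  rw [pd_comp_affine i (hf.differentiable (by norm_num)) a t]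
  have h := (pd_contDiff i hf)
  have h1 : pd i (fun y => t * pd i f (a + t • y)) y = t * pd i (fun y => pd i f (a + t • y)) y := by
    have hd : DifferentiableAt ℝ (fun y => pd i f (a + t • y)) y := by
      have h5 : ContDiff ℝ (⊤ : ℕ∞) (fun y => pd i f (a + t • y)) := h.comp (by fun_prop)
      exact h5.differentiable (by norm_num) y
    have : fderiv ℝ (fun y => t * pd i f (a + t • y)) y = t • fderiv ℝ (fun y => pd i f (a + t • y)) y :=
      fderiv_const_mul hd t
    rw [pd, this]; simp [pd]
  rw [h1, pd_comp_affine i (h.differentiable (by norm_num)) a t]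
  ring


/-! ### Part 2: radial mollifier, mean value inequality -/

/-- Unnormalised radial bump. -/
def zet0 (m : ℕ) (y : Euc m) : ℝ := Real.smoothTransition (1 - ‖y‖^2)
/-- Unnormalised radial mollifier with `∇ zet0 = - y eta0`. -/
def eta0 (m : ℕ) (y : Euc m) : ℝ := 2 * deriv Real.smoothTransition (1 - ‖y‖^2)

theorem zet0_contDiff (m : ℕ) : ContDiff ℝ (⊤ : ℕ∞) (zet0 m) := by
  unfold zet0
  exact Real.smoothTransition.contDiff.comp (contDiff_const.sub (contDiff_norm_sq ℝ))

theorem eta0_contDiff (m : ℕ) : ContDiff ℝ (⊤ : ℕ∞) (eta0 m) := by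
  unfold eta0
  have h : ContDiff ℝ (⊤ : ℕ∞) (deriv Real.smoothTransition) := by
    have := (contDiff_infty_iff_deriv (f := Real.smoothTransition) (𝕜 := ℝ)).1
      Real.smoothTransition.contDiff
    exact this.2
  exact contDiff_const.mul (h.comp (contDiff_const.sub (contDiff_norm_sq ℝ)))

theorem zet0_zero (m : ℕ) (y : Euc m) (hy : 1 ≤ ‖y‖) : zet0 m y = 0 := by
  apply Real.smoothTransition.zero_of_nonpos
  nlinarith

theorem deriv_st_zero (t : ℝ) (ht : t ≤ 0) : deriv Real.smoothTransition t = 0 := by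
  have hc : Continuous (deriv Real.smoothTransition) := by
    have h : ContDiff ℝ 1 Real.smoothTransition := Real.smoothTransition.contDiff
    exact h.continuous_deriv (by norm_num)
  have h1 : ∀ t < 0, deriv Real.smoothTransition t = 0 := by
    intro t ht
    have : Real.smoothTransition =ᶠ[𝓝 t] fun _ => 0 := by
      filter_upwards [Iio_mem_nhds ht] with s hs
      exact Real.smoothTransition.zero_of_nonpos (le_of_lt hs)
    rw [this.deriv_eq]; simp
  have h2 : IsClosed {t | deriv Real.smoothTransition t = 0} := isClosed_eq hc continuous_const
  have h3 : Iio (0:ℝ) ⊆ {t | deriv Real.smoothTransition t = 0} := fun t ht => h1 t ht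
  have h4 := closure_minimal h3 h2
  rw [closure_Iio] at h4
  exact h4 ht

theorem st_mono : Monotone Real.smoothTransition := by
  intro s t hst
  exact Real.smoothTransition.monotone hst

theorem eta0_zero (m : ℕ) (y : Euc m) (hy : 1 ≤ ‖y‖) : eta0 m y = 0 := by
  unfold eta0
  rw [deriv_st_zero]; · simp
  nlinarith

theorem eta0_nonneg (m : ℕ) (y : Euc m) : 0 ≤ eta0 m y := by
  unfold eta0
  have := st_mono.deriv_nonneg (x := 1 - ‖y‖^2)
  linarith

theorem zet0_nonneg (m : ℕ) (y : Euc m) : 0 ≤ zet0 m y := Real.smoothTransition.nonneg _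

theorem hcs_of_zero {m : ℕ} {f : Euc m → ℝ} (R : ℝ) (h : ∀ y, R ≤ ‖y‖ → f y = 0) :
    HasCompactSupport f := by
  apply HasCompactSupport.intro (isCompact_closedBall (0 : Euc m) R)
  intro x hx
  apply h
  simp at hx
  exact hx.le

theorem norm_deriv {m : ℕ} (i : Fin (2*m)) (z y : Euc m) :
    fderiv ℝ (fun y : Euc m => ‖y - z‖^2) y (EuclideanSpace.single i (1:ℝ)) = 2 * (y i - z i) := by
  have h1 : HasFDerivAt (fun y : Euc m => y - z) (ContinuousLinearMap.id ℝ (Euc m)) y :=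
    (hasFDerivAt_id y).sub_const z
  have := h1.norm_sq
  rw [this.fderiv]
  simp [EuclideanSpace.inner_single_right]

/-- Chain rule for radial functions. -/
theorem pd_radial {m : ℕ} (i : Fin (2*m)) (z : Euc m) {F : ℝ → ℝ} {F' : ℝ} {y : Euc m}
    (hF : HasDerivAt F F' (‖y - z‖^2)) :
    pd i (fun y => F (‖y - z‖^2)) y = 2 * (y i - z i) * F' := by
  have hd : DifferentiableAt ℝ (fun y : Euc m => ‖y - z‖^2) y := by
    have : ContDiff ℝ 1 (fun y : Euc m => ‖y - z‖^2) :=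
      (contDiff_norm_sq ℝ).comp (contDiff_id.sub contDiff_const)
    exact this.differentiable (by norm_num) y
  have := hF.comp_hasFDerivAt y hd.hasFDerivAt
  have h2 : fderiv ℝ (fun y => F (‖y - z‖^2)) y = _ := this.fderiv
  rw [pd, h2]
  simp only [smul_apply, norm_deriv, smul_eq_mul]
  ring

theorem pd_zet0 {m : ℕ} (i : Fin (2*m)) (y : Euc m) : pd i (zet0 m) y = - (y i * eta0 m y) := by
  have h : HasDerivAt (fun t => Real.smoothTransition (1 - t))
      (- deriv Real.smoothTransition (1 - ‖y - 0‖^2)) (‖y - 0‖^2) := by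
    have hd : DifferentiableAt ℝ Real.smoothTransition (1 - ‖y - 0‖^2) := by
      have h : ContDiff ℝ 1 Real.smoothTransition := Real.smoothTransition.contDiff
      exact h.differentiable (by norm_num) _
    have := hd.hasDerivAt.comp (‖y - 0‖^2) ((hasDerivAt_id _).const_sub 1)
    simpa [Function.comp_def] using this
  have := pd_radial i 0 h
  simp only [sub_zero] at this
  unfold zet0 eta0
  rw [this]
  simp
  ring

theorem eta0_int_pos (m : ℕ) (hm : 1 ≤ m) : 0 < ∫ y, eta0 m y := by
  have hc := (eta0_contDiff m).continuous
  have hcs : HasCompactSupport (eta0 m) := hcs_of_zero 1 (eta0_zero m)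
  have : ∃ t ∈ Ioo (0:ℝ) 1, deriv Real.smoothTransition t = (1 - 0)/(1-0) := by
    have := exists_deriv_eq_slope Real.smoothTransition (a := 0) (b := 1) (by norm_num)
      Real.smoothTransition.continuous.continuousOn ?_
    · simpa [Real.smoothTransition.zero, Real.smoothTransition.one] using this
    · have h : ContDiff ℝ 1 Real.smoothTransition := Real.smoothTransition.contDiff
      exact (h.differentiable (by norm_num)).differentiableOn
  obtain ⟨t, ht, hdt⟩ := this
  let e : Euc m := EuclideanSpace.single ⟨0, by omega⟩ (Real.sqrt (1 - t))
  have he : 1 - ‖e‖^2 = t := by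
    simp only [e, PiLp.norm_single, Real.norm_eq_abs, sq_abs]
    rw [Real.sq_sqrt (by linarith [ht.2])]; ring
  apply hc.integral_pos_of_hasCompactSupport_nonneg_nonzero hcs (eta0_nonneg m) (x := e)
  simp only [eta0]
  rw [he, hdt]; norm_num

theorem zet0_int_pos (m : ℕ) : 0 < ∫ y, zet0 m y := by
  have hc := (zet0_contDiff m).continuous
  have hcs : HasCompactSupport (zet0 m) := hcs_of_zero 1 (zet0_zero m)
  apply hc.integral_pos_of_hasCompactSupport_nonneg_nonzero hcs (zet0_nonneg m) (x := 0)
  simp [zet0]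

/-- Normalised mollifier. -/
def eta (m : ℕ) (y : Euc m) : ℝ := (∫ z, eta0 m z)⁻¹ * eta0 m y
/-- Companion bump. -/
def zet (m : ℕ) (y : Euc m) : ℝ := (∫ z, eta0 m z)⁻¹ * zet0 m y
/-- Mass of the companion bump. -/
def kap (m : ℕ) : ℝ := ∫ y, zet m y

theorem eta_contDiff (m : ℕ) : ContDiff ℝ (⊤ : ℕ∞) (eta m) := contDiff_const.mul (eta0_contDiff m)
theorem zet_contDiff (m : ℕ) : ContDiff ℝ (⊤ : ℕ∞) (zet m) := contDiff_const.mul (zet0_contDiff m)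
theorem eta_zero (m : ℕ) (y : Euc m) (hy : 1 ≤ ‖y‖) : eta m y = 0 := by
  simp [eta, eta0_zero m y hy]
theorem zet_zero (m : ℕ) (y : Euc m) (hy : 1 ≤ ‖y‖) : zet m y = 0 := by
  simp [zet, zet0_zero m y hy]
theorem eta_hcs (m : ℕ) : HasCompactSupport (eta m) := hcs_of_zero 1 (eta_zero m)
theorem zet_hcs (m : ℕ) : HasCompactSupport (zet m) := hcs_of_zero 1 (zet_zero m)
theorem eta_nonneg (m : ℕ) (y : Euc m) : 0 ≤ eta m y :=
  mul_nonneg (inv_nonneg.2 (integral_nonneg (eta0_nonneg m))) (eta0_nonneg m y)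
theorem zet_nonneg (m : ℕ) (y : Euc m) : 0 ≤ zet m y :=
  mul_nonneg (inv_nonneg.2 (integral_nonneg (eta0_nonneg m))) (zet0_nonneg m y)
theorem eta_int (m : ℕ) (hm : 1 ≤ m) : ∫ y, eta m y = 1 := by
  unfold eta
  rw [integral_const_mul, inv_mul_cancel₀ (eta0_int_pos m hm).ne']
theorem kap_pos (m : ℕ) (hm : 1 ≤ m) : 0 < kap m := by
  unfold kap zet
  rw [integral_const_mul]
  exact mul_pos (inv_pos.2 (eta0_int_pos m hm)) (zet0_int_pos m)
theorem eta_neg (m : ℕ) (y : Euc m) : eta m (-y) = eta m y := by simp [eta, eta0]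
theorem eta_integrable (m : ℕ) : Integrable (eta m) :=
  (eta_contDiff m).continuous.integrable_of_hasCompactSupport (eta_hcs m)
theorem zet_integrable (m : ℕ) : Integrable (zet m) :=
  (zet_contDiff m).continuous.integrable_of_hasCompactSupport (zet_hcs m)
theorem zet_test (m : ℕ) : IsTestOn univ (zet m) := ⟨zet_contDiff m, zet_hcs m, subset_univ _⟩
theorem pd_zet {m : ℕ} (i : Fin (2*m)) (y : Euc m) : pd i (zet m) y = - (y i * eta m y) := by
  have hd : DifferentiableAt ℝ (zet0 m) y := (zet0_contDiff m).differentiable (by norm_num) y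
  have : fderiv ℝ (zet m) y = (∫ z, eta0 m z)⁻¹ • fderiv ℝ (zet0 m) y := fderiv_const_mul hd _
  have h2 := pd_zet0 i y
  unfold pd at h2 ⊢
  rw [this]
  simp only [smul_apply, smul_eq_mul, h2, eta]; ring

theorem fderiv_eq_sum {m : ℕ} (ψ : Euc m → ℝ) (z y : Euc m) :
    fderiv ℝ ψ z y = ∑ i, y i * pd i ψ z := by
  have : y = ∑ i, y i • (EuclideanSpace.single i (1:ℝ) : Euc m) := by
    ext j
    simp [Finset.sum_apply, Pi.single_apply]
  conv_lhs => rw [this]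
  simp [pd]

/-- Mollified average with step `s`. -/
def avg {m : ℕ} (s : ℝ) (ψ : Euc m → ℝ) (x : Euc m) : ℝ := ∫ y, ψ (x + s • y) * eta m y

theorem avg_hasDerivAt {m : ℕ} {ψ : Euc m → ℝ} (hψ : ContDiff ℝ (⊤ : ℕ∞) ψ) (x : Euc m) (s : ℝ) :
    HasDerivAt (fun s => avg s ψ x) (s * ∫ y, lap ψ (x + s • y) * zet m y) s := by
  have hc := hψ.continuous
  have hfd : Continuous (fderiv ℝ ψ) := hψ.continuous_fderiv (by norm_num)
  have he := (eta_contDiff m).continuous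
  obtain ⟨C, hC⟩ := (isCompact_closedBall x (|s| + 1)).exists_bound_of_continuousOn hfd.continuousOn
  have key := hasDerivAt_integral_of_dominated_loc_of_deriv_le (μ := (volume : Measure (Euc m)))
    (F := fun s y => ψ (x + s • y) * eta m y)
    (F' := fun s y => fderiv ℝ ψ (x + s • y) y * eta m y) (x₀ := s) (s := ball s 1)
    (bound := fun y => C * eta m y)
    (ball_mem_nhds _ one_pos) ?_ ?_ ?_ ?_ ?_ ?_
  · have h2 := key.2
    refine h2.congr_deriv ?_
    symm
    simp only [fderiv_eq_sum, Finset.sum_mul]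
    rw [integral_finsetSum]
    · rw [lap_eq]
      simp only [Finset.sum_mul]
      rw [integral_finsetSum, Finset.mul_sum]
      · refine Finset.sum_congr rfl fun i _ => ?_
        have hp := pd_contDiff i hψ
        have h5 : ContDiff ℝ (⊤ : ℕ∞) (fun y => pd i ψ (x + s • y)) := hp.comp (by fun_prop)
        have h3 := ibp i isOpen_univ h5.contDiffOn (zet_test m)
        rw [pd_comp_affine i (hp.differentiable (by norm_num)) x s] at h3
        simp only [pd_zet, mul_assoc, integral_const_mul, mul_neg, integral_neg, neg_inj] at h3
        rw [← h3]
        congr 1; funext y; ring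
      · intro i _
        apply Continuous.integrable_of_hasCompactSupport
        · have := (pd_contDiff i (pd_contDiff i hψ)).continuous
          have := (zet_contDiff m).continuous
          fun_prop
        · exact (zet_hcs m).mul_left
    · intro i _
      apply Continuous.integrable_of_hasCompactSupport
      · have := (pd_contDiff i hψ).continuous
        fun_prop
      · exact (eta_hcs m).mul_left
  · exact Eventually.of_forall fun t => (Continuous.aestronglyMeasurable (by fun_prop))
  · exact Continuous.integrable_of_hasCompactSupport (by fun_prop) (eta_hcs m).mul_left
  · apply Continuous.aestronglyMeasurable
    have : Continuous fun y => fderiv ℝ ψ (x + s • y) y :=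
      (hfd.comp (by fun_prop)).clm_apply continuous_id
    fun_prop
  · refine Eventually.of_forall fun y t ht => ?_
    by_cases hy : 1 ≤ ‖y‖
    · simp [eta_zero m y hy]
    · push Not at hy
      rw [norm_mul, Real.norm_of_nonneg (eta_nonneg m y)]
      gcongr
      · exact eta_nonneg m y
      have ht' : |t| ≤ |s| + 1 := by
        have : |t - s| < 1 := by simpa [Real.dist_eq] using ht
        have h3 := abs_sub_abs_le_abs_sub t s
        linarith
      have h1 : ‖fderiv ℝ ψ (x + t • y)‖ ≤ C := by
        apply hC
        simp [norm_smul]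
        nlinarith [abs_nonneg t, norm_nonneg y]
      calc ‖fderiv ℝ ψ (x + t • y) y‖ ≤ ‖fderiv ℝ ψ (x + t • y)‖ * ‖y‖ :=
            ContinuousLinearMap.le_opNorm _ _
        _ ≤ C * 1 := by gcongr; exact (norm_nonneg _).trans h1
        _ = C := mul_one C
  · exact (eta_integrable m).const_mul C
  · refine Eventually.of_forall fun y t _ => ?_
    have h1 : HasDerivAt (fun t : ℝ => x + t • y) y t := by
      simpa using ((hasDerivAt_id t).smul_const y).const_add x
    have h2 := ((hψ.differentiable (by norm_num) (x + t • y)).hasFDerivAt.comp_hasDerivAt t h1)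
    exact h2.mul_const _

theorem avg_zero {m : ℕ} (hm : 1 ≤ m) (ψ : Euc m → ℝ) (x : Euc m) : avg 0 ψ x = ψ x := by
  simp [avg, integral_const_mul, eta_int m hm]

/-- Mean value inequality. -/
theorem avg_ge {m : ℕ} (hm : 1 ≤ m) {ψ : Euc m → ℝ} (hψ : ContDiff ℝ (⊤ : ℕ∞) ψ) (x : Euc m)
    {r a : ℝ} (hr : 0 ≤ r) (ha : ∀ z ∈ ball x r, a ≤ lap ψ z) :
    ψ x + a * kap m * r^2 / 2 ≤ avg r ψ x := by
  have hd : ∀ s, HasDerivAt (fun s => avg s ψ x - a * kap m * s^2/2)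
      (s * ∫ y, (lap ψ (x + s • y) - a) * zet m y) s := by
    intro s
    have h1 := (avg_hasDerivAt hψ x s).sub
      ((((hasDerivAt_id s).pow 2).const_mul (a * kap m)).div_const 2)
    refine h1.congr_deriv ?_
    symm
    have : ∫ y, (lap ψ (x + s • y) - a) * zet m y = (∫ y, lap ψ (x + s • y) * zet m y) - a * kap m := by
      simp only [sub_mul]
      rw [integral_sub, integral_const_mul]; · rfl
      · apply Continuous.integrable_of_hasCompactSupport
        · have := (lap_contDiff hψ).continuous
          have := (zet_contDiff m).continuous
          fun_prop
        · exact (zet_hcs m).mul_left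
      · exact (zet_integrable m).const_mul _
    rw [this]
    simp
    ring
  have hmono : MonotoneOn (fun s => avg s ψ x - a * kap m * s^2/2) (Icc 0 r) := by
    apply monotoneOn_of_deriv_nonneg (convex_Icc 0 r)
    · exact fun s _ => (hd s).continuousAt.continuousWithinAt
    · exact fun s _ => (hd s).differentiableAt.differentiableWithinAt
    · intro s hs
      rw [interior_Icc] at hs
      rw [(hd s).deriv]
      apply mul_nonneg hs.1.le
      apply integral_nonneg
      intro y
      by_cases hy : 1 ≤ ‖y‖
      · simp [zet_zero m y hy]
      · apply mul_nonneg _ (zet_nonneg m y)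
        rw [sub_nonneg]
        apply ha
        simp [norm_smul, abs_of_pos hs.1]
        push Not at hy
        nlinarith [hs.1, hs.2]
  have := hmono (left_mem_Icc.2 hr) (right_mem_Icc.2 hr) hr
  simp only [avg_zero hm] at this
  linarith


/-! ### Part 3: the discrete Dirichlet problem -/

/-- Rescaled mollifier. -/
def mker (m : ℕ) (r : ℝ) (t : Euc m) : ℝ := (r^(2*m))⁻¹ * eta m (r⁻¹ • t)

theorem mker_contDiff (m : ℕ) (r : ℝ) : ContDiff ℝ (⊤ : ℕ∞) (mker m r) :=
  contDiff_const.mul ((eta_contDiff m).comp (contDiff_id.const_smul _))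

theorem mker_zero {m : ℕ} {r : ℝ} (hr : 0 < r) (t : Euc m) (ht : r ≤ ‖t‖) : mker m r t = 0 := by
  rw [mker, eta_zero, mul_zero]
  rw [norm_smul, norm_inv, Real.norm_of_nonneg hr.le, inv_mul_eq_div, le_div_iff₀ hr]
  linarith

theorem mker_hcs {m : ℕ} {r : ℝ} (hr : 0 < r) : HasCompactSupport (mker m r) :=
  hcs_of_zero r (mker_zero hr)

theorem mker_neg (m : ℕ) (r : ℝ) (t : Euc m) : mker m r (-t) = mker m r t := by
  simp [mker, eta_neg]

theorem mker_nonneg {m : ℕ} {r : ℝ} (hr : 0 < r) (t : Euc m) : 0 ≤ mker m r t :=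
  mul_nonneg (by positivity) (eta_nonneg m _)

theorem avg_eq {m : ℕ} {r : ℝ} (hr : 0 < r) (v : Euc m → ℝ) (x : Euc m) :
    avg r v x = ∫ z, v z * mker m r (x - z) := by
  have h1 := Measure.integral_comp_inv_smul_of_nonneg (volume : Measure (Euc m))
    (fun y => v (x + r • y) * eta m y) hr.le
  have h2 := integral_sub_right_eq_self (μ := (volume : Measure (Euc m)))
    (fun z => v (x + r • r⁻¹ • z) * eta m (r⁻¹ • z)) x
  rw [h1] at h2
  have h3 : ∀ z, x + r • r⁻¹ • (z - x) = z := by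
    intro z; rw [smul_smul, mul_inv_cancel₀ hr.ne']; simp
  simp only [h3, finrank_euclideanSpace, Fintype.card_fin, smul_eq_mul] at h2
  have h4 : avg r v x = (r^(2*m))⁻¹ * ∫ z, v z * eta m (r⁻¹ • (z - x)) := by
    rw [h2, avg, ← mul_assoc, inv_mul_cancel₀ (by positivity), one_mul]
  rw [h4, ← integral_const_mul]
  congr 1; funext z
  rw [← mker_neg m r (x - z), mker, neg_sub]; ring

theorem avg_contDiff {m : ℕ} {r : ℝ} (hr : 0 < r) {v : Euc m → ℝ} (hv : LocallyIntegrable v) :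
    ContDiff ℝ (⊤ : ℕ∞) (avg r v) := by
  have h := (mker_hcs (m := m) hr).contDiff_convolution_right (ContinuousLinearMap.mul ℝ ℝ) hv
    (mker_contDiff m r)
  convert h using 1
  funext x
  rw [avg_eq hr]; rfl

theorem bdd_locInt {m : ℕ} {v : Euc m → ℝ} (hv : Measurable v) {M : ℝ} (hM : ∀ x, |v x| ≤ M) :
    LocallyIntegrable v := by
  have : LocallyIntegrable (fun _ : Euc m => M) := continuous_const.locallyIntegrable
  exact this.mono hv.aestronglyMeasurable (Eventually.of_forall fun x => by
    rw [Real.norm_eq_abs, Real.norm_eq_abs]; exact (hM x).trans (le_abs_self M))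

theorem avg_integrable {m : ℕ} {v : Euc m → ℝ} (hv : Measurable v) {M : ℝ} (hM : ∀ x, |v x| ≤ M)
    (r : ℝ) (x : Euc m) : Integrable (fun y => v (x + r • y) * eta m y) := by
  apply (eta_integrable m).bdd_mul (c := M)
  · exact (hv.comp (by fun_prop)).aestronglyMeasurable
  · exact Eventually.of_forall fun y => hM _

theorem avg_mono {m : ℕ} {v v' : Euc m → ℝ} (hv : Measurable v) (hv' : Measurable v') {M : ℝ}
    (hM : ∀ x, |v x| ≤ M) (hM' : ∀ x, |v' x| ≤ M) {r : ℝ} {x : Euc m}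
    (h : ∀ y, ‖y‖ < 1 → v (x + r • y) ≤ v' (x + r • y)) :
    avg r v x ≤ avg r v' x := by
  apply integral_mono (avg_integrable hv hM r x) (avg_integrable hv' hM' r x)
  intro y
  by_cases hy : 1 ≤ ‖y‖
  · simp [eta_zero m y hy]
  · exact mul_le_mul_of_nonneg_right (h y (not_le.1 hy)) (eta_nonneg m y)

theorem avg_const {m : ℕ} (hm : 1 ≤ m) (c r : ℝ) (x : Euc m) : avg r (fun _ => c) x = c := by
  simp [avg, integral_const_mul, eta_int m hm]

open Classical in
/-- Iterates of the stopped random walk operator. -/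
def wk {m : ℕ} (Ω : Set (Euc m)) (G : Euc m → ℝ) (r : ℝ) : ℕ → Euc m → ℝ
  | 0 => fun _ => -1
  | (j+1) => fun x => if x ∈ Ω then avg r (wk Ω G r j) x else G x

theorem abs_le_one {a : ℝ} (h : -1 ≤ a ∧ a ≤ 0) : |a| ≤ 1 := by
  rw [abs_le]; constructor <;> linarith [h.1, h.2]

theorem wk_spec {m : ℕ} (hm : 1 ≤ m) {Ω : Set (Euc m)} (hΩ : IsOpen Ω) {G : Euc m → ℝ}
    (hG : Continuous G) (hG1 : ∀ x, -1 ≤ G x ∧ G x ≤ 0) {r : ℝ} (hr : 0 < r) (j : ℕ) :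
    Measurable (wk Ω G r j) ∧ (∀ x, -1 ≤ wk Ω G r j x ∧ wk Ω G r j x ≤ 0) := by
  induction j with
  | zero => exact ⟨measurable_const, fun x => by simp [wk]⟩
  | succ j ih =>
    obtain ⟨h1, h2⟩ := ih
    have hb := fun x => abs_le_one (h2 x)
    constructor
    · exact Measurable.ite hΩ.measurableSet
        (avg_contDiff hr (bdd_locInt h1 hb)).continuous.measurable hG.measurable
    · intro x
      simp only [wk]
      split_ifs
      · constructor
        · rw [← avg_const hm (-1) r x]
          exact avg_mono measurable_const h1 (M := 1) (by simp) hb (fun y _ => (h2 _).1)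
        · rw [← avg_const hm 0 r x]
          exact avg_mono h1 measurable_const (M := 1) hb (by simp) (fun y _ => (h2 _).2)
      · exact hG1 x

theorem wk_mono {m : ℕ} (hm : 1 ≤ m) {Ω : Set (Euc m)} (hΩ : IsOpen Ω) {G : Euc m → ℝ}
    (hG : Continuous G) (hG1 : ∀ x, -1 ≤ G x ∧ G x ≤ 0) {r : ℝ} (hr : 0 < r) (j : ℕ) (x : Euc m) :
    wk Ω G r j x ≤ wk Ω G r (j+1) x := by
  induction j generalizing x with
  | zero => exact ((wk_spec hm hΩ hG hG1 hr 1).2 x).1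
  | succ j ih =>
    simp only [wk]
    split_ifs
    · exact avg_mono (wk_spec hm hΩ hG hG1 hr j).1 (wk_spec hm hΩ hG hG1 hr (j+1)).1 (M := 1)
        (fun x => abs_le_one ((wk_spec hm hΩ hG hG1 hr j).2 x))
        (fun x => abs_le_one ((wk_spec hm hΩ hG hG1 hr (j+1)).2 x)) (fun y _ => ih _)
    · exact le_rfl

theorem exists_walk {m : ℕ} (hm : 1 ≤ m) {Ω : Set (Euc m)} (hΩ : IsOpen Ω) {G : Euc m → ℝ}
    (hG : Continuous G) (hG1 : ∀ x, -1 ≤ G x ∧ G x ≤ 0) {r : ℝ} (hr : 0 < r) :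
    ∃ w : Euc m → ℝ, Measurable w ∧ (∀ x, -1 ≤ w x ∧ w x ≤ 0) ∧ (∀ x ∈ Ω, w x = avg r w x) ∧
      ∀ x ∉ Ω, w x = G x := by
  have hs := wk_spec hm hΩ hG hG1 hr
  have hmono : ∀ x, Monotone (fun j => wk Ω G r j x) := fun x =>
    monotone_nat_of_le_succ fun j => wk_mono hm hΩ hG hG1 hr j x
  have hbdd : ∀ x, BddAbove (range fun j => wk Ω G r j x) := fun x =>
    ⟨0, by rintro _ ⟨j, rfl⟩; exact ((hs j).2 x).2⟩
  have ht : ∀ x, Tendsto (fun j => wk Ω G r j x) atTop (𝓝 (⨆ j, wk Ω G r j x)) := fun x =>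
    tendsto_atTop_ciSup (hmono x) (hbdd x)
  refine ⟨fun x => ⨆ j, wk Ω G r j x, ?_, ?_, ?_, ?_⟩
  · exact measurable_of_tendsto_metrizable (fun j => (hs j).1) (tendsto_pi_nhds.2 ht)
  · intro x
    constructor
    · exact le_ciSup_of_le (hbdd x) 0 ((hs 0).2 x).1
    · exact ciSup_le fun j => ((hs j).2 x).2
  · intro x hx
    have h1 : Tendsto (fun j => wk Ω G r (j+1) x) atTop (𝓝 (⨆ j, wk Ω G r j x)) :=
      (ht x).comp (tendsto_add_atTop_nat 1)
    have h2 : Tendsto (fun j => avg r (wk Ω G r j) x) atTop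
        (𝓝 (avg r (fun x => ⨆ j, wk Ω G r j x) x)) := by
      apply tendsto_integral_of_dominated_convergence (eta m)
      · intro j
        exact (avg_integrable (hs j).1 (fun x => abs_le_one ((hs j).2 x)) r x).aestronglyMeasurable
      · exact eta_integrable m
      · intro j
        refine Eventually.of_forall fun y => ?_
        rw [norm_mul, Real.norm_of_nonneg (eta_nonneg m y)]
        have := abs_le_one ((hs j).2 (x + r • y))
        rw [Real.norm_eq_abs]
        nlinarith [eta_nonneg m y]
      · exact Eventually.of_forall fun y => (ht _).mul_const _
    refine tendsto_nhds_unique h1 (h2.congr fun j => ?_)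
    simp [wk, hx]
  · intro x hx
    have h1 : Tendsto (fun j => wk Ω G r (j+1) x) atTop (𝓝 (⨆ j, wk Ω G r j x)) :=
      (ht x).comp (tendsto_add_atTop_nat 1)
    refine tendsto_nhds_unique h1 (tendsto_const_nhds.congr fun j => ?_)
    simp [wk, hx]

theorem walk_compare {m : ℕ} (hm : 1 ≤ m) {Ω : Set (Euc m)} (hΩb : IsBounded Ω)
    {G : Euc m → ℝ} {r : ℝ} (hr : 0 < r) {w : Euc m → ℝ} (hw : Measurable w)
    (hw1 : ∀ x, |w x| ≤ 1) (hw2 : ∀ x ∈ Ω, w x = avg r w x) (hw3 : ∀ x ∉ Ω, w x = G x)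
    {L : Euc m → ℝ} (hL : ContDiff ℝ (⊤ : ℕ∞) L) {a : ℝ} (ha : 0 < a)
    (hL1 : ∀ x ∈ closure Ω, ∀ z ∈ ball x r, a ≤ lap L z)
    (hL2 : ∀ x ∈ closure Ω, ∀ z ∈ ball x r, z ∉ Ω → L z < G z) :
    ∀ x ∈ Ω, L x ≤ w x := by
  by_contra! hcon
  obtain ⟨x0, hx0, hx0'⟩ := hcon
  have hc : Continuous (avg r w) := (avg_contDiff hr (bdd_locInt hw hw1)).continuous
  have hcomp : IsCompact (closure Ω) := hΩb.isCompact_closure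
  obtain ⟨x, hx, hmax⟩ := hcomp.exists_isMaxOn ⟨x0, subset_closure hx0⟩
    (f := fun x => L x - avg r w x) (hL.continuous.sub hc).continuousOn
  set s := L x - avg r w x with hs
  have hs0 : 0 < s := by
    have := hmax (subset_closure hx0)
    simp only [mem_ofPred_eq] at this
    rw [← hw2 x0 hx0] at this
    linarith
  have hLi : Integrable (fun y => L (x + r • y) * eta m y) := by
    apply Continuous.integrable_of_hasCompactSupport
    · have := hL.continuous
      have := (eta_contDiff m).continuous
      fun_prop
    · exact (eta_hcs m).mul_left
  have h1 : avg r L x - avg r w x ≤ s := by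
    rw [avg, avg, ← integral_sub hLi (avg_integrable hw hw1 r x)]
    calc _ ≤ ∫ y, s * eta m y := by
          apply integral_mono (hLi.sub (avg_integrable hw hw1 r x)) ((eta_integrable m).const_mul s)
          intro y
          simp only
          by_cases hy : 1 ≤ ‖y‖
          · simp [eta_zero m y hy]
          show L (x + r • y) * eta m y - w (x + r • y) * eta m y ≤ s * eta m y
          rw [← sub_mul]
          apply mul_le_mul_of_nonneg_right _ (eta_nonneg m y)
          have hb : x + r • y ∈ ball x r := by
            simp [norm_smul, abs_of_pos hr]
            push Not at hy
            nlinarith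
          by_cases hyΩ : x + r • y ∈ Ω
          · have := hmax (subset_closure hyΩ)
            simp only [mem_ofPred_eq] at this
            rw [← hw2 _ hyΩ] at this
            exact this
          · have := hL2 x hx _ hb hyΩ
            rw [hw3 _ hyΩ]; linarith
      _ = s := by rw [integral_const_mul, eta_int m hm, mul_one]
  have h2 := avg_ge hm hL x hr.le (hL1 x hx)
  have h3 : 0 < a * kap m * r^2/2 := by have := kap_pos m hm; positivity
  linarith


/-! ### Part 4: weak limits and harmonicity -/

theorem weak_limit {m : ℕ} {Ω : Set (Euc m)} (hΩ : IsOpen Ω) (hΩb : IsBounded Ω)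
    {w : ℕ → Euc m → ℝ} (hw : ∀ k, Measurable (w k)) (hw1 : ∀ k x, |w k x| ≤ 1) :
    ∃ W : Euc m → ℝ, Integrable W ∧ (∀ x ∉ Ω, W x = 0) ∧
      ∀ f : Euc m → ℝ, Continuous f →
        Tendsto (fun k => ∫ x in Ω, w k x * f x) (hyperfilter ℕ : Filter ℕ) (𝓝 (∫ x, W x * f x)) := by
  set μ := (volume : Measure (Euc m)).restrict Ω with hμ
  have : IsFiniteMeasure μ := ⟨by rw [hμ, Measure.restrict_apply_univ]; exact hΩb.measure_lt_top⟩
  have hmem : ∀ k, MemLp (w k) 2 μ := fun k =>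
    MemLp.of_bound (hw k).aestronglyMeasurable 1 (Eventually.of_forall fun x => hw1 k x)
  let T : ℕ → WeakDual ℝ (Lp ℝ 2 μ) := fun k =>
    StrongDual.toWeakDual (InnerProductSpace.toDual ℝ (Lp ℝ 2 μ) ((hmem k).toLp))
  obtain ⟨R, hR⟩ : ∃ R : ℝ, ∀ k, ‖(hmem k).toLp‖ ≤ R := by
    refine ⟨(eLpNorm (fun _ : Euc m => (1:ℝ)) 2 μ).toReal, fun k => ?_⟩
    rw [Lp.norm_toLp]
    apply ENNReal.toReal_mono
    · exact (memLp_const (1:ℝ)).2.ne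
    · apply eLpNorm_mono; intro x; simpa using hw1 k x
  have hcpt := WeakDual.isCompact_closedBall (𝕜 := ℝ) (E := Lp ℝ 2 μ) 0 R
  obtain ⟨T0, hT0, hlim⟩ := hcpt.ultrafilter_le_nhds ((hyperfilter ℕ).map T) (by
    rw [le_principal_iff, Ultrafilter.coe_map, mem_map]
    refine Filter.univ_mem' fun k => ?_
    simp only [T, mem_preimage, mem_closedBall, dist_zero_right]
    show ‖(InnerProductSpace.toDual ℝ (Lp ℝ 2 μ)) ((hmem k).toLp)‖ ≤ R
    rw [LinearIsometryEquiv.norm_map]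
    exact hR k)
  set W := (InnerProductSpace.toDual ℝ (Lp ℝ 2 μ)).symm (WeakDual.toStrongDual T0) with hW
  have hWi : Integrable (W : Euc m → ℝ) μ := (Lp.memLp W).integrable (by norm_num)
  refine ⟨Ω.indicator W, ?_, fun x hx => indicator_of_notMem hx _, ?_⟩
  · rw [integrable_indicator_iff hΩ.measurableSet]; exact hWi
  · intro f hf
    obtain ⟨M, hM⟩ := hΩb.isCompact_closure.exists_bound_of_continuousOn hf.continuousOn
    have hfm : MemLp f 2 μ := MemLp.of_bound hf.aestronglyMeasurable M (by
      rw [hμ, ae_restrict_iff' hΩ.measurableSet]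
      exact Eventually.of_forall fun x hx => hM x (subset_closure hx))
    have h1 : Tendsto (fun k => T k hfm.toLp) (hyperfilter ℕ : Filter ℕ) (𝓝 (T0 hfm.toLp)) := by
      have h2 : Tendsto T (hyperfilter ℕ : Filter ℕ) (𝓝 T0) := hlim
      exact ((WeakDual.eval_continuous hfm.toLp).tendsto T0).comp h2
    have h3 : ∀ k, T k hfm.toLp = ∫ x in Ω, w k x * f x := by
      intro k
      show inner ℝ ((hmem k).toLp) hfm.toLp = _
      rw [L2.inner_def]
      apply integral_congr_ae
      filter_upwards [(hmem k).coeFn_toLp, hfm.coeFn_toLp] with x h1 h2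
      rw [h1, h2]; simp [mul_comm]
    have h4 : T0 hfm.toLp = ∫ x, Ω.indicator W x * f x := by
      have : T0 hfm.toLp = inner ℝ W hfm.toLp := by
        rw [hW, InnerProductSpace.toDual_symm_apply]; rfl
      rw [this, L2.inner_def]
      have h5 : ∀ x, Ω.indicator W x * f x = Ω.indicator (fun x => W x * f x) x := by
        intro x; by_cases hx : x ∈ Ω <;> simp [hx]
      simp_rw [h5]
      rw [integral_indicator hΩ.measurableSet]
      apply integral_congr_ae
      filter_upwards [hfm.coeFn_toLp] with x h2
      rw [h2]; simp [mul_comm]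
    rw [h4] at h1
    exact h1.congr h3


theorem mker_bdd {m : ℕ} {r : ℝ} (hr : 0 < r) : ∃ M, ∀ t : Euc m, ‖mker m r t‖ ≤ M :=
  (mker_contDiff m r).continuous.bounded_above_of_compact_support (mker_hcs hr)

theorem avg_symm {m : ℕ} {r : ℝ} (hr : 0 < r) {v ψ : Euc m → ℝ} (hv : LocallyIntegrable v)
    (hψ : Continuous ψ) (hc : HasCompactSupport ψ) :
    ∫ x, avg r v x * ψ x = ∫ z, v z * avg r ψ z := by
  obtain ⟨R, hR⟩ := hc.isCompact.isBounded.subset_closedBall (0 : Euc m)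
  have hψ0 : ∀ x, R < ‖x‖ → ψ x = 0 := by
    intro x hx
    by_contra h
    have := hR (subset_tsupport _ h)
    simp at this; linarith
  set K : Set (Euc m) := closedBall 0 (R + r)
  have hvK : Integrable (K.indicator v) := by
    rw [integrable_indicator_iff measurableSet_closedBall]
    exact hv.integrableOn_isCompact (isCompact_closedBall _ _)
  have key : ∀ x z, v z * mker m r (x - z) * ψ x = mker m r (x - z) * (ψ x * K.indicator v z) := by
    intro x z
    by_cases hz : z ∈ K
    · simp [hz]; ring
    · by_cases hx : R < ‖x‖
      · simp [hψ0 x hx]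
      · rw [mker_zero hr]
        · simp
        · simp [K] at hz
          have := norm_sub_norm_le z x
          rw [norm_sub_rev] at this
          linarith
  have hInteg : Integrable (fun p : Euc m × Euc m => v p.2 * mker m r (p.1 - p.2) * ψ p.1)
      (volume.prod volume) := by
    simp_rw [key]
    obtain ⟨M, hM⟩ := mker_bdd (m := m) hr
    apply Integrable.bdd_mul (c := M)
    · exact (hψ.integrable_of_hasCompactSupport hc).mul_prod hvK
    · exact ((mker_contDiff m r).continuous.comp (by fun_prop)).aestronglyMeasurable
    · exact Eventually.of_forall fun p => hM _
  have h1 : ∫ x, avg r v x * ψ x = ∫ x, ∫ z, v z * mker m r (x - z) * ψ x := by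
    congr 1; funext x; rw [avg_eq hr, integral_mul_const]
  rw [h1, integral_integral_swap hInteg]
  congr 1; funext z
  rw [avg_eq hr, ← integral_const_mul]
  congr 1; funext x
  rw [← mker_neg m r (x - z), neg_sub]; ring

theorem avg_comm {m : ℕ} {r s : ℝ} (hr : 0 < r) (hs : 0 < s) {v : Euc m → ℝ}
    (hv : LocallyIntegrable v) (x : Euc m) : avg r (avg s v) x = avg s (avg r v) x := by
  have hc : ∀ (t : ℝ), 0 < t → HasCompactSupport (fun z => mker m t (x - z)) := fun t ht =>
    (mker_hcs ht).comp_homeomorph (Homeomorph.subLeft x)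
  have hcont : ∀ t, Continuous (fun z => mker m t (x - z)) := fun t =>
    (mker_contDiff m t).continuous.comp (by fun_prop)
  rw [avg_eq hr, avg_eq hs, avg_symm hs hv (hcont r) (hc r hr), avg_symm hr hv (hcont s) (hc s hs)]
  congr 1; funext z
  rw [avg_eq hr, avg_eq hs, ← integral_sub_left_eq_self _ volume (x + z)]
  congr 2; funext y
  rw [← mker_neg m r, ← mker_neg m s]
  rw [mul_comm]
  congr 2 <;> abel

theorem avg_zero_of {m : ℕ} {r : ℝ} (hr : 0 < r) {ψ : Euc m → ℝ} {x : Euc m}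
    (h : ∀ z ∈ ball x r, ψ z = 0) : avg r ψ x = 0 := by
  rw [avg]
  apply integral_eq_zero_of_ae
  refine Eventually.of_forall fun y => ?_
  by_cases hy : 1 ≤ ‖y‖
  · simp [eta_zero m y hy]
  · simp only [Pi.zero_apply]
    rw [h, zero_mul]
    simp [norm_smul, abs_of_pos hr]
    push Not at hy
    nlinarith

theorem avg_neg {m : ℕ} (r : ℝ) (ψ : Euc m → ℝ) (x : Euc m) :
    avg r (fun z => - ψ z) x = - avg r ψ x := by
  simp [avg, integral_neg]

theorem avg_near {m : ℕ} (hm : 1 ≤ m) {ψ : Euc m → ℝ} (hψ : ContDiff ℝ (⊤ : ℕ∞) ψ) (x : Euc m)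
    {r ε : ℝ} (hr : 0 ≤ r) (h : ∀ z ∈ ball x r, |lap ψ z - lap ψ x| ≤ ε) :
    |avg r ψ x - ψ x - kap m * r^2/2 * lap ψ x| ≤ kap m * r^2/2 * ε := by
  have h1 := avg_ge hm hψ x hr (a := lap ψ x - ε) fun z hz => by linarith [(abs_le.1 (h z hz)).1]
  have h2 := avg_ge hm hψ.neg x hr (a := - lap ψ x - ε) fun z hz => by
    have e : lap (fun y => - ψ y) z = - lap ψ z := lap_neg ψ z
    show _ ≤ lap (fun y => - ψ y) z
    rw [e]
    linarith [(abs_le.1 (h z hz)).2]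
  rw [avg_neg r ψ x] at h2
  rw [abs_le]
  constructor <;> nlinarith

theorem weak_harm {m : ℕ} (hm : 1 ≤ m) {Ω : Set (Euc m)} (hΩ : IsOpen Ω) (hΩb : IsBounded Ω)
    {w : ℕ → Euc m → ℝ} (hw : ∀ k, Measurable (w k)) (hw1 : ∀ k x, |w k x| ≤ 1)
    {r : ℕ → ℝ} (hr : ∀ k, 0 < r k) (hr0 : Tendsto r atTop (𝓝 0))
    (hwa : ∀ k, ∀ x ∈ Ω, w k x = avg (r k) (w k) x)
    {W : Euc m → ℝ}
    (hW : ∀ f : Euc m → ℝ, Continuous f →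
        Tendsto (fun k => ∫ x in Ω, w k x * f x) (hyperfilter ℕ : Filter ℕ) (𝓝 (∫ x, W x * f x)))
    {ψ : Euc m → ℝ} (hψ : IsTestOn Ω ψ) : ∫ x, W x * lap ψ x = 0 := by
  have hl := lap_test hψ
  have hlc : Continuous (lap ψ) := hl.1.continuous
  refine tendsto_nhds_unique (hW _ hlc) ?_
  have hle : (hyperfilter ℕ : Filter ℕ) ≤ atTop := Nat.hyperfilter_le_atTop
  refine Tendsto.mono_left ?_ hle
  rw [Metric.tendsto_atTop']
  intro e he
  have huc := hl.2.1.uniformContinuous_of_continuous hlc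
  rw [Metric.uniformContinuous_iff] at huc
  set A := (volume : Measure (Euc m)).real Ω
  have hA : 0 ≤ A := measureReal_nonneg
  obtain ⟨δ, hδ, huc⟩ := huc (e / (A + 1)) (by positivity)
  obtain ⟨δ', hδ', hth⟩ := hψ.2.1.isCompact.exists_cthickening_subset_open hΩ hψ.2.2
  obtain ⟨N, hN⟩ := (Metric.tendsto_atTop.1 hr0) (min δ δ') (lt_min hδ hδ')
  refine ⟨N, fun k hk => ?_⟩
  have hrk := hr k
  have hk' := hN k hk.le
  rw [Real.dist_eq, sub_zero, abs_of_pos hrk, lt_min_iff] at hk'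
  have hψ0 : ∀ x ∉ Ω, ψ x = 0 := fun x hx => by
    by_contra h; exact hx (hψ.2.2 (subset_tsupport _ h))
  have hav0 : ∀ x ∉ Ω, avg (r k) ψ x = 0 := by
    intro x hx
    apply avg_zero_of hrk
    intro z hz
    by_contra h
    apply hx
    apply hth
    apply mem_cthickening_of_dist_le x z δ' _ (subset_tsupport _ h)
    rw [mem_ball, dist_comm] at hz
    linarith
  have h1 : ∫ x in Ω, w k x * ψ x = ∫ x in Ω, w k x * avg (r k) ψ x := by
    rw [setIntegral_eq_integral_of_forall_compl_eq_zero (fun x hx => by rw [hψ0 x hx, mul_zero]),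
      setIntegral_eq_integral_of_forall_compl_eq_zero (fun x hx => by rw [hav0 x hx, mul_zero]),
      ← avg_symm hrk (bdd_locInt (hw k) (hw1 k)) hψ.1.continuous hψ.2.1]
    congr 1; funext x
    by_cases hx : x ∈ Ω
    · rw [← hwa k x hx]
    · rw [hψ0 x hx, mul_zero, mul_zero]
  have hInteg : ∀ f : Euc m → ℝ, Continuous f → IntegrableOn (fun x => w k x * f x) Ω := by
    intro f hf
    apply Integrable.bdd_mul (c := 1)
    · exact (hf.continuousOn.integrableOn_compact hΩb.isCompact_closure).mono_set subset_closure
    · exact (hw k).aestronglyMeasurable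
    · exact Eventually.of_forall fun x => hw1 k x
  have hac : Continuous (avg (r k) ψ) :=
    (avg_contDiff hrk hψ.1.continuous.locallyIntegrable).continuous
  have hc : 0 < kap m * r k^2/2 := by have := kap_pos m hm; positivity
  set c := kap m * r k^2/2
  have h2 : c * ∫ x in Ω, w k x * lap ψ x
      = - ∫ x in Ω, w k x * (avg (r k) ψ x - ψ x - c * lap ψ x) := by
    have e1 : ∀ x, w k x * (avg (r k) ψ x - ψ x - c * lap ψ x)
      = w k x * avg (r k) ψ x - w k x * ψ x - c * (w k x * lap ψ x) := fun x => by ring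
    simp_rw [e1]
    rw [integral_sub (f := fun x => w k x * avg (r k) ψ x - w k x * ψ x)
      ((hInteg _ hac).sub (hInteg _ hψ.1.continuous)) ((hInteg _ hlc).const_mul c),
      integral_sub (hInteg _ hac) (hInteg _ hψ.1.continuous), integral_const_mul, h1]
    ring
  have h3 : ‖∫ x in Ω, w k x * (avg (r k) ψ x - ψ x - c * lap ψ x)‖ ≤ c * (e/(A+1)) * A := by
    apply norm_setIntegral_le_of_norm_le_const hΩb.measure_lt_top
    intro x hx
    have := avg_near hm hψ.1 x hrk.le (ε := e/(A+1)) fun z hz => (huc (lt_trans hz hk'.1)).le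
    rw [norm_mul, Real.norm_eq_abs, Real.norm_eq_abs]
    calc |w k x| * _ ≤ 1 * (c * (e/(A+1))) := by
          apply mul_le_mul (hw1 k x) this (abs_nonneg _) zero_le_one
      _ = _ := one_mul _
  rw [Real.dist_eq, sub_zero]
  have h4 : c * |∫ x in Ω, w k x * lap ψ x| ≤ c * (e/(A+1)*A) := by
    rw [← abs_of_pos hc, ← abs_mul, abs_of_pos hc, h2, abs_neg]
    rw [← mul_assoc]; exact h3
  have h5 : e/(A+1)*A < e := by
    rw [div_mul_eq_mul_div, div_lt_iff₀ (by positivity)]; nlinarith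
  exact lt_of_le_of_lt (le_of_mul_le_mul_left h4 hc) h5


theorem pd_conv {m : ℕ} (i : Fin (2*m)) {v g : Euc m → ℝ} (hv : LocallyIntegrable v)
    (hg : ContDiff ℝ (⊤ : ℕ∞) g) (hc : HasCompactSupport g) :
    pd i (fun x => ∫ z, v z * g (x - z)) = fun x => ∫ z, v z * pd i g (x - z) := by
  funext x
  have h := hc.hasFDerivAt_convolution_right (ContinuousLinearMap.mul ℝ ℝ) hv
    (hg.of_le (by exact_mod_cast le_top)) x
  have h2 := convolution_precompR_apply (ContinuousLinearMap.mul ℝ ℝ) hv (hc.fderiv ℝ)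
    (hg.continuous_fderiv (by simp)) x (EuclideanSpace.single i (1:ℝ))
  have h3 : pd i (fun x => ∫ z, v z * g (x - z)) x = _ := congrArg
    (fun T : Euc m →L[ℝ] ℝ => T (EuclideanSpace.single i (1:ℝ))) h.fderiv
  rw [h3]
  exact h2

theorem lap_avg {m : ℕ} {r : ℝ} (hr : 0 < r) {v : Euc m → ℝ} (hv : LocallyIntegrable v) (x : Euc m) :
    lap (avg r v) x = ∫ z, v z * lap (fun z => mker m r (x - z)) z := by
  have e : avg r v = fun x => ∫ z, v z * mker m r (x - z) := funext fun x => avg_eq hr v x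
  have hg := mker_contDiff m r
  have hc := mker_hcs (m := m) hr
  have h1 : ∀ i, pd i (pd i (avg r v)) x = ∫ z, v z * pd i (pd i (mker m r)) (x - z) := by
    intro i
    rw [e, pd_conv i hv hg hc, pd_conv i hv (pd_contDiff i hg)
      (pd_test i (U := univ) ⟨hg, hc, subset_univ _⟩).2.1]
  rw [lap_eq]
  simp only [h1]
  rw [← integral_finsetSum]
  · congr 1; funext z
    rw [← Finset.mul_sum]
    congr 1
    have := lap_comp_affine hg x (-1) z
    simp only [neg_smul, one_smul, ← sub_eq_add_neg] at this
    rw [this]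
    simp [lap_eq]
  · intro i _
    have ht := pd_test i (pd_test i (U := univ) ⟨hg, hc, subset_univ _⟩)
    have := hv.integrable_smul_left_of_hasCompactSupport (g := fun z => pd i (pd i (mker m r)) (x - z))
      (ht.1.continuous.comp (by fun_prop)) (ht.2.1.comp_homeomorph (Homeomorph.subLeft x))
    simpa [mul_comm] using this

theorem lap_avg_zero {m : ℕ} {Ω : Set (Euc m)} {W : Euc m → ℝ} (hWi : LocallyIntegrable W)
    (hW : ∀ ψ, IsTestOn Ω ψ → ∫ x, W x * lap ψ x = 0) {r : ℝ} (hr : 0 < r) {x : Euc m}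
    (hx : closedBall x r ⊆ Ω) : lap (avg r W) x = 0 := by
  rw [lap_avg hr hWi]
  apply hW
  refine ⟨(mker_contDiff m r).comp (contDiff_const.sub contDiff_id),
    (mker_hcs hr).comp_homeomorph (Homeomorph.subLeft x), subset_trans ?_ hx⟩
  apply closure_minimal _ isClosed_closedBall
  intro z hz
  by_contra h
  apply hz
  apply mker_zero hr
  rw [mem_closedBall, not_le, dist_comm, dist_eq_norm] at h
  exact h.le

theorem mean_eq {m : ℕ} (hm : 1 ≤ m) {f : Euc m → ℝ} (hf : ContDiff ℝ (⊤ : ℕ∞) f) {x : Euc m}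
    {r : ℝ} (hr : 0 ≤ r) (h : ∀ z ∈ ball x r, lap f z = 0) : avg r f x = f x := by
  by_cases hr0 : r = 0
  · rw [hr0, avg_zero hm]
  have hx := h x (mem_ball_self (lt_of_le_of_ne hr (Ne.symm hr0)))
  have := avg_near hm hf x (ε := 0) hr (fun z hz => by rw [h z hz, hx]; simp)
  rw [hx] at this
  simp at this
  linarith

theorem avg_avg {m : ℕ} (hm : 1 ≤ m) {Ω : Set (Euc m)} {W : Euc m → ℝ} (hWi : LocallyIntegrable W)
    (hW : ∀ ψ, IsTestOn Ω ψ → ∫ x, W x * lap ψ x = 0) {r s : ℝ} (hr : 0 < r) (hs : 0 ≤ s) {x : Euc m}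
    (hx : closedBall x (r + s) ⊆ Ω) : avg s (avg r W) x = avg r W x := by
  apply mean_eq hm (avg_contDiff hr hWi) hs
  intro z hz
  apply lap_avg_zero hWi hW hr (subset_trans _ hx)
  apply closedBall_subset_closedBall'
  rw [mem_ball] at hz
  linarith

theorem avg_indep {m : ℕ} (hm : 1 ≤ m) {Ω : Set (Euc m)} {W : Euc m → ℝ} (hWi : LocallyIntegrable W)
    (hW : ∀ ψ, IsTestOn Ω ψ → ∫ x, W x * lap ψ x = 0) {r s : ℝ} (hr : 0 < r) (hs : 0 < s) {x : Euc m}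
    (hx : closedBall x (r + s) ⊆ Ω) : avg r W x = avg s W x := by
  rw [← avg_avg hm hWi hW hr hs.le hx, avg_comm hs hr hWi,
    avg_avg hm hWi hW hs hr.le (by rwa [add_comm])]

/-- The Weyl representative. -/
def weyl {m : ℕ} (Ω : Set (Euc m)) (W : Euc m → ℝ) (x : Euc m) : ℝ :=
  avg (infDist x Ωᶜ / 3) W x

theorem cball_sub {m : ℕ} {Ω : Set (Euc m)} {x : Euc m} {r : ℝ} (h : r < infDist x Ωᶜ) :
    closedBall x r ⊆ Ω := by
  intro y hy
  by_contra hn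
  have := infDist_le_dist_of_mem (x := x) (show y ∈ Ωᶜ from hn)
  rw [mem_closedBall, dist_comm] at hy
  linarith

theorem weyl_eq {m : ℕ} (hm : 1 ≤ m) {Ω : Set (Euc m)} {W : Euc m → ℝ} (hWi : LocallyIntegrable W)
    (hW : ∀ ψ, IsTestOn Ω ψ → ∫ x, W x * lap ψ x = 0) {x : Euc m} {r : ℝ} (hr : 0 < r)
    (hx : 2 * r < infDist x Ωᶜ) : weyl Ω W x = avg r W x := by
  apply avg_indep hm hWi hW _ hr
  · apply cball_sub; linarith
  · linarith

theorem weyl_near {m : ℕ} (hm : 1 ≤ m) {Ω : Set (Euc m)} {W : Euc m → ℝ} (hWi : LocallyIntegrable W)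
    (hW : ∀ ψ, IsTestOn Ω ψ → ∫ x, W x * lap ψ x = 0) {x : Euc m} (hx : 0 < infDist x Ωᶜ) :
    ∀ z ∈ ball x (infDist x Ωᶜ / 4), weyl Ω W z = avg (infDist x Ωᶜ / 4) W z := by
  intro z hz
  apply weyl_eq hm hWi hW (by linarith)
  have := infDist_le_infDist_add_dist (s := Ωᶜ) (x := x) (y := z)
  rw [mem_ball, dist_comm] at hz
  linarith

theorem weyl_spec {m : ℕ} (hm : 1 ≤ m) {Ω : Set (Euc m)} (hΩ : IsOpen Ω) (hne : Ωᶜ.Nonempty)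
    {W : Euc m → ℝ} (hWi : LocallyIntegrable W)
    (hW : ∀ ψ, IsTestOn Ω ψ → ∫ x, W x * lap ψ x = 0) :
    ContDiffOn ℝ (⊤ : ℕ∞) (weyl Ω W) Ω ∧ (∀ x ∈ Ω, lap (weyl Ω W) x = 0) ∧
    (∀ x ∈ Ω, ∃ r0 > 0, ball x r0 ⊆ Ω ∧ ∀ r, 0 < r → r ≤ r0 → avg r (weyl Ω W) x = weyl Ω W x) := by
  have hpos : ∀ x ∈ Ω, 0 < infDist x Ωᶜ := fun x hx =>
    (hΩ.isClosed_compl.notMem_iff_infDist_pos hne).1 (by simpa using hx)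
  have hev : ∀ x ∈ Ω, weyl Ω W =ᶠ[𝓝 x] avg (infDist x Ωᶜ / 4) W := fun x hx => by
    filter_upwards [ball_mem_nhds x (show 0 < infDist x Ωᶜ / 4 by linarith [hpos x hx])] with z hz
    exact weyl_near hm hWi hW (hpos x hx) z hz
  refine ⟨fun x hx => ?_, fun x hx => ?_, fun x hx => ?_⟩
  · have h := hpos x hx
    exact ((avg_contDiff (by linarith) hWi).contDiffAt.congr_of_eventuallyEq (hev x hx)).contDiffWithinAt
  · have h := hpos x hx
    rw [lap_congr (hev x hx)]
    apply lap_avg_zero hWi hW (by linarith)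
    apply cball_sub; linarith
  · have h := hpos x hx
    refine ⟨infDist x Ωᶜ / 4, by linarith, subset_trans ball_subset_closedBall (cball_sub (by linarith)), fun r hr hr2 => ?_⟩
    have e : avg r (weyl Ω W) x = avg r (avg (infDist x Ωᶜ / 4) W) x := by
      rw [avg, avg]
      congr 1; funext y
      by_cases hy : 1 ≤ ‖y‖
      · simp [eta_zero m y hy]
      · rw [weyl_near hm hWi hW h]
        simp [norm_smul, abs_of_pos hr]
        push Not at hy
        nlinarith
    rw [e, avg_avg hm hWi hW (by linarith) hr.le (cball_sub (by linarith))]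
    exact (weyl_near hm hWi hW h x (mem_ball_self (by linarith))).symm


theorem weyl_lower {m : ℕ} (hm : 1 ≤ m) {Ω : Set (Euc m)} (hΩ : IsOpen Ω) (hΩb : IsBounded Ω)
    (hne : Ωᶜ.Nonempty)
    {w : ℕ → Euc m → ℝ} (hw : ∀ k, Measurable (w k)) (hw1 : ∀ k x, |w k x| ≤ 1)
    {W : Euc m → ℝ}
    (hW : ∀ f : Euc m → ℝ, Continuous f →
        Tendsto (fun k => ∫ x in Ω, w k x * f x) (hyperfilter ℕ : Filter ℕ) (𝓝 (∫ x, W x * f x)))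
    {L : Euc m → ℝ} (hL : ContDiff ℝ (⊤ : ℕ∞) L) (hL0 : ∀ x ∈ Ω, 0 ≤ lap L x)
    (hLw : ∀ᶠ k in (hyperfilter ℕ : Filter ℕ), ∀ x ∈ Ω, L x ≤ w k x) :
    ∀ x ∈ Ω, L x ≤ weyl Ω W x := by
  intro x hx
  have hpos : 0 < infDist x Ωᶜ := (hΩ.isClosed_compl.notMem_iff_infDist_pos hne).1 (by simpa using hx)
  set d := infDist x Ωᶜ / 3 with hd
  have hd0 : 0 < d := by positivity
  have hsub : closedBall x d ⊆ Ω := cball_sub (by linarith)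
  have h1 : L x ≤ avg d L x := by
    have := avg_ge hm hL x hd0.le (a := 0) fun z hz => hL0 z (hsub (ball_subset_closedBall hz))
    linarith
  refine h1.trans ?_
  have hk : Continuous (fun z => mker m d (x - z)) :=
    (mker_contDiff m d).continuous.comp (by fun_prop)
  rw [weyl, ← hd, avg_eq hd0 W, avg_eq hd0 L]
  refine ge_of_tendsto (hW _ hk) ?_
  filter_upwards [hLw] with k hkL
  have hz : ∀ z ∉ Ω, L z * mker m d (x - z) = 0 := by
    intro z hz
    rw [mker_zero hd0, mul_zero]
    by_contra h
    apply hz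
    apply hsub
    rw [mem_closedBall, dist_comm, dist_eq_norm]
    linarith
  rw [← setIntegral_eq_integral_of_forall_compl_eq_zero hz]
  have hInteg : ∀ f : Euc m → ℝ, Continuous f → IntegrableOn f Ω := fun f hf =>
    (hf.continuousOn.integrableOn_compact hΩb.isCompact_closure).mono_set subset_closure
  apply setIntegral_mono_on (hInteg _ (hL.continuous.mul hk)) _ hΩ.measurableSet
  · intro z hz
    exact mul_le_mul_of_nonneg_right (hkL z hz) (mker_nonneg hd0 _)
  · apply Integrable.bdd_mul (c := 1) (hInteg _ hk)
    · exact (hw k).aestronglyMeasurable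
    · exact Eventually.of_forall fun x => hw1 k x

theorem exists_harm {m : ℕ} (hm : 1 ≤ m) {Ω : Set (Euc m)} (hΩ : IsOpen Ω) (hΩb : IsBounded Ω)
    (hne : Ωᶜ.Nonempty) {G : Euc m → ℝ} (hG : Continuous G) (hG1 : ∀ x, -1 ≤ G x ∧ G x ≤ 0) :
    ∃ φ : Euc m → ℝ, ContDiffOn ℝ (⊤ : ℕ∞) φ Ω ∧ (∀ x ∈ Ω, lap φ x = 0) ∧
      (∀ x ∈ Ω, ∃ r0 > 0, ball x r0 ⊆ Ω ∧ ∀ r, 0 < r → r ≤ r0 → avg r φ x = φ x) ∧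
      (∀ x ∈ Ω, φ x ≤ 0) ∧
      (∀ L : Euc m → ℝ, ContDiff ℝ (⊤ : ℕ∞) L → ∀ a > 0, ∀ ρ > 0,
        (∀ x ∈ closure Ω, ∀ z ∈ ball x ρ, a ≤ lap L z) →
        (∀ x ∈ closure Ω, ∀ z ∈ ball x ρ, z ∉ Ω → L z < G z) → ∀ x ∈ Ω, L x ≤ φ x) ∧
      (∀ L : Euc m → ℝ, ContDiff ℝ (⊤ : ℕ∞) L → ∀ a > 0, ∀ ρ > 0,
        (∀ x ∈ closure Ω, ∀ z ∈ ball x ρ, a ≤ lap L z) →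
        (∀ x ∈ closure Ω, ∀ z ∈ ball x ρ, z ∉ Ω → L z < - G z) → ∀ x ∈ Ω, L x ≤ - φ x) := by
  set r : ℕ → ℝ := fun k => 1 / ((k:ℝ) + 1)
  have hr : ∀ k, 0 < r k := fun k => by positivity
  have hr0 : Tendsto r atTop (𝓝 0) := tendsto_one_div_add_atTop_nhds_zero_nat
  choose w hw hw1 hwa hwG using fun k => exists_walk hm hΩ hG hG1 (hr k)
  have hwb : ∀ k x, |w k x| ≤ 1 := fun k x => abs_le_one (hw1 k x)
  obtain ⟨W, hWi, -, hW⟩ := weak_limit hΩ hΩb hw hwb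
  have hharm : ∀ ψ, IsTestOn Ω ψ → ∫ x, W x * lap ψ x = 0 := fun ψ hψ =>
    weak_harm hm hΩ hΩb hw hwb hr hr0 hwa hW hψ
  obtain ⟨h1, h2, h3⟩ := weyl_spec hm hΩ hne hWi.locallyIntegrable hharm
  have hW' : ∀ f : Euc m → ℝ, Continuous f →
        Tendsto (fun k => ∫ x in Ω, (- w k x) * f x) (hyperfilter ℕ : Filter ℕ)
          (𝓝 (∫ x, (- W x) * f x)) := by
    intro f hf
    simp only [neg_mul, integral_neg]
    exact (hW f hf).neg
  have hneg : ∀ x, weyl Ω (fun z => - W z) x = - weyl Ω W x := fun x => avg_neg _ _ _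
  have hev : ∀ ρ > 0, ∀ᶠ k in (hyperfilter ℕ : Filter ℕ), r k < ρ := fun ρ hρ =>
    Nat.hyperfilter_le_atTop (hr0.eventually (gt_mem_nhds hρ))
  refine ⟨weyl Ω W, h1, h2, h3, ?_, ?_, ?_⟩
  · intro x hx
    have := weyl_lower hm hΩ hΩb hne (fun k => (hw k).neg) (fun k x => by simpa using hwb k x) hW'
      (L := fun _ => 0) contDiff_const (fun x _ => by simp [lap]) (Eventually.of_forall fun k x _ => by
        simpa using (hw1 k x).2) x hx
    rw [hneg] at this
    linarith
  · intro L hL a ha ρ hρ hL1 hL2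
    apply weyl_lower hm hΩ hΩb hne hw hwb hW hL
    · intro x hx
      exact ha.le.trans (hL1 x (subset_closure hx) x (mem_ball_self hρ))
    · filter_upwards [hev ρ hρ] with k hk
      exact walk_compare hm hΩb (hr k) (hw k) (hwb k) (hwa k) (hwG k) hL ha
        (fun x hx z hz => hL1 x hx z (ball_subset_ball hk.le hz))
        (fun x hx z hz => hL2 x hx z (ball_subset_ball hk.le hz))
  · intro L hL a ha ρ hρ hL1 hL2 x hx
    rw [← hneg]
    revert x
    apply weyl_lower hm hΩ hΩb hne (fun k => (hw k).neg) (fun k x => by simpa using hwb k x) hW' hL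
    · intro x hx
      exact ha.le.trans (hL1 x (subset_closure hx) x (mem_ball_self hρ))
    · filter_upwards [hev ρ hρ] with k hk
      exact walk_compare hm hΩb (hr k) (G := fun x => - G x) (w := fun x => - w k x) (hw k).neg
        (fun x => by simpa using hwb k x)
        (fun x hx => by rw [avg_neg, ← hwa k x hx])
        (fun x hx => by rw [hwG k x hx]) hL ha
        (fun x hx z hz => hL1 x hx z (ball_subset_ball hk.le hz))
        (fun x hx z hz => hL2 x hx z (ball_subset_ball hk.le hz))


theorem lap_radial {m : ℕ} (z : Euc m) {F F1 F2 : ℝ → ℝ} (hF : ∀ s, 0 ≤ s → HasDerivAt F (F1 s) s)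
    (hF1 : ∀ s, 0 ≤ s → HasDerivAt F1 (F2 s) s) (y : Euc m) :
    lap (fun y => F (‖y - z‖^2)) y = 4 * ‖y - z‖^2 * F2 (‖y - z‖^2) + 4 * m * F1 (‖y - z‖^2) := by
  have h1 : ∀ i, pd i (fun y => F (‖y - z‖^2)) = fun y => 2 * (y i - z i) * F1 (‖y - z‖^2) := fun i =>
    funext fun y => pd_radial i z (hF _ (sq_nonneg _))
  have h2 : ∀ i, pd i (fun y => 2 * (y i - z i) * F1 (‖y - z‖^2)) y
      = 2 * F1 (‖y - z‖^2) + 4 * (y i - z i)^2 * F2 (‖y - z‖^2) := by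
    intro i
    have ha : HasFDerivAt (fun y : Euc m => 2 * (y i - z i)) ((2:ℝ) • (EuclideanSpace.proj i : Euc m →L[ℝ] ℝ)) y := by
      have := ((EuclideanSpace.proj i : Euc m →L[ℝ] ℝ).hasFDerivAt (x := y)).sub_const (z i)
      exact this.const_mul 2
    have hb : DifferentiableAt ℝ (fun y : Euc m => F1 (‖y - z‖^2)) y := by
      have h3 : DifferentiableAt ℝ (fun y : Euc m => ‖y - z‖^2) y :=
        ((hasFDerivAt_id y).sub_const z).norm_sq.differentiableAt
      exact (hF1 _ (sq_nonneg _)).differentiableAt.comp y h3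
    have hc := ha.mul hb.hasFDerivAt
    have hd := pd_radial i z (hF1 (‖y - z‖^2) (sq_nonneg _))
    rw [pd] at hd
    have e : pd i (fun y => 2 * (y i - z i) * F1 (‖y - z‖^2)) y = _ := congrArg
      (fun T : Euc m →L[ℝ] ℝ => T (EuclideanSpace.single i (1:ℝ))) hc.fderiv
    rw [e]
    simp only [add_apply, smul_apply, hd, smul_eq_mul]
    simp
    ring
  rw [lap_eq]
  simp only [h1, h2, Finset.sum_add_distrib, ← Finset.sum_mul, ← Finset.mul_sum]
  have h4 : ∑ i, (y i - z i)^2 = ‖y - z‖^2 := by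
    rw [EuclideanSpace.real_norm_sq_eq]; simp
  rw [h4]
  simp
  ring

theorem exterior_ball {m : ℕ} {Ω : Set (Euc m)} (hΩ : SmoothBoundedDomain Ω) {x0 : Euc m}
    (hx0 : x0 ∈ frontier Ω) : ∃ (z : Euc m) (R : ℝ), 0 < R ∧ ‖x0 - z‖ = R ∧
      ∀ x ∈ closure Ω, x ≠ x0 → R < ‖x - z‖ := by
  obtain ⟨-, -, -, f, hf, hfΩ, hfr, hD⟩ := hΩ
  have hf0 : f x0 = 0 := by rw [hfr] at hx0; exact hx0
  have hcl : ∀ x ∈ closure Ω, f x ≤ 0 := by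
    intro x hx
    have : closure Ω ⊆ {x | f x ≤ 0} := by
      apply closure_minimal _ (isClosed_le hf.continuous continuous_const)
      rw [hfΩ]; intro x hx; exact le_of_lt (show f x < 0 from hx)
    exact this hx
  set D := fderiv ℝ f x0 with hDdef
  set p := (InnerProductSpace.toDual ℝ (Euc m)).symm D with hp
  have hpD : ∀ h, inner ℝ p h = D h := fun h => InnerProductSpace.toDual_symm_apply
  have hp0 : 0 < ‖p‖ := by
    rw [norm_pos_iff]; intro h
    apply hD x0 hx0
    rw [hp] at h
    simpa using h
  have hC1 : ContDiffAt ℝ 1 (fderiv ℝ f) x0 := by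
    have : ContDiff ℝ 1 (fderiv ℝ f) := hf.fderiv_right (by
      rw [show (1 : WithTop ℕ∞) + 1 = ((2 : ℕ∞) : WithTop ℕ∞) from rfl]; exact_mod_cast le_top)
    exact this.contDiffAt
  obtain ⟨K, t, ht, hK⟩ := hC1.exists_lipschitzOnWith
  obtain ⟨δ, hδ, hball⟩ := Metric.mem_nhds_iff.1 ht
  have hloc : ∀ x ∈ closure Ω, ‖x - x0‖ < δ → D (x - x0) ≤ K * ‖x - x0‖^2 := by
    intro x hx hxd
    have := (convex_closedBall x0 ‖x - x0‖).norm_image_sub_le_of_norm_fderiv_le' (f := f) (𝕜 := ℝ)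
      (φ := D) (C := K * ‖x - x0‖) (x := x0) (y := x)
      (fun y _ => hf.differentiable (by simp) y)
      (fun y hy => by
        have hy' : ‖y - x0‖ ≤ ‖x - x0‖ := by rwa [mem_closedBall, dist_eq_norm] at hy
        have h1 := hK.norm_sub_le (hball (show y ∈ ball x0 δ by
          rw [mem_ball, dist_eq_norm]; linarith)) (hball (mem_ball_self hδ))
        exact h1.trans (by gcongr))
      (by simp) (by simp [dist_eq_norm])
    rw [hf0, Real.norm_eq_abs] at this
    have h2 := (abs_le.1 this).1
    have h3 := hcl x hx
    nlinarith
  set M : ℝ := K + ‖p‖/δ + 1 with hM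
  have hM0 : 0 < M := by positivity
  have hglob : ∀ x ∈ closure Ω, inner ℝ p (x - x0) ≤ M * ‖x - x0‖^2 := by
    intro x hx
    have hKn : (0:ℝ) ≤ K := K.2
    have hq : 0 ≤ ‖p‖/δ := by positivity
    by_cases h : ‖x - x0‖ < δ
    · rw [hpD]
      refine (hloc x hx h).trans ?_
      apply mul_le_mul_of_nonneg_right _ (sq_nonneg _)
      linarith
    · push Not at h
      refine (real_inner_le_norm _ _).trans ?_
      have h1 : ‖p‖ * ‖x - x0‖ ≤ ‖p‖/δ * ‖x - x0‖^2 := by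
        rw [div_mul_eq_mul_div, le_div_iff₀ hδ, pow_two, ← mul_assoc]
        apply mul_le_mul_of_nonneg_left h (by positivity)
      refine h1.trans ?_
      apply mul_le_mul_of_nonneg_right _ (sq_nonneg _)
      linarith
  set s : ℝ := 1/(4*M) with hs
  have hs0 : 0 < s := by positivity
  refine ⟨x0 + s • p, s * ‖p‖, by positivity, by simp [norm_smul, abs_of_pos hs0], ?_⟩
  intro x hx hne
  have hpos : 0 < ‖x - x0‖ := norm_pos_iff.2 (sub_ne_zero.2 hne)
  have e : x - (x0 + s • p) = (x - x0) - s • p := by abel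
  rw [e]
  have h1 := norm_sub_sq_real (x - x0) (s • p)
  rw [inner_smul_right, real_inner_comm, norm_smul, Real.norm_of_nonneg hs0.le] at h1
  have h2 := hglob x hx
  have h3 : s * M = 1/4 := by rw [hs]; field_simp
  apply lt_of_pow_lt_pow_left₀ 2 (norm_nonneg _)
  rw [h1]
  have h4 : s * inner ℝ p (x - x0) ≤ 1/4 * ‖x - x0‖^2 := by
    rw [← h3, mul_assoc]; exact mul_le_mul_of_nonneg_left h2 hs0.le
  nlinarith [sq_nonneg ‖x-x0‖, pow_pos hpos 2]


theorem nbhd_of_closure {m : ℕ} {Ω : Set (Euc m)} (hΩb : IsBounded Ω) {U : Set (Euc m)} (hU : IsOpen U)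
    (h : closure Ω ⊆ U) : ∃ ρ > 0, ∀ x ∈ closure Ω, ∀ z ∈ ball x ρ, z ∈ U := by
  obtain ⟨δ, hδ, hth⟩ := hΩb.isCompact_closure.exists_cthickening_subset_open hU h
  refine ⟨δ, hδ, fun x hx z hz => hth (mem_cthickening_of_dist_le z x δ _ hx (le_of_lt hz))⟩

theorem barrier {m : ℕ} (hm : 1 ≤ m) {Ω : Set (Euc m)} (hΩ : SmoothBoundedDomain Ω)
    {G : Euc m → ℝ} (hG : Continuous G) {x0 : Euc m} (hx0 : x0 ∈ frontier Ω) {ε : ℝ} (hε : 0 < ε) :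
    ∃ L : Euc m → ℝ, ContDiff ℝ (⊤ : ℕ∞) L ∧ L x0 = G x0 - ε ∧ ∃ a > 0, ∃ ρ > 0,
      (∀ x ∈ closure Ω, ∀ z ∈ ball x ρ, a ≤ lap L z) ∧
      (∀ x ∈ closure Ω, ∀ z ∈ ball x ρ, L z < G z) := by
  obtain ⟨z, R, hR, hzR, hext⟩ := exterior_ball hΩ hx0
  have hΩb := hΩ.2.2.1
  have hcpt := hΩb.isCompact_closure
  have hx0c : x0 ∈ closure Ω := frontier_subset_closure hx0
  have hm' : (1:ℝ) ≤ m := by exact_mod_cast hm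
  set α : ℝ := 2 * m / R^2 with hα
  have hα0 : 0 < α := by positivity
  set F : ℝ → ℝ := fun s => Real.exp (-α * s) - Real.exp (-α * R^2)
  have hF : ∀ s, HasDerivAt F (-α * Real.exp (-α * s)) s := by
    intro s
    have := (((hasDerivAt_id s).const_mul (-α)).exp).sub_const (Real.exp (-α * R^2))
    refine this.congr_deriv ?_
    simp; ring
  have hF1 : ∀ s, HasDerivAt (fun s => -α * Real.exp (-α * s)) (α^2 * Real.exp (-α * s)) s := by
    intro s
    have := (((hasDerivAt_id s).const_mul (-α)).exp).const_mul (-α)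
    refine this.congr_deriv ?_
    simp; ring
  set B : Euc m → ℝ := fun y => F (‖y - z‖^2) with hB
  have hBc : ContDiff ℝ (⊤ : ℕ∞) B := by
    have h1 : ContDiff ℝ (⊤ : ℕ∞) (fun y : Euc m => ‖y - z‖^2) :=
      (contDiff_norm_sq ℝ).comp (contDiff_id.sub contDiff_const)
    have h2 : ContDiff ℝ (⊤ : ℕ∞) F :=
      ((contDiff_const.mul contDiff_id).exp).sub contDiff_const
    exact h2.comp h1
  have hlap : ∀ y, lap B y = (4 * α * (α * ‖y - z‖^2 - m)) * Real.exp (-α * ‖y - z‖^2) := by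
    intro y
    rw [hB, lap_radial z (fun s _ => hF s) (fun s _ => hF1 s)]
    ring
  have hBx0 : B x0 = 0 := by simp [hB, F, hzR]
  have hge : ∀ x ∈ closure Ω, R ≤ ‖x - z‖ := by
    intro x hx
    by_cases h : x = x0
    · rw [h, hzR]
    · exact (hext x hx h).le
  have hBneg : ∀ x ∈ closure Ω, x ≠ x0 → B x < 0 := by
    intro x hx h
    have := hext x hx h
    simp only [hB, F, sub_neg, Real.exp_lt_exp]
    have : R^2 < ‖x - z‖^2 := by nlinarith
    nlinarith
  have hlpos : ∀ x ∈ closure Ω, 0 < lap B x := by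
    intro x hx
    rw [hlap]
    have h1 : R^2 ≤ ‖x - z‖^2 := by have := hge x hx; nlinarith
    have h2 : α * R^2 = 2 * m := by rw [hα]; field_simp
    have h3 : 2 * m ≤ α * ‖x - z‖^2 := by rw [← h2]; exact mul_le_mul_of_nonneg_left h1 hα0.le
    have : 0 < α * ‖x - z‖^2 - m := by linarith
    positivity
  have hlc : Continuous (lap B) := (lap_contDiff hBc).continuous
  obtain ⟨x1, hx1, hmin⟩ := hcpt.exists_isMinOn ⟨x0, hx0c⟩ hlc.continuousOn
  set a0 := lap B x1
  have ha0 : 0 < a0 := hlpos x1 hx1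
  have hBle : ∀ x ∈ closure Ω, B x ≤ 0 := by
    intro x hx
    by_cases h : x = x0
    · rw [h, hBx0]
    · exact (hBneg x hx h).le
  -- choose the multiple
  obtain ⟨A, hA, hAL⟩ : ∃ A > 0, ∀ x ∈ closure Ω, G x0 - ε + A * B x < G x := by
    obtain ⟨δ, hδ, hδG⟩ := Metric.continuous_iff.1 hG x0 ε hε
    have hnear : ∀ x, dist x x0 < δ → G x0 - ε < G x := fun x hx => by
      have := hδG x hx
      rw [Real.dist_eq] at this
      linarith [(abs_lt.1 this).1]
    obtain ⟨M, hM⟩ := hcpt.exists_bound_of_continuousOn hG.continuousOn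
    have hM' : ∀ x ∈ closure Ω, -M ≤ G x ∧ G x ≤ M := fun x hx => abs_le.1 (hM x hx)
    by_cases hemp : (closure Ω \ ball x0 δ).Nonempty
    · obtain ⟨x2, hx2, hmax⟩ := (hcpt.diff isOpen_ball).exists_isMaxOn hemp hBc.continuous.continuousOn
      have hb : B x2 < 0 := hBneg x2 hx2.1 (by
        rintro rfl; exact hx2.2 (mem_ball_self hδ))
      have hM0 : 0 ≤ M := by linarith [hM' x0 hx0c]
      refine ⟨(2 * M + 1)/(-B x2), div_pos (by linarith) (by linarith), fun x hx => ?_⟩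
      have hA0 : 0 < (2 * M + 1)/(-B x2) := div_pos (by linarith) (by linarith)
      by_cases hxb : dist x x0 < δ
      · have := hnear x hxb
        have := hBle x hx
        nlinarith
      · have h1 : B x ≤ B x2 := hmax ⟨hx, hxb⟩
        have h2 : (2 * M + 1)/(-B x2) * B x ≤ -(2*M+1) := by
          calc _ ≤ (2 * M + 1)/(-B x2) * B x2 := mul_le_mul_of_nonneg_left h1 hA0.le
            _ = _ := by
              have : B x2 ≠ 0 := hb.ne
              rw [div_neg, neg_mul, div_mul_cancel₀ _ this]
        linarith [hM' x0 hx0c, hM' x hx]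
    · refine ⟨1, one_pos, fun x hx => ?_⟩
      have hxb : dist x x0 < δ := by
        by_contra h
        exact hemp ⟨x, hx, h⟩
      have := hnear x hxb
      have := hBle x hx
      linarith
  set L : Euc m → ℝ := fun x => G x0 - ε + A * B x with hL
  have hLc : ContDiff ℝ (⊤ : ℕ∞) L := contDiff_const.add (contDiff_const.mul hBc)
  have hlapL : ∀ x, lap L x = A * lap B x := by
    intro x
    rw [hL, lap_add contDiff_const (contDiff_const.mul hBc), lap_const_mul hBc]
    simp [lap]
  obtain ⟨ρ1, hρ1, h1⟩ := nbhd_of_closure hΩb (isOpen_lt continuous_const hlc) (U := {x | a0/2 < lap B x})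
    (fun x hx => show a0/2 < lap B x by
      have : a0 ≤ lap B x := hmin hx
      linarith)
  obtain ⟨ρ2, hρ2, h2⟩ := nbhd_of_closure hΩb (isOpen_lt hLc.continuous hG) (U := {x | L x < G x}) hAL
  refine ⟨L, hLc, by simp [hL, hBx0], A * (a0/2), by positivity, min ρ1 ρ2, lt_min hρ1 hρ2, ?_, ?_⟩
  · intro x hx y hy
    rw [hlapL]
    have : a0/2 < lap B y := h1 x hx y (ball_subset_ball (min_le_left _ _) hy)
    exact mul_le_mul_of_nonneg_left this.le hA.le
  · intro x hx y hy
    exact h2 x hx y (ball_subset_ball (min_le_right _ _) hy)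

theorem eta_pos_pt {m : ℕ} (hm : 1 ≤ m) : ∃ t : ℝ, 0 < t ∧ ∀ y : Euc m, ‖y‖ = t → 0 < eta m y := by
  obtain ⟨y0, hy0, h⟩ : ∃ y0 : Euc m, y0 ≠ 0 ∧ eta m y0 ≠ 0 := by
    by_contra! hcon
    have h1 : ∫ y, eta m y = 0 := by
      apply integral_eq_zero_of_ae
      have : Nontrivial (Euc m) := by
        have : Nonempty (Fin (2*m)) := ⟨⟨0, by omega⟩⟩
        infer_instance
      filter_upwards [compl_mem_ae_iff.2 (measure_singleton (0 : Euc m))] with y hy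
      exact hcon y hy
    rw [eta_int m hm] at h1
    exact one_ne_zero h1
  refine ⟨‖y0‖, norm_pos_iff.2 hy0, fun y hy => ?_⟩
  have e : eta m y = eta m y0 := by simp [eta, eta0, hy]
  rw [e]
  exact lt_of_le_of_ne (eta_nonneg m y0) (Ne.symm h)

theorem strong_max {m : ℕ} (hm : 1 ≤ m) {Ω : Set (Euc m)} {φ : Euc m → ℝ} (hφ : ContinuousOn φ Ω)
    (hneg : ∀ x ∈ Ω, φ x ≤ 0) {x : Euc m} (hx : φ x = 0) {r0 : ℝ} (hr0 : 0 < r0)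
    (hb : ball x r0 ⊆ Ω) (hmv : ∀ r, 0 < r → r ≤ r0 → avg r φ x = φ x) :
    ∀ᶠ y in 𝓝 x, φ y = 0 := by
  obtain ⟨t, ht, hη⟩ := eta_pos_pt hm
  have key : ∀ r, 0 < r → r < r0 → ∀ y : Euc m, ‖y‖ = t → φ (x + r • y) = 0 := by
    intro r hr hr2 y hy
    have h1 : ∀ y : Euc m, ‖y‖ < 1 → x + r • y ∈ ball x r0 := by
      intro y hy
      simp [norm_smul, abs_of_pos hr]
      nlinarith
    have hcont : Continuous (fun y => - (φ (x + r • y) * eta m y)) := by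
      apply Continuous.neg
      apply mul_test_continuous (U := ball 0 (r0/r)) isOpen_ball
      · apply hφ.comp (by fun_prop)
        intro y hy
        apply hb
        simp at hy
        rw [lt_div_iff₀ hr] at hy
        simp [norm_smul, abs_of_pos hr]
        linarith
      · refine ⟨eta_contDiff m, eta_hcs m, ?_⟩
        have h2 : tsupport (eta m) ⊆ closedBall 0 1 := by
          apply closure_minimal _ isClosed_closedBall
          intro y hy
          by_contra h
          apply hy
          apply eta_zero
          simp at h
          exact h.le
        refine h2.trans (closedBall_subset_ball ?_)
        rw [lt_div_iff₀ hr]; linarith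
    have hnn : ∀ y, 0 ≤ - (φ (x + r • y) * eta m y) := by
      intro y
      by_cases hy : 1 ≤ ‖y‖
      · simp [eta_zero m y hy]
      · have := hneg _ (hb (h1 y (not_le.1 hy)))
        have := eta_nonneg m y
        nlinarith
    have hInteg : Integrable (fun y => - (φ (x + r • y) * eta m y)) :=
      hcont.integrable_of_hasCompactSupport (hcs_of_zero 1 fun y hy => by simp [eta_zero m y hy])
    have h0 : ∫ y, - (φ (x + r • y) * eta m y) = 0 := by
      rw [integral_neg]
      have := hmv r hr hr2.le
      rw [avg, hx] at this
      rw [this, neg_zero]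
    rw [integral_eq_zero_iff_of_nonneg hnn hInteg] at h0
    have h2 := (Continuous.ae_eq_iff_eq volume hcont continuous_zero).1 h0
    have h3 := congrFun h2 y
    have h4 := hη y hy
    simp at h3
    rcases h3 with h3 | h3
    · exact h3
    · linarith
  filter_upwards [ball_mem_nhds x (mul_pos hr0 ht)] with z hz
  by_cases hzx : z = x
  · rw [hzx, hx]
  have hpos : 0 < ‖z - x‖ := norm_pos_iff.2 (sub_ne_zero.2 hzx)
  rw [mem_ball, dist_eq_norm] at hz
  have := key (‖z - x‖ / t) (by positivity) (by rw [div_lt_iff₀ ht]; exact hz)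
    ((t / ‖z - x‖) • (z - x)) (by
      rw [norm_smul, Real.norm_of_nonneg (by positivity)]; field_simp)
  rw [smul_smul, show ‖z - x‖ / t * (t / ‖z - x‖) = 1 by field_simp] at this
  simpa using this

theorem exists_phi {m : ℕ} (hm : 1 ≤ m) {Ω : Set (Euc m)} (hΩ : SmoothBoundedDomain Ω)
    {Γ : Set (Euc m)} (hΓ : Γ ⊆ frontier Ω) (hΓc : IsClosed Γ) (hΓne : Γ ≠ frontier Ω) :
    ∃ φ : Euc m → ℝ, ContDiffOn ℝ (⊤ : ℕ∞) φ Ω ∧ (∀ x ∈ Ω, lap φ x = 0) ∧ (∀ x ∈ Ω, φ x < 0) ∧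
      (∀ x ∈ Γ, Tendsto φ (𝓝[Ω] x) (𝓝 0)) ∧
      (∀ x ∈ frontier Ω, x ∉ Γ → ¬ Tendsto φ (𝓝[Ω] x) (𝓝 0)) ∧ (∀ x ∉ Ω, φ x = 0) := by
  obtain ⟨hΩo, hΩcon, hΩb, -⟩ := id hΩ
  obtain ⟨x1, hx1, hx1Γ⟩ : ∃ x1 ∈ frontier Ω, x1 ∉ Γ := by
    by_contra! h
    exact hΓne (Subset.antisymm hΓ h)
  have hne : Ωᶜ.Nonempty := ⟨x1, by
    rw [hΩo.frontier_eq] at hx1; exact hx1.2⟩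
  obtain ⟨G, hG, hG1, hGΓ, hGn⟩ : ∃ G : Euc m → ℝ, Continuous G ∧ (∀ x, -1 ≤ G x ∧ G x ≤ 0) ∧
      (∀ x ∈ Γ, G x = 0) ∧ ∀ x ∉ Γ, G x < 0 := by
    by_cases hemp : Γ.Nonempty
    · refine ⟨fun x => - min 1 (infDist x Γ), (continuous_const.min (continuous_infDist_pt Γ)).neg,
        fun x => ⟨neg_le_neg (min_le_left _ _), ?_⟩, fun x hx => ?_, fun x hx => ?_⟩
      · simp [infDist_nonneg]
      · simp [infDist_zero_of_mem hx]
      · have := (hΓc.notMem_iff_infDist_pos hemp).1 hx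
        simp [this]
    · refine ⟨fun _ => -1, continuous_const, fun x => by norm_num, fun x hx => absurd ⟨x, hx⟩ hemp,
        fun x _ => by norm_num⟩
  obtain ⟨φ, h1, h2, h3, h4, h5, h6⟩ := exists_harm hm hΩo hΩb hne hG hG1
  have hlow : ∀ x ∈ Γ, Tendsto φ (𝓝[Ω] x) (𝓝 0) := by
    intro x hx
    rw [Metric.tendsto_nhds]
    intro ε hε
    obtain ⟨L, hL, hLx, a, ha, ρ, hρ, hl, hlG⟩ := barrier hm hΩ hG (hΓ hx) (half_pos hε)
    have hle := h5 L hL a ha ρ hρ hl (fun x hx z hz _ => hlG x hx z hz)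
    rw [hGΓ x hx] at hLx
    have hev : ∀ᶠ y in 𝓝 x, -ε < L y := hL.continuous.continuousAt.eventually (lt_mem_nhds (by
      rw [hLx]; linarith))
    filter_upwards [self_mem_nhdsWithin, hev.filter_mono nhdsWithin_le_nhds] with y hy hy2
    rw [Real.dist_eq, sub_zero, abs_lt]
    constructor
    · linarith [hle y hy]
    · linarith [h4 y hy]
  have hup : ∀ x ∈ frontier Ω, x ∉ Γ → ¬ Tendsto φ (𝓝[Ω] x) (𝓝 0) := by
    intro x hx hxΓ ht
    have hGx := hGn x hxΓ
    obtain ⟨L, hL, hLx, a, ha, ρ, hρ, hl, hlG⟩ := barrier hm hΩ hG.neg hx (show 0 < - G x / 2 by linarith)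
    have hle := h6 L hL a ha ρ hρ hl (fun x hx z hz _ => hlG x hx z hz)
    have : (𝓝[Ω] x).NeBot := mem_closure_iff_nhdsWithin_neBot.1 (frontier_subset_closure hx)
    have h7 : Tendsto L (𝓝[Ω] x) (𝓝 (L x)) := hL.continuous.continuousAt.tendsto.mono_left nhdsWithin_le_nhds
    have h8 := le_of_tendsto_of_tendsto h7 ht.neg (by
      filter_upwards [self_mem_nhdsWithin] with y hy using hle y hy)
    rw [hLx, Pi.neg_apply] at h8
    linarith
  have hneg : ∀ x ∈ Ω, φ x < 0 := by
    by_contra! hcon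
    obtain ⟨x2, hx2, hx2'⟩ := hcon
    have hx20 : φ x2 = 0 := le_antisymm (h4 x2 hx2) hx2'
    have hfr : ∀ x ∈ frontier Ω, x ∉ Ω := fun x hx => by
      rw [hΩo.frontier_eq] at hx; exact hx.2
    -- the zero set is open
    have hop1 : IsOpen {x | x ∈ Ω ∧ φ x = 0} := by
      rw [isOpen_iff_mem_nhds]
      rintro x ⟨hx, hx0⟩
      obtain ⟨r0, hr0, hb, hmv⟩ := h3 x hx
      filter_upwards [strong_max hm h1.continuousOn h4 hx0 hr0 hb hmv, hΩo.mem_nhds hx] with y hy hy2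
      exact ⟨hy2, hy⟩
    have hop2 : IsOpen (Ω ∩ φ ⁻¹' {0}ᶜ) :=
      h1.continuousOn.isOpen_inter_preimage hΩo isOpen_compl_singleton
    have hsub : Ω ⊆ {x | x ∈ Ω ∧ φ x = 0} := by
      apply hΩcon.isPreconnected.subset_left_of_subset_union hop1 hop2
      · rw [disjoint_left]
        rintro x ⟨_, h⟩ ⟨_, h'⟩
        exact h' h
      · intro x hx
        by_cases h : φ x = 0
        · exact Or.inl ⟨hx, h⟩
        · exact Or.inr ⟨hx, h⟩
      · exact ⟨x2, hx2, hx2, hx20⟩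
    apply hup x1 hx1 hx1Γ
    apply tendsto_const_nhds.congr'
    filter_upwards [self_mem_nhdsWithin] with y hy
    exact (hsub hy).2.symm
  classical
  have hev : ∀ x, Ω.indicator φ =ᶠ[𝓝[Ω] x] φ := fun x => by
    filter_upwards [self_mem_nhdsWithin] with y hy using indicator_of_mem hy _
  have hev2 : ∀ x ∈ Ω, Ω.indicator φ =ᶠ[𝓝 x] φ := fun x hx => by
    filter_upwards [hΩo.mem_nhds hx] with y hy using indicator_of_mem hy _
  refine ⟨Ω.indicator φ, ?_, ?_, ?_, ?_, ?_, fun x hx => indicator_of_notMem hx _⟩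
  · exact h1.congr fun x hx => indicator_of_mem hx _
  · intro x hx; rw [lap_congr (hev2 x hx), h2 x hx]
  · intro x hx; rw [indicator_of_mem hx]; exact hneg x hx
  · intro x hx; exact (hlow x hx).congr' (hev x).symm
  · intro x hx hxΓ h
    exact hup x hx hxΓ (h.congr' (hev x))


/-! ### Part 5: fundamental solution -/

theorem euc_nontrivial {m : ℕ} (hm : 1 ≤ m) : Nontrivial (Euc m) := by
  have : Nonempty (Fin (2*m)) := ⟨⟨0, by omega⟩⟩
  infer_instance

theorem npow_intOn {m : ℕ} (hm : 1 ≤ m) {a : ℕ} (ha : a ≤ 2*m - 1) (R : ℝ) :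
    IntegrableOn (fun x : Euc m => (‖x‖^a)⁻¹) (ball 0 R) := by
  have := euc_nontrivial hm
  rw [integrableOn_fun_norm_addHaar volume (f := fun y : ℝ => (y^a)⁻¹)]
  have h : IntegrableOn (fun y : ℝ => y^(2*m-1-a)) (Ioo 0 R) :=
    ((continuous_pow _).continuousOn.integrableOn_compact isCompact_Icc).mono_set Ioo_subset_Icc_self
  refine h.congr_fun ?_ measurableSet_Ioo
  intro y hy
  have hy0 : y ≠ 0 := hy.1.ne'
  simp only [finrank_euclideanSpace, Fintype.card_fin, smul_eq_mul]
  rw [pow_sub₀ _ hy0 ha]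

theorem npow_locInt {m : ℕ} (hm : 1 ≤ m) {a : ℕ} (ha : a ≤ 2*m - 1) :
    LocallyIntegrable (fun x : Euc m => (‖x‖^a)⁻¹) := by
  rw [locallyIntegrable_iff]
  intro K hK
  obtain ⟨R, hR⟩ := hK.isBounded.subset_ball (0 : Euc m)
  exact (npow_intOn hm ha R).mono_set hR

theorem abs_log_le {t : ℝ} (ht : 0 ≤ t) : |Real.log t| ≤ t + t⁻¹ := by
  rcases ht.eq_or_lt with h | h
  · simp [← h]
  rw [abs_le]
  have h1 := Real.log_le_sub_one_of_pos h
  have h2 := Real.log_le_sub_one_of_pos (inv_pos.2 h)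
  rw [Real.log_inv] at h2
  have h3 := inv_pos.2 h
  constructor <;> linarith

theorem log_locInt {m : ℕ} (hm : 1 ≤ m) : LocallyIntegrable (fun x : Euc m => Real.log ‖x‖) := by
  have h1 : LocallyIntegrable (fun x : Euc m => ‖x‖ + (‖x‖^1)⁻¹) :=
    (continuous_norm.locallyIntegrable).add (npow_locInt hm (by omega))
  refine h1.mono (Real.measurable_log.comp measurable_norm).aestronglyMeasurable ?_
  refine Eventually.of_forall fun x => ?_
  rw [Real.norm_eq_abs, Real.norm_eq_abs, pow_one]
  exact (abs_log_le (norm_nonneg x)).trans (le_abs_self _)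

theorem spow_contDiff {m : ℕ} (z : Euc m) {a : ℝ} (ha : 0 < a) (p : ℕ) :
    ContDiff ℝ (⊤ : ℕ∞) (fun y : Euc m => ((‖y - z‖^2 + a)^p)⁻¹) := by
  have h1 : ContDiff ℝ (⊤ : ℕ∞) (fun y : Euc m => ‖y - z‖^2) :=
      (contDiff_norm_sq ℝ).comp (contDiff_id.sub contDiff_const)
  exact ((h1.add contDiff_const).pow p).inv fun y => by positivity

theorem slog_contDiff {m : ℕ} (z : Euc m) {a : ℝ} (ha : 0 < a) :
    ContDiff ℝ (⊤ : ℕ∞) (fun y : Euc m => Real.log (‖y - z‖^2 + a)) := by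
  have h1 : ContDiff ℝ (⊤ : ℕ∞) (fun y : Euc m => ‖y - z‖^2) :=
      (contDiff_norm_sq ℝ).comp (contDiff_id.sub contDiff_const)
  exact (h1.add contDiff_const).log fun y => by positivity

theorem spow_deriv {a : ℝ} (ha : 0 < a) (p : ℕ) (s : ℝ) (hs : 0 ≤ s) :
    HasDerivAt (fun s => ((s + a)^p)⁻¹) (-p * ((s + a)^(p+1))⁻¹) s := by
  have hp : s + a ≠ 0 := by positivity
  have := (((hasDerivAt_id s).add_const a).pow p).inv (pow_ne_zero p hp)
  refine this.congr_deriv ?_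
  simp only [id]
  rcases p with _ | p
  · simp
  · simp only [Nat.add_sub_cancel]
    field_simp
    simp only [Pi.add_apply, Pi.pow_apply, id]
    ring

theorem lap_spow {m : ℕ} (z : Euc m) {a : ℝ} (ha : 0 < a) (p : ℕ) (y : Euc m) :
    - lap (fun y : Euc m => ((‖y - z‖^2 + a)^p)⁻¹) y =
      4 * p * (m - p - 1) * ((‖y - z‖^2 + a)^(p+1))⁻¹
        + 4 * p * (p + 1) * a * ((‖y - z‖^2 + a)^(p+2))⁻¹ := by
  have h1 : ∀ s : ℝ, 0 ≤ s → HasDerivAt (fun s => -p * ((s + a)^(p+1))⁻¹)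
      (p * (p+1) * ((s + a)^(p+2))⁻¹) s := by
    intro s hs
    have := (spow_deriv ha (p+1) s hs).const_mul (-p : ℝ)
    refine this.congr_deriv ?_
    push_cast; ring
  rw [lap_radial z (F := fun s => ((s + a)^p)⁻¹) (spow_deriv ha p) h1]
  have hp : ‖y - z‖^2 + a ≠ 0 := by positivity
  field_simp
  ring

theorem lap_slog {m : ℕ} (z : Euc m) {a : ℝ} (ha : 0 < a) (y : Euc m) :
    - lap (fun y : Euc m => Real.log (‖y - z‖^2 + a)) y =
      - (4 * ((m - 1) * ((‖y - z‖^2 + a)^1)⁻¹ + a * ((‖y - z‖^2 + a)^2)⁻¹)) := by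
  have h0 : ∀ s : ℝ, 0 ≤ s → HasDerivAt (fun s => Real.log (s + a)) (((s + a)^1)⁻¹) s := by
    intro s hs
    have := ((hasDerivAt_id s).add_const a).log (by simp; positivity)
    refine this.congr_deriv ?_
    simp
  rw [lap_radial z h0 (spow_deriv ha 1)]
  have hp : ‖y - z‖^2 + a ≠ 0 := by positivity
  field_simp
  ring

theorem lap_sum {m : ℕ} (S : Finset ℕ) (c : ℕ → ℝ) {f : ℕ → Euc m → ℝ}
    (hf : ∀ i, ContDiff ℝ (⊤ : ℕ∞) (f i)) (y : Euc m) :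
    lap (fun y => ∑ i ∈ S, c i * f i y) y = ∑ i ∈ S, c i * lap (f i) y := by
  induction S using Finset.induction_on with
  | empty => simp [lap]
  | insert i S hi ih =>
    simp only [Finset.sum_insert hi]
    rw [lap_add (contDiff_const.mul (hf i)) (ContDiff.sum fun j _ => contDiff_const.mul (hf j)),
      lap_const_mul (hf i), ih]

/-- Coefficients in the iterated Laplacian of the regularized logarithm. -/
def Dco (m k i : ℕ) : ℝ :=
  ((k+1).choose i : ℝ) * ((k+i).factorial : ℝ) * ∏ t ∈ Finset.Ioc i (k+1), ((m:ℝ) - t)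

theorem Dco_zero (m k : ℕ) : Dco m (k+1) 0 = Dco m k 0 * ((k+1) * (m - (k+1) - 1)) := by
  simp only [Dco, Nat.choose_zero_right, add_zero]
  rw [Finset.prod_Ioc_succ_top (by omega : 0 ≤ k+1), Nat.factorial_succ]
  push_cast; ring

theorem Dco_succ (m k i : ℕ) (hi : i < k + 2) : Dco m (k+1) (i+1) =
    Dco m k (i+1) * ((k+1+(i+1)) * (m - (k+1+(i+1)) - 1)) + Dco m k i * ((k+1+i) * (k+1+i+1)) := by
  simp only [Dco]
  rcases (by omega : i ≤ k ∨ i = k+1) with h | h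
  · rw [Finset.prod_Ioc_succ_top (by omega : i+1 ≤ k+1)]
    have e1 : ∏ t ∈ Finset.Ioc i (k+1), ((m:ℝ) - t)
        = ((m:ℝ) - (i+1)) * ∏ t ∈ Finset.Ioc (i+1) (k+1), ((m:ℝ) - t) := by
      rw [← Finset.insert_Ioc_add_one_left_eq_Ioc (by omega : i < k+1)]
      rw [Finset.prod_insert (by simp)]
      push_cast; ring
    rw [e1]
    have e2 : ((k+1+(i+1)).factorial : ℝ) = (k+i+2) * ((k+i+1) * (k+i).factorial) := by
      rw [show k+1+(i+1) = (k+i+1)+1 by ring, Nat.factorial_succ, Nat.factorial_succ]; push_cast; ring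
    have e3 : ((k+(i+1)).factorial : ℝ) = ((k+i+1) * (k+i).factorial) := by
      rw [show k+(i+1) = (k+i)+1 by ring, Nat.factorial_succ]; push_cast; ring
    have e4 : ((k+1+1).choose (i+1) : ℝ) = (k+1).choose i + (k+1).choose (i+1) := by
      rw [Nat.choose_succ_succ]; push_cast; ring
    have e5 : ((k+1).choose (i+1) : ℝ) * (i+1) = (k+1).choose i * (k + 1 - i) := by
      have := Nat.choose_succ_right_eq (k+1) i
      have h2 : (((k+1).choose (i+1) * (i+1) : ℕ) : ℝ) = (((k+1).choose i * (k+1-i) : ℕ) : ℝ) := by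
        rw [this]
      push_cast [Nat.cast_sub (by omega : i ≤ k+1)] at h2
      exact h2
    rw [e2, e3, e4]
    push_cast
    linear_combination ((k+i+2) * ((k+i+1) * ((k+i).factorial:ℝ)) *
      (∏ t ∈ Finset.Ioc (i+1) (k+1), ((m:ℝ) - t))) * e5
  · subst h
    simp only [Nat.choose_self, Nat.choose_succ_self, Finset.Ioc_self, Finset.prod_empty]
    rw [show k+1+(k+1+1) = (k+(k+1)+1)+1 by ring, Nat.factorial_succ, Nat.factorial_succ]
    push_cast; ring

theorem negLapPow_slog {m : ℕ} (z : Euc m) {a : ℝ} (ha : 0 < a) (k : ℕ) :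
    negLapPow (k+1) (fun y : Euc m => Real.log (‖y - z‖^2 + a)) = fun y =>
      ∑ i ∈ Finset.range (k+2), (-(4^(k+1) * (Dco m k i * a^i))) * ((‖y - z‖^2 + a)^(k+1+i))⁻¹ := by
  induction k with
  | zero =>
    rw [negLapPow_succ', negLapPow_zero]
    funext y
    rw [lap_slog z ha]
    simp [Dco, Finset.sum_range_succ]
    ring
  | succ k ih =>
    rw [negLapPow_succ', ih]
    funext y
    rw [lap_sum _ _ (fun i => spow_contDiff z ha (k+1+i)), ← Finset.sum_neg_distrib]
    have e : ∀ i, -(-(4^(k+1) * (Dco m k i * a^i)) * lap (fun y : Euc m => ((‖y - z‖^2 + a)^(k+1+i))⁻¹) y)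
        = -(4^(k+2) * (Dco m k i * ((k+1+i) * (m - (k+1+i) - 1))) * a^i * ((‖y - z‖^2 + a)^(k+2+i))⁻¹)
         + -(4^(k+2) * (Dco m k i * ((k+1+i) * (k+1+i+1))) * a^(i+1) * ((‖y - z‖^2 + a)^(k+2+(i+1)))⁻¹) := by
      intro i
      rw [← mul_neg, lap_spow z ha]
      rw [show k+1+i+1 = k+2+i by ring, show k+1+i+2 = k+2+(i+1) by ring]
      push_cast
      ring
    simp only [e, Finset.sum_add_distrib]
    have hx : ∑ i ∈ Finset.range (k+2), -(4^(k+2) * (Dco m k i * ((k+1+i) * (m - (k+1+i) - 1))) * a^i * ((‖y - z‖^2 + a)^(k+2+i))⁻¹)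
        = ∑ i ∈ Finset.range (k+3), -(4^(k+2) * (Dco m k i * ((k+1+i) * (m - (k+1+i) - 1))) * a^i * ((‖y - z‖^2 + a)^(k+2+i))⁻¹) := by
      rw [Finset.sum_range_succ _ (k+2)]
      have : Dco m k (k+2) = 0 := by simp [Dco]
      rw [this]; simp
    rw [hx, show k + 1 + 2 = (k+2) + 1 by ring, Finset.sum_range_succ' _ (k+2), Finset.sum_range_succ' _ (k+2), add_right_comm,
      ← Finset.sum_add_distrib]
    congr 1
    · refine Finset.sum_congr rfl fun i hi => ?_
      rw [Dco_succ m k i (Finset.mem_range.1 hi), show k+1+1 = k+2 by ring]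
      push_cast
      ring
    · rw [Dco_zero]
      push_cast
      ring


theorem locInt_sub {m : ℕ} {f : Euc m → ℝ} (hf : LocallyIntegrable f) (z : Euc m) :
    LocallyIntegrable (fun x => f (x - z)) := by
  rw [locallyIntegrable_iff]
  intro K hK
  have h1 : IsCompact ((fun x => x - z) '' K) := hK.image (continuous_id.sub continuous_const)
  have h2 := (measurePreserving_sub_right volume z).integrableOn_comp_preimage
    (MeasurableEquiv.subRight z).measurableEmbedding (f := f) (s := (fun x => x - z) '' K)
  have h3 := h2.2 (hf.integrableOn_isCompact h1)
  exact h3.mono_set (subset_preimage_image _ _)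

theorem negLapPow_slog_top {m : ℕ} (hm : 1 ≤ m) (z : Euc m) {a : ℝ} (ha : 0 < a) :
    negLapPow m (fun y : Euc m => Real.log (‖y - z‖^2 + a)) = fun y =>
      (-(4^m * ((2*m-1).factorial * a^m))) * ((‖y - z‖^2 + a)^(2*m))⁻¹ := by
  obtain ⟨k, rfl⟩ : ∃ k, m = k + 1 := ⟨m - 1, by omega⟩
  rw [negLapPow_slog z ha k]
  funext y
  rw [Finset.sum_range_succ, Finset.sum_eq_zero, zero_add]
  · have h1 : Dco (k+1) k (k+1) = ((2*(k+1)-1).factorial : ℝ) := by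
      simp only [Dco, Nat.choose_self, Finset.Ioc_self, Finset.prod_empty]
      rw [show k + (k+1) = 2*(k+1)-1 by omega]; simp
    rw [h1, show k+1+(k+1) = 2*(k+1) by ring]
  · intro i hi
    have : Dco (k+1) k i = 0 := by
      simp only [Dco]
      rw [Finset.prod_eq_zero (i := k+1)]
      · simp
      · simp at hi ⊢; omega
      · simp
    rw [this]; simp

theorem bubble_int {m : ℕ} (hm : 1 ≤ m) :
    Integrable (fun t : Euc m => ((‖t‖^2 + 1)^(2*m))⁻¹) := by
  have h := integrable_rpow_neg_one_add_norm_sq (E := Euc m) (μ := volume) (r := 4*m) (by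
    rw [finrank_euclideanSpace, Fintype.card_fin]; push_cast
    have : (1:ℝ) ≤ m := by exact_mod_cast hm
    linarith)
  refine h.congr (Eventually.of_forall fun t => ?_)
  have : (-(4*(m:ℝ))/2) = -((2*m : ℕ):ℝ) := by push_cast; ring
  simp only [this]
  rw [Real.rpow_neg (by positivity), Real.rpow_natCast, add_comm]

theorem bubble_pos {m : ℕ} (hm : 1 ≤ m) :
    0 < ∫ t : Euc m, ((‖t‖^2 + 1)^(2*m))⁻¹ := by
  rw [integral_pos_iff_support_of_nonneg (fun t => by positivity) (bubble_int hm)]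
  have : Function.support (fun t : Euc m => ((‖t‖^2 + 1)^(2*m))⁻¹) = univ := by
    ext t
    simp only [Function.mem_support, mem_univ, iff_true]
    positivity
  rw [this]
  exact (isOpen_univ (X := Euc m)).measure_pos volume ⟨0, mem_univ _⟩

theorem fund_eps {m : ℕ} (hm : 1 ≤ m) {ψ : Euc m → ℝ} (hψ : IsTestOn univ ψ) (z : Euc m)
    {ε : ℝ} (hε : 0 < ε) :
    ∫ x, Real.log (‖x - z‖^2 + ε^2) * negLapPow m ψ x
      = (-(4^m * ((2*m-1).factorial : ℝ))) * ∫ t : Euc m, ((‖t‖^2 + 1)^(2*m))⁻¹ * ψ (z + ε • t) := by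
  have h0 : 0 < ε^2 := by positivity
  rw [ibp_pow m isOpen_univ (slog_contDiff z h0).contDiffOn hψ, negLapPow_slog_top hm z h0]
  have e1 : ∀ t : Euc m, ((‖t‖^2 + 1)^(2*m))⁻¹ * ψ (z + ε • t)
      = (fun w : Euc m => ε^(4*m) * ((‖w‖^2 + ε^2)^(2*m))⁻¹ * ψ (z + w)) (ε • t) := by
    intro t
    simp only [norm_smul, Real.norm_eq_abs, abs_of_pos hε]
    rw [show (ε * ‖t‖)^2 + ε^2 = ε^2 * (‖t‖^2 + 1) by ring, mul_pow, mul_inv, ← pow_mul]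
    rw [show 2 * (2*m) = 4*m by ring]
    field_simp
  simp_rw [e1]
  rw [Measure.integral_comp_smul volume (fun w : Euc m => ε^(4*m) * ((‖w‖^2 + ε^2)^(2*m))⁻¹ * ψ (z + w)) ε]
  rw [finrank_euclideanSpace, Fintype.card_fin, abs_of_pos (by positivity), smul_eq_mul,
    ← integral_sub_right_eq_self (fun w : Euc m => ε^(4*m) * ((‖w‖^2 + ε^2)^(2*m))⁻¹ * ψ (z + w)) z, ← integral_const_mul, ← integral_const_mul]
  refine integral_congr_ae (Eventually.of_forall fun x => ?_)
  simp only [add_sub_cancel]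
  rw [← pow_mul ε 2 m, show 4*m = 2*m + 2*m by ring, pow_add]
  field_simp

theorem fund {m : ℕ} (hm : 1 ≤ m) : ∃ c : ℝ, c ≠ 0 ∧ ∀ ψ : Euc m → ℝ, IsTestOn univ ψ → ∀ z : Euc m,
    ∫ x, Real.log ‖x - z‖ * negLapPow m ψ x = c * ψ z := by
  refine ⟨(-(4^m * ((2*m-1).factorial : ℝ))) * (∫ t : Euc m, ((‖t‖^2 + 1)^(2*m))⁻¹) / 2, ?_, ?_⟩
  · have := bubble_pos hm
    have h2 : (0:ℝ) < (2*m-1).factorial := by exact_mod_cast Nat.factorial_pos _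
    have : 0 < 4^m * ((2*m-1).factorial : ℝ) * (∫ t : Euc m, ((‖t‖^2 + 1)^(2*m))⁻¹) := by positivity
    intro h
    linarith
  intro ψ hψ z
  have hnt := euc_nontrivial hm
  have hψc : Continuous ψ := hψ.1.continuous
  have hL := negLapPow_test m hψ
  set e : ℕ → ℝ := fun n => 1 / ((n:ℝ) + 1) with he
  have hepos : ∀ n, 0 < e n := fun n => by positivity
  have hele : ∀ n, e n ≤ 1 := fun n => by
    rw [he]; simp only; rw [div_le_one (by positivity)]; linarith [Nat.cast_nonneg (α := ℝ) n]
  have he0 : Tendsto e atTop (𝓝 0) := tendsto_one_div_add_atTop_nhds_zero_nat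
  -- right hand side
  obtain ⟨M, hM⟩ := hψ.2.1.exists_bound_of_continuous hψc
  have hR : Tendsto (fun n => ∫ t : Euc m, ((‖t‖^2 + 1)^(2*m))⁻¹ * ψ (z + e n • t)) atTop
      (𝓝 (∫ t : Euc m, ((‖t‖^2 + 1)^(2*m))⁻¹ * ψ z)) := by
    refine tendsto_integral_of_dominated_convergence (fun t => ((‖t‖^2 + 1)^(2*m))⁻¹ * M) ?_ ?_ ?_ ?_
    · intro n
      exact (bubble_int hm).aestronglyMeasurable.mul (by fun_prop)
    · exact (bubble_int hm).mul_const M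
    · intro n
      refine Eventually.of_forall fun t => ?_
      rw [norm_mul, Real.norm_of_nonneg (by positivity)]
      exact mul_le_mul_of_nonneg_left (hM _) (by positivity)
    · refine Eventually.of_forall fun t => ?_
      refine Tendsto.mul tendsto_const_nhds ?_
      have : Tendsto (fun n => z + e n • t) atTop (𝓝 (z + (0:ℝ) • t)) :=
        tendsto_const_nhds.add (he0.smul_const t)
      rw [zero_smul, add_zero] at this
      exact (hψc.tendsto z).comp this
  rw [integral_mul_const] at hR
  -- left hand side
  have hb : LocallyIntegrable (fun x : Euc m => 2 * |Real.log ‖x - z‖| + ‖x - z‖^2) := by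
    have h0 : LocallyIntegrable (fun x : Euc m => |Real.log ‖x - z‖|) :=
      (locInt_sub (log_locInt hm) z).mono (by
        exact (continuous_abs.measurable.comp (Real.measurable_log.comp
          (by fun_prop : Continuous (fun x : Euc m => ‖x - z‖)).measurable)).aestronglyMeasurable)
        (Eventually.of_forall fun x => by simp)
    have h1 := h0.smul (2:ℝ)
    have h2 : LocallyIntegrable (fun x : Euc m => ‖x - z‖^2) (volume : Measure (Euc m)) :=
      (by fun_prop : Continuous (fun x : Euc m => ‖x - z‖^2)).locallyIntegrable
    exact h1.add h2
  have hLc : Continuous (negLapPow m ψ) := hL.1.continuous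
  have hLl : Tendsto (fun n => ∫ x, Real.log (‖x - z‖^2 + (e n)^2) * negLapPow m ψ x) atTop
      (𝓝 (∫ x, (2 * Real.log ‖x - z‖) * negLapPow m ψ x)) := by
    have hae : ∀ᵐ x : Euc m, x ≠ z := by
      rw [ae_iff]; simp
    refine tendsto_integral_of_dominated_convergence
      (fun x => |negLapPow m ψ x| * (2 * |Real.log ‖x - z‖| + ‖x - z‖^2)) ?_ ?_ ?_ ?_
    · intro n
      refine AEStronglyMeasurable.mul ?_ hLc.aestronglyMeasurable
      exact (slog_contDiff z (by have := hepos n; positivity)).continuous.aestronglyMeasurable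
    · exact hb.integrable_smul_left_of_hasCompactSupport (continuous_abs.comp hLc)
        (hL.2.1.comp_left abs_zero)
    · intro n
      filter_upwards [hae] with x hx
      have hx' : 0 < ‖x - z‖ := norm_pos_iff.2 (sub_ne_zero.2 hx)
      rw [norm_mul, mul_comm, Real.norm_eq_abs, Real.norm_eq_abs]
      refine mul_le_mul_of_nonneg_left ?_ (abs_nonneg _)
      have hen := hepos n
      have h1 := Real.log_le_sub_one_of_pos (by positivity : 0 < ‖x - z‖^2 + (e n)^2)
      have h2 : (e n)^2 ≤ 1 := by nlinarith [hele n]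
      have h3 : Real.log (‖x - z‖^2) ≤ Real.log (‖x - z‖^2 + (e n)^2) :=
        Real.log_le_log (by positivity) (by nlinarith)
      rw [Real.log_pow] at h3
      push_cast at h3
      rw [abs_le]
      have h4 := neg_abs_le (Real.log ‖x - z‖)
      have h5 := abs_nonneg (Real.log ‖x - z‖)
      constructor
      · nlinarith [sq_nonneg ‖x-z‖]
      · nlinarith
    · filter_upwards [hae] with x hx
      have hx' : 0 < ‖x - z‖ := norm_pos_iff.2 (sub_ne_zero.2 hx)
      refine Tendsto.mul ?_ tendsto_const_nhds
      have h1 : Tendsto (fun n => ‖x - z‖^2 + (e n)^2) atTop (𝓝 (‖x - z‖^2 + 0^2)) :=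
        tendsto_const_nhds.add (he0.pow 2)
      have h2 := (Real.continuousAt_log (x := ‖x - z‖^2 + 0^2) (by positivity)).tendsto.comp h1
      have h3 : Real.log (‖x - z‖^2 + 0^2) = 2 * Real.log ‖x - z‖ := by
        rw [zero_pow two_ne_zero, add_zero, Real.log_pow]; norm_num
      rw [h3] at h2
      exact h2
  have hfin := tendsto_nhds_unique hLl ((hR.const_mul (-(4^m * ((2*m-1).factorial : ℝ)))).congr
    fun n => (fund_eps hm hψ z (hepos n)).symm)
  simp only [mul_assoc] at hfin
  rw [integral_const_mul] at hfin
  linear_combination hfin / 2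


/-! ### Part 6: regularity of potentials -/

/-- Bounded measurable function vanishing off a ball. -/
def BddSupp {m : ℕ} (F : Euc m → ℝ) (B R : ℝ) : Prop :=
  Measurable F ∧ (∀ y, |F y| ≤ B) ∧ ∀ y, y ∉ ball (0 : Euc m) R → F y = 0

/-- Kernel family dominated by a locally integrable function. -/
def Dom {m : ℕ} {E : Type} [NormedAddCommGroup E] [NormedSpace ℝ E] (k : Euc m × ℝ → E) : Prop :=
  ContDiffOn ℝ (⊤ : ℕ∞) k {0}ᶜ ∧ ∃ b : Euc m → ℝ, LocallyIntegrable b ∧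
    ∀ ε ∈ Icc (0:ℝ) 1, ∀ x : Euc m, x ≠ 0 → ‖k (x, ε)‖ ≤ b x

/-- The regularization sequence. -/
def een (n : ℕ) : ℝ := 1 / ((n:ℝ) + 1)

theorem een_pos (n : ℕ) : 0 < een n := by unfold een; positivity

theorem een_le (n : ℕ) : een n ≤ 1 := by
  unfold een; rw [div_le_one (by positivity)]; linarith [Nat.cast_nonneg (α := ℝ) n]

theorem een_tendsto : Tendsto een atTop (𝓝 0) := tendsto_one_div_add_atTop_nhds_zero_nat

section
variable {m : ℕ} {E : Type} [NormedAddCommGroup E] [NormedSpace ℝ E]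

theorem ae_ne_zero (hm : 1 ≤ m) : ∀ᵐ x : Euc m, x ≠ 0 := by
  have := euc_nontrivial hm
  rw [ae_iff]; simp

theorem Dom.contDiff {k : Euc m × ℝ → E} (hk : Dom k) {ε : ℝ} (hε : 0 < ε) :
    ContDiff ℝ (⊤ : ℕ∞) (fun x : Euc m => k (x, ε)) := by
  rw [← contDiffOn_univ]
  refine hk.1.comp (t := {0}ᶜ) (contDiff_id.prodMk contDiff_const).contDiffOn ?_
  intro x _ h
  have : (x, ε) = (0 : Euc m × ℝ) := h
  exact hε.ne' (congrArg Prod.snd this)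

theorem Dom.cont_at {k : Euc m × ℝ → E} (hk : Dom k) {x : Euc m} (hx : x ≠ 0) :
    ContinuousAt k (x, 0) := by
  refine hk.1.continuousOn.continuousAt (isOpen_compl_singleton.mem_nhds ?_)
  intro h
  have : (x, 0) = (0 : Euc m × ℝ) := h
  exact hx (congrArg Prod.fst this)

theorem Dom.meas {k : Euc m × ℝ → E} (hm : 1 ≤ m) (hk : Dom k) :
    AEStronglyMeasurable (fun x : Euc m => k (x, 0)) := by
  have h1 : ContinuousOn (fun x : Euc m => k (x, 0)) {0}ᶜ := by
    intro x hx
    exact (ContinuousAt.comp (f := fun x : Euc m => (x, (0:ℝ))) (hk.cont_at hx)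
      (by fun_prop)).continuousWithinAt
  have h2 := h1.aestronglyMeasurable (μ := volume) (measurableSet_singleton _).compl
  rwa [Measure.restrict_eq_self_of_ae_mem (s := {0}ᶜ) (ae_ne_zero hm)] at h2

theorem Dom.meas' {k : Euc m × ℝ → E} (hm : 1 ≤ m) (hk : Dom k) {ε : ℝ} (hε : 0 ≤ ε) :
    AEStronglyMeasurable (fun x : Euc m => k (x, ε)) := by
  rcases hε.eq_or_lt with h | h
  · rw [← h]; exact hk.meas hm
  · exact (hk.contDiff h).continuous.aestronglyMeasurable

theorem Dom.locInt {k : Euc m × ℝ → E} (hm : 1 ≤ m) (hk : Dom k) {ε : ℝ} (hε : ε ∈ Icc (0:ℝ) 1) :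
    LocallyIntegrable (fun x : Euc m => k (x, ε)) := by
  obtain ⟨b, hb, hkb⟩ := hk.2
  refine hb.mono (hk.meas' hm hε.1) ?_
  filter_upwards [ae_ne_zero hm] with x hx
  exact (hkb ε hε x hx).trans (le_abs_self _)

theorem locInt_ball {f : Euc m → E} (hf : LocallyIntegrable f) (R : ℝ) : IntegrableOn f (ball 0 R) :=
  (hf.integrableOn_isCompact (isCompact_closedBall 0 R)).mono_set ball_subset_closedBall

theorem Dom.L1 {k : Euc m × ℝ → E} (hm : 1 ≤ m) (hk : Dom k) (R : ℝ) :
    Tendsto (fun n => ∫ x in ball (0 : Euc m) R, ‖k (x, een n) - k (x, 0)‖) atTop (𝓝 0) := by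
  obtain ⟨b, hb, hkb⟩ := hk.2
  have h : Tendsto (fun n => ∫ x in ball (0 : Euc m) R, ‖k (x, een n) - k (x, 0)‖) atTop
      (𝓝 (∫ x in ball (0 : Euc m) R, (0:ℝ))) := by
    refine tendsto_integral_of_dominated_convergence (fun x => b x + b x) ?_ ?_ ?_ ?_
    · intro n
      exact ((hk.meas' hm (een_pos n).le).sub (hk.meas hm)).norm.restrict
    · exact (locInt_ball hb R).add (locInt_ball hb R)
    · intro n
      filter_upwards [ae_restrict_of_ae (ae_ne_zero hm)] with x hx
      rw [norm_norm]
      refine (norm_sub_le _ _).trans (add_le_add ?_ ?_)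
      · exact hkb _ ⟨(een_pos n).le, een_le n⟩ x hx
      · exact hkb _ ⟨le_rfl, zero_le_one⟩ x hx
    · filter_upwards [ae_restrict_of_ae (ae_ne_zero hm)] with x hx
      have h1 : Tendsto (fun n => (x, een n)) atTop (𝓝 (x, (0:ℝ))) :=
        tendsto_const_nhds.prodMk_nhds een_tendsto
      have h2 := (hk.cont_at hx).tendsto.comp h1
      have h3 := (h2.sub (tendsto_const_nhds (x := k (x, 0)))).norm
      simpa using h3
  simpa using h

theorem conv_int {k : Euc m → E} (hk : LocallyIntegrable k) {F : Euc m → ℝ} {B R0 : ℝ}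
    (hF : BddSupp F B R0) (x : Euc m) : Integrable (fun z => F (x - z) • k z) := by
  have h1 : IntegrableOn k (ball 0 (‖x‖ + R0)) := locInt_ball hk _
  have h2 : IntegrableOn (fun z => F (x - z) • k z) (ball 0 (‖x‖ + R0)) := by
    refine Integrable.bdd_smul (C := B) h1 ?_ ?_
    · exact (hF.1.comp (measurable_const.sub measurable_id)).aestronglyMeasurable
    · exact Eventually.of_forall fun z => hF.2.1 _
  refine (integrableOn_iff_integrable_of_support_subset ?_).1 h2
  intro z hz
  by_contra hz2
  apply hz
  simp only
  rw [hF.2.2, zero_smul]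
  intro h3
  apply hz2
  rw [mem_ball_zero_iff] at h3 ⊢
  calc ‖z‖ = ‖x - (x - z)‖ := by congr 1; abel
    _ ≤ ‖x‖ + ‖x - z‖ := norm_sub_le _ _
    _ < _ := by linarith

theorem conv_int' {k : Euc m → E} (hk : LocallyIntegrable k) {F : Euc m → ℝ} {B R0 : ℝ}
    (hF : BddSupp F B R0) (x : Euc m) : Integrable (fun y => F y • k (x - y)) := by
  have := (conv_int hk hF x).comp_sub_left x
  simpa using this

theorem conv_swap (k : Euc m → E) (F : Euc m → ℝ) (x : Euc m) :
    ∫ y, F y • k (x - y) = ∫ z, F (x - z) • k z := by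
  rw [← integral_sub_left_eq_self _ volume x]
  simp

theorem conv_bound {k : Euc m → E} (hk : LocallyIntegrable k) {F : Euc m → ℝ} {B R0 : ℝ}
    (hF : BddSupp F B R0) {x : Euc m} {R : ℝ} (hx : ‖x‖ ≤ R) :
    ‖∫ y, F y • k (x - y)‖ ≤ B * ∫ z in ball (0 : Euc m) (R + R0), ‖k z‖ := by
  rw [conv_swap, ← integral_const_mul, ← integral_indicator measurableSet_ball]
  refine norm_integral_le_of_norm_le ?_ (Eventually.of_forall fun z => ?_)
  · exact (integrable_indicator_iff measurableSet_ball).2 (((locInt_ball hk _).norm).const_mul B)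
  by_cases hz : z ∈ ball (0 : Euc m) (R + R0)
  · rw [indicator_of_mem hz, norm_smul]
    exact mul_le_mul_of_nonneg_right (hF.2.1 _) (norm_nonneg _)
  · rw [indicator_of_notMem hz, hF.2.2, zero_smul, norm_zero]
    intro h3
    apply hz
    rw [mem_ball_zero_iff] at h3 ⊢
    calc ‖z‖ = ‖x - (x - z)‖ := by congr 1; abel
      _ ≤ ‖x‖ + ‖x - z‖ := norm_sub_le _ _
      _ < _ := by linarith

theorem Dom.unif {k : Euc m × ℝ → E} (hm : 1 ≤ m) (hk : Dom k) {F : Euc m → ℝ} {B R0 : ℝ}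
    (hF : BddSupp F B R0) (R : ℝ) :
    TendstoUniformlyOn (fun n x => ∫ y, F y • k (x - y, een n)) (fun x => ∫ y, F y • k (x - y, 0))
      atTop (ball (0 : Euc m) R) := by
  rw [Metric.tendstoUniformlyOn_iff]
  intro ε hε
  have h1 := (hk.L1 hm (R + R0)).const_mul B
  rw [mul_zero] at h1
  filter_upwards [h1.eventually_lt_const hε] with n hn x hx
  refine lt_of_le_of_lt ?_ hn
  have l1 := hk.locInt hm (ε := een n) ⟨(een_pos n).le, een_le n⟩
  have l2 := hk.locInt hm (ε := 0) ⟨le_rfl, zero_le_one⟩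
  rw [dist_comm, dist_eq_norm, ← integral_sub (conv_int' l1 hF x) (conv_int' l2 hF x)]
  simp only [← smul_sub]
  exact conv_bound (l1.sub l2) hF (mem_ball_zero_iff.1 hx).le

theorem conv_hasFDerivAt {k : Euc m → E} (hk : ContDiff ℝ (⊤ : ℕ∞) k) {F : Euc m → ℝ} {B R0 : ℝ}
    (hF : BddSupp F B R0) (x : Euc m) :
    HasFDerivAt (fun x => ∫ y, F y • k (x - y)) (∫ y, F y • fderiv ℝ k (x - y)) x := by
  have hk1 : Continuous (fderiv ℝ k) := hk.continuous_fderiv (by norm_num)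
  obtain ⟨M, hM⟩ := (isCompact_closedBall (0 : Euc m) (‖x‖ + 1 + R0)).exists_bound_of_continuousOn
    hk1.continuousOn
  have hB : 0 ≤ B := (abs_nonneg _).trans (hF.2.1 0)
  refine hasFDerivAt_integral_of_dominated_of_fderiv_le (𝕜 := ℝ) (E := E) (F := fun x y => F y • k (x - y)) (F' := fun x y => F y • fderiv ℝ k (x - y)) (s := ball x 1)
    (bound := (ball (0 : Euc m) R0).indicator fun _ => B * M) (ball_mem_nhds x one_pos) ?_ ?_ ?_ ?_ ?_ ?_
  · refine Eventually.of_forall fun y => ?_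
    exact (conv_int' hk.continuous.locallyIntegrable hF y).aestronglyMeasurable
  · exact conv_int' hk.continuous.locallyIntegrable hF x
  · exact (conv_int' hk1.locallyIntegrable hF x).aestronglyMeasurable
  · refine Eventually.of_forall fun y z hz => ?_
    by_cases hy : y ∈ ball (0 : Euc m) R0
    · rw [indicator_of_mem hy, norm_smul]
      refine mul_le_mul (hF.2.1 y) (hM _ ?_) (norm_nonneg _) hB
      rw [mem_closedBall_zero_iff]
      rw [mem_ball_zero_iff] at hy
      rw [mem_ball, dist_eq_norm] at hz
      calc ‖z - y‖ = ‖x + (z - x) - y‖ := by congr 1; abel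
        _ ≤ ‖x + (z - x)‖ + ‖y‖ := norm_sub_le _ _
        _ ≤ ‖x‖ + ‖z - x‖ + ‖y‖ := by gcongr; exact norm_add_le _ _
        _ ≤ _ := by linarith
    · rw [indicator_of_notMem hy, hF.2.2 y hy, zero_smul, norm_zero]
  · exact (integrable_indicator_iff measurableSet_ball).2 (integrableOn_const (by exact measure_ball_lt_top.ne))
  · refine Eventually.of_forall fun y z hz => ?_
    have h1 : HasFDerivAt k (fderiv ℝ k (z - y)) (z - y) :=
      (hk.differentiable (by norm_num) _).hasFDerivAt
    have h2 : HasFDerivAt (fun z => k (z - y)) (fderiv ℝ k (z - y)) z := by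
      have := h1.comp z ((hasFDerivAt_id z).sub_const y)
      rw [ContinuousLinearMap.comp_id] at this
      exact this
    exact h2.const_smul (F y)

theorem Dom.continuous {k : Euc m × ℝ → E} (hm : 1 ≤ m) (hk : Dom k) {F : Euc m → ℝ} {B R0 : ℝ}
    (hF : BddSupp F B R0) : Continuous (fun x => ∫ y, F y • k (x - y, 0)) := by
  rw [continuous_iff_continuousAt]
  intro x
  have h1 := (hk.unif hm hF (‖x‖+1)).continuousOn (Eventually.frequently (Eventually.of_forall fun n => ?_))
  · exact h1.continuousAt (isOpen_ball.mem_nhds (by simp))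
  · refine Continuous.continuousOn ?_
    rw [continuous_iff_continuousAt]
    intro y
    exact (conv_hasFDerivAt (hk.contDiff (een_pos n)) hF y).continuousAt

/-- Derivative of the kernel in the space directions. -/
def dk (k : Euc m × ℝ → E) (p : Euc m × ℝ) : Euc m →L[ℝ] E :=
  (fderiv ℝ k p).comp (ContinuousLinearMap.inl ℝ (Euc m) ℝ)

theorem dk_contDiffOn {k : Euc m × ℝ → E} (hk : ContDiffOn ℝ (⊤ : ℕ∞) k {0}ᶜ) :
    ContDiffOn ℝ (⊤ : ℕ∞) (dk k) {0}ᶜ := by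
  have h : ContDiffOn ℝ (⊤ : ℕ∞) (fderiv ℝ k) {0}ᶜ :=
    hk.fderiv_of_isOpen isOpen_compl_singleton (by norm_cast)
  exact h.clm_comp contDiffOn_const

theorem dk_eq {k : Euc m × ℝ → E} (hk : ContDiffOn ℝ (⊤ : ℕ∞) k {0}ᶜ) {ε : ℝ} (hε : 0 < ε) (x : Euc m) :
    fderiv ℝ (fun x => k (x, ε)) x = dk k (x, ε) := by
  have hp : (x, ε) ∈ ({0}ᶜ : Set (Euc m × ℝ)) := by
    intro h
    have : (x, ε) = (0 : Euc m × ℝ) := h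
    exact hε.ne' (congrArg Prod.snd this)
  have h1 : HasFDerivAt k (fderiv ℝ k (x, ε)) (x, ε) :=
    ((hk.contDiffAt (isOpen_compl_singleton.mem_nhds hp)).differentiableAt (by norm_num)).hasFDerivAt
  exact (h1.comp x (hasFDerivAt_prodMk_left x ε)).fderiv

theorem Dom.hasFDerivAt {k : Euc m × ℝ → E} (hm : 1 ≤ m) (hk : Dom k) (hdk : Dom (dk k))
    {F : Euc m → ℝ} {B R0 : ℝ} (hF : BddSupp F B R0) (x : Euc m) :
    HasFDerivAt (fun x => ∫ y, F y • k (x - y, 0)) (∫ y, F y • dk k (x - y, 0)) x := by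
  refine hasFDerivAt_of_tendstoUniformlyOn (l := atTop) (s := ball 0 (‖x‖+1)) isOpen_ball
    (hdk.unif hm hF (‖x‖+1)) (f := fun n x => ∫ y, F y • k (x - y, een n)) ?_ ?_ (by simp)
    (g' := fun x => ∫ y, F y • dk k (x - y, 0))
  · intro n z _
    have := conv_hasFDerivAt (hk.contDiff (een_pos n)) hF z
    simpa only [dk_eq hk.1 (een_pos n)] using this
  · intro z hz
    exact (hk.unif hm hF (‖x‖+1)).tendsto_at hz

/-- Homogeneous kernels. -/
def Homk (a : ℕ) (k : Euc m × ℝ → E) : Prop :=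
  ContDiffOn ℝ (⊤ : ℕ∞) k {0}ᶜ ∧ ∀ t : ℝ, 0 < t → ∀ p : Euc m × ℝ, p ≠ 0 → k (t • p) = (t^a)⁻¹ • k p

theorem Homk.dom {a : ℕ} {k : Euc m × ℝ → E} (hm : 1 ≤ m) (ha : a ≤ 2*m-1) (hk : Homk a k) : Dom k := by
  refine ⟨hk.1, ?_⟩
  obtain ⟨C, hC⟩ := (isCompact_sphere (0 : Euc m × ℝ) 1).exists_bound_of_continuousOn
    (hk.1.continuousOn.mono (by
      intro p hp h
      rw [mem_singleton_iff] at h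
      simp [h] at hp))
  refine ⟨fun x => |C| * (‖x‖^a)⁻¹, (npow_locInt hm ha).smul |C|, ?_⟩
  intro ε hε x hx
  have hx0 : 0 < ‖x‖ := norm_pos_iff.2 hx
  have hpx : ‖x‖ ≤ ‖((x, ε) : Euc m × ℝ)‖ := norm_fst_le ((x, ε) : Euc m × ℝ)
  set p : Euc m × ℝ := (x, ε) with hp
  have hp0 : 0 < ‖p‖ := hx0.trans_le hpx
  have h1 := hk.2 ‖p‖ hp0 (‖p‖⁻¹ • p) (by
    rw [← norm_pos_iff, norm_smul, norm_inv, norm_norm, inv_mul_cancel₀ hp0.ne']; exact one_pos)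
  rw [smul_smul, mul_inv_cancel₀ hp0.ne', one_smul] at h1
  rw [h1, norm_smul, norm_inv, norm_pow, norm_norm, mul_comm]
  have h2 := hC (‖p‖⁻¹ • p) (by
    rw [mem_sphere_zero_iff_norm, norm_smul, norm_inv, norm_norm, inv_mul_cancel₀ hp0.ne'])
  refine mul_le_mul (h2.trans (le_abs_self C)) ?_ (by positivity) (abs_nonneg _)
  gcongr

theorem dk_homk {a : ℕ} {k : Euc m × ℝ → E} (hk : ContDiffOn ℝ (⊤ : ℕ∞) k {0}ᶜ) (c : ℝ → E)
    (h : ∀ t : ℝ, 0 < t → ∀ p : Euc m × ℝ, p ≠ 0 → k (t • p) = (t^a)⁻¹ • k p + c t) :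
    Homk (a+1) (dk k) := by
  refine ⟨dk_contDiffOn hk, ?_⟩
  intro t ht p hp
  have hd : DifferentiableAt ℝ k p :=
    (hk.contDiffAt (isOpen_compl_singleton.mem_nhds hp)).differentiableAt (by norm_num)
  have h1 : (fun q => k (t • q)) =ᶠ[𝓝 p] fun q => (t^a)⁻¹ • k q + c t := by
    filter_upwards [isOpen_compl_singleton.mem_nhds hp] with q hq
    exact h t ht q hq
  have h2 := h1.fderiv_eq (𝕜 := ℝ)
  rw [fderiv_comp_smul, fderiv_add_const, fderiv_fun_const_smul hd] at h2
  have h3 : fderiv ℝ k (t • p) = (t^(a+1))⁻¹ • fderiv ℝ k p := by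
    rw [pow_succ', mul_inv, ← smul_smul, ← h2, smul_smul, inv_mul_cancel₀ ht.ne', one_smul]
  simp only [dk, h3, ContinuousLinearMap.smul_comp]

end

theorem homk_contDiff {m : ℕ} (hm : 1 ≤ m) {F : Euc m → ℝ} {B R0 : ℝ} (hF : BddSupp F B R0) (N : ℕ) :
    ∀ (a : ℕ) (E : Type) [NormedAddCommGroup E] [NormedSpace ℝ E] (k : Euc m × ℝ → E),
      Homk a k → a + N ≤ 2*m-1 → ContDiff ℝ N (fun x => ∫ y, F y • k (x - y, 0)) := by
  induction N with
  | zero =>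
    intro a E _ _ k hk ha
    rw [Nat.cast_zero, contDiff_zero]
    exact (hk.dom hm (by omega)).continuous hm hF
  | succ N ih =>
    intro a E _ _ k hk ha
    have hdk : Homk (a+1) (dk k) := dk_homk hk.1 (fun _ => 0) (fun t ht p hp => by
      rw [add_zero]; exact hk.2 t ht p hp)
    push_cast
    rw [contDiff_succ_iff_hasFDerivAt]
    refine ⟨fun x => ∫ y, F y • dk k (x - y, 0), ih (a+1) _ _ hdk (by omega), fun x => ?_⟩
    exact (hk.dom hm (by omega)).hasFDerivAt hm (hdk.dom hm (by omega)) hF x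

/-- Regularized logarithm as a function of both variables. -/
def logk {m : ℕ} (p : Euc m × ℝ) : ℝ := Real.log (‖p.1‖^2 + p.2^2) / 2

theorem logk_arg_pos {m : ℕ} {p : Euc m × ℝ} (hp : p ≠ 0) : 0 < ‖p.1‖^2 + p.2^2 := by
  by_contra h
  push Not at h
  apply hp
  have h1 : ‖p.1‖^2 = 0 := by nlinarith [sq_nonneg ‖p.1‖, sq_nonneg p.2]
  have h2 : p.2^2 = 0 := by nlinarith [sq_nonneg ‖p.1‖, sq_nonneg p.2]
  ext1
  · exact norm_eq_zero.1 (pow_eq_zero_iff two_ne_zero |>.1 h1)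
  · exact pow_eq_zero_iff two_ne_zero |>.1 h2

theorem logk_zero {m : ℕ} (x : Euc m) : logk (x, 0) = Real.log ‖x‖ := by
  simp [logk, Real.log_pow]

theorem logk_contDiffOn {m : ℕ} : ContDiffOn ℝ (⊤ : ℕ∞) (logk (m := m)) {0}ᶜ := by
  have h1 : ContDiff ℝ (⊤ : ℕ∞) (fun p : Euc m × ℝ => ‖p.1‖^2 + p.2^2) :=
    ((contDiff_norm_sq ℝ).comp contDiff_fst).add (contDiff_snd.pow 2)
  exact (h1.contDiffOn.log fun p hp => (logk_arg_pos hp).ne').div_const 2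

theorem logk_dom {m : ℕ} (hm : 1 ≤ m) : Dom (logk (m := m)) := by
  refine ⟨logk_contDiffOn, fun x => 1 * ‖Real.log ‖x‖‖ + ‖x‖^2/2, ?_, ?_⟩
  · have h0 : LocallyIntegrable (fun x : Euc m => ‖Real.log ‖x‖‖) :=
      (log_locInt hm).mono (continuous_norm.measurable.comp
        (Real.measurable_log.comp measurable_norm)).aestronglyMeasurable
        (Eventually.of_forall fun x => by simp)
    exact (h0.smul (1:ℝ)).add
      (by fun_prop : Continuous (fun x : Euc m => ‖x‖^2/2)).locallyIntegrable
  · intro ε hε x hx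
    have hx' : 0 < ‖x‖ := norm_pos_iff.2 hx
    have h1 := Real.log_le_sub_one_of_pos (by positivity : 0 < ‖x‖^2 + ε^2)
    have h2 : ε^2 ≤ 1 := by nlinarith [hε.1, hε.2]
    have h3 : Real.log (‖x‖^2) ≤ Real.log (‖x‖^2 + ε^2) :=
        Real.log_le_log (by positivity) (by nlinarith)
    rw [Real.log_pow] at h3
    push_cast at h3
    simp only [logk]
    rw [Real.norm_eq_abs, Real.norm_eq_abs, abs_le]
    have h4 := neg_abs_le (Real.log ‖x‖)
    have h5 := abs_nonneg (Real.log ‖x‖)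
    constructor
    · nlinarith [sq_nonneg ‖x‖]
    · nlinarith

theorem pot_contDiff {m : ℕ} (hm : 1 ≤ m) {F : Euc m → ℝ} {B R0 : ℝ} (hF : BddSupp F B R0) :
    ContDiff ℝ (2*m-1 : ℕ) (fun x => ∫ y, F y * Real.log ‖x - y‖) := by
  have hdk : Homk 1 (dk (logk (m := m))) := dk_homk (a := 0) logk_contDiffOn (fun t => Real.log t) (by
    intro t ht p hp
    have h1 := logk_arg_pos hp
    simp only [logk, Prod.smul_fst, Prod.smul_snd, norm_smul, smul_eq_mul, pow_zero, inv_one, one_mul]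
    rw [Real.norm_eq_abs, abs_of_pos ht, mul_pow, mul_pow, ← mul_add, Real.log_mul (by positivity) h1.ne',
      Real.log_pow]
    push_cast; ring)
  have h2 : 2*m-1 = (2*m-2) + 1 := by omega
  have h3 : (fun x => ∫ y, F y * Real.log ‖x - y‖) = fun x => ∫ y, F y • logk (x - y, 0) := by
    simp only [logk_zero, smul_eq_mul]
  rw [h2, h3]
  push_cast
  rw [contDiff_succ_iff_hasFDerivAt]
  refine ⟨fun x => ∫ y, F y • dk logk (x - y, 0), homk_contDiff hm hF (2*m-2) 1 _ _ hdk (by omega), fun x => ?_⟩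
  exact (logk_dom hm).hasFDerivAt hm (hdk.dom hm (by omega)) hF x


/-! ### Part 7: potentials solve the equation; fixed point -/

theorem log_locInt_n {m : ℕ} (hm : 1 ≤ m) : LocallyIntegrable (fun x : Euc m => |Real.log ‖x‖|) :=
  (log_locInt hm).mono (continuous_abs.measurable.comp
    (Real.measurable_log.comp measurable_norm)).aestronglyMeasurable
    (Eventually.of_forall fun x => by simp)

theorem BddSupp.integrable {m : ℕ} {F : Euc m → ℝ} {B R0 : ℝ} (hF : BddSupp F B R0) : Integrable F := by
  have h : IntegrableOn F (ball 0 R0) := by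
    refine Measure.integrableOn_of_bounded (M := B) measure_ball_lt_top.ne
      hF.1.aestronglyMeasurable ?_
    exact Eventually.of_forall fun y => hF.2.1 y
  refine (integrableOn_iff_integrable_of_support_subset ?_).1 h
  intro y hy
  by_contra h2
  exact hy (hF.2.2 y h2)

theorem pot_weak {m : ℕ} (hm : 1 ≤ m) {c : ℝ} (hfund : ∀ ψ : Euc m → ℝ, IsTestOn univ ψ → ∀ z : Euc m,
    ∫ x, Real.log ‖x - z‖ * negLapPow m ψ x = c * ψ z) {F : Euc m → ℝ} {B R0 : ℝ} (hF : BddSupp F B R0)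
    {ψ : Euc m → ℝ} (hψ : IsTestOn univ ψ) :
    ∫ x, (∫ y, F y * Real.log ‖x - y‖) * negLapPow m ψ x = c * ∫ y, F y * ψ y := by
  have hL := negLapPow_test m hψ
  set L := negLapPow m ψ with hLdef
  obtain ⟨M, hM⟩ := hL.2.1.exists_bound_of_continuous hL.1.continuous
  obtain ⟨R1, hR1⟩ := hL.2.1.isCompact.isBounded.subset_ball (0 : Euc m)
  have hR : Integrable ((ball (0 : Euc m) (R0 + R1)).indicator fun z => Real.log ‖z‖) :=
    (integrable_indicator_iff measurableSet_ball).2 (locInt_ball (log_locInt hm) _)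
  have h1 := hF.integrable.convolution_integrand (ContinuousLinearMap.mul ℝ ℝ) hR
  have h2 : Integrable (fun p : Euc m × Euc m => L p.1 * (F p.2 *
      ((ball (0 : Euc m) (R0 + R1)).indicator (fun z => Real.log ‖z‖) (p.1 - p.2))))
      (volume.prod volume) := by
    refine Integrable.bdd_mul (c := M) h1 ?_ ?_
    · exact (hL.1.continuous.comp continuous_fst).aestronglyMeasurable
    · exact Eventually.of_forall fun p => hM _
  have h3 : (fun p : Euc m × Euc m => L p.1 * (F p.2 *
      ((ball (0 : Euc m) (R0 + R1)).indicator (fun z => Real.log ‖z‖) (p.1 - p.2))))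
      = fun p : Euc m × Euc m => F p.2 * Real.log ‖p.1 - p.2‖ * L p.1 := by
    funext p
    by_cases hp : p.2 ∈ ball (0 : Euc m) R0
    · by_cases hp1 : p.1 ∈ tsupport L
      · rw [indicator_of_mem]
        · ring
        have h5 := hR1 hp1
        rw [mem_ball_zero_iff] at *
        exact (norm_sub_le _ _).trans_lt (by linarith)
      · rw [image_eq_zero_of_notMem_tsupport hp1]; simp
    · rw [hF.2.2 _ hp]; simp
  rw [h3] at h2
  calc ∫ x, (∫ y, F y * Real.log ‖x - y‖) * L x = ∫ x, ∫ y, F y * Real.log ‖x - y‖ * L x := by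
        simp only [integral_mul_const]
    _ = ∫ y, ∫ x, F y * Real.log ‖x - y‖ * L x := integral_integral_swap h2
    _ = ∫ y, c * (F y * ψ y) := by
        refine integral_congr_ae (Eventually.of_forall fun y => ?_)
        simp only [mul_assoc]
        rw [integral_const_mul, hfund ψ hψ y]
        ring
    _ = _ := by rw [integral_const_mul]

/-- Clamp to `[-1,1]`. -/
def clamp (t : ℝ) : ℝ := max (-1) (min 1 t)

theorem clamp_cont : Continuous clamp := by unfold clamp; fun_prop

theorem clamp_le (t : ℝ) : clamp t ≤ 1 := max_le (by norm_num) (min_le_left _ _)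

theorem clamp_ge (t : ℝ) : -1 ≤ clamp t := le_max_left _ _

theorem clamp_eq {t : ℝ} (h : |t| ≤ 1) : clamp t = t := by
  rw [abs_le] at h
  unfold clamp
  rw [min_eq_right h.2, max_eq_right h.1]

theorem clamp_lip (s t : ℝ) : |clamp s - clamp t| ≤ |s - t| := by
  unfold clamp
  refine (abs_max_sub_max_le_max _ _ _ _).trans ?_
  rw [sub_self, abs_zero, max_eq_right (abs_nonneg _)]
  refine (abs_min_sub_min_le_max _ _ _ _).trans ?_
  rw [sub_self, abs_zero, max_eq_right (abs_nonneg _)]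

theorem exp_clamp_lip (a : ℝ) (ha : 0 ≤ a) (s t : ℝ) :
    |Real.exp (a * clamp s) - Real.exp (a * clamp t)| ≤ a * Real.exp a * |s - t| := by
  have key : ∀ x y : ℝ, x ≤ 1 → Real.exp (a * x) - Real.exp (a * y) ≤ a * Real.exp a * |x - y| := by
    intro x y hx
    have h1 := Real.add_one_le_exp (a * (y - x))
    have h2 : Real.exp (a * y) = Real.exp (a * x) * Real.exp (a * (y - x)) := by
      rw [← Real.exp_add]; congr 1; ring
    have h3 : Real.exp (a * x) ≤ Real.exp a := Real.exp_le_exp.2 (by nlinarith)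
    have h4 := Real.exp_pos (a * x)
    have h5 : Real.exp (a*x) - Real.exp (a*y) ≤ Real.exp (a*x) * (a * (x - y)) := by
      rw [h2]; nlinarith
    have h6 : a * (x - y) ≤ a * |x - y| := mul_le_mul_of_nonneg_left (le_abs_self _) ha
    have h7 : 0 ≤ a * |x - y| := by positivity
    calc _ ≤ Real.exp (a*x) * (a * (x - y)) := h5
      _ ≤ Real.exp (a*x) * (a * |x - y|) := by gcongr
      _ ≤ Real.exp a * (a * |x - y|) := by gcongr
      _ = _ := by ring
  have h1 := key (clamp s) (clamp t) (clamp_le s)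
  have h2 := key (clamp t) (clamp s) (clamp_le t)
  rw [abs_sub_comm (clamp t)] at h2
  have h3 : a * Real.exp a * |clamp s - clamp t| ≤ a * Real.exp a * |s - t| := by
    have := clamp_lip s t
    gcongr
  rw [abs_le]
  constructor <;> linarith

theorem fixpt {m : ℕ} (hm : 1 ≤ m) {G : Euc m → ℝ} {B R0 A a : ℝ} (ha : 1 ≤ a) (hG : BddSupp G B R0)
    (hA : ∀ x : Euc m, ‖x‖ ≤ R0 + 1 → ∫ y, |G y| * |Real.log ‖x - y‖| ≤ A)
    (hA2 : a * Real.exp a * A ≤ 1/2) :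
    ∃ F : Euc m → ℝ, BddSupp F (B * Real.exp a) R0 ∧
      (∀ x ∈ ball (0 : Euc m) R0, |∫ y, F y * Real.log ‖x - y‖| ≤ 1) ∧
      ∀ y, F y = G y * Real.exp (a * ∫ z, F z * Real.log ‖y - z‖) := by
  have ha0 : 0 ≤ a := by linarith
  have hB : 0 ≤ B := (abs_nonneg _).trans (hG.2.1 0)
  -- the nonlinear source
  have hN : ∀ v : Euc m → ℝ, Continuous v →
      BddSupp (fun y => G y * Real.exp (a * clamp (v y))) (B * Real.exp a) R0 := by
    intro v hv
    refine ⟨hG.1.mul (by have := clamp_cont; exact (by fun_prop : Continuous fun y => Real.exp (a * clamp (v y))).measurable), ?_, ?_⟩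
    · intro y
      rw [abs_mul, Real.abs_exp]
      refine mul_le_mul (hG.2.1 y) (Real.exp_le_exp.2 ?_) (Real.exp_pos _).le hB
      nlinarith [clamp_le (v y)]
    · intro y hy
      simp [hG.2.2 y hy]
  have hI : ∀ x : Euc m, Integrable (fun y => |G y| * |Real.log ‖x - y‖|) := by
    intro x
    have h1 := conv_int' (log_locInt hm) hG x
    refine h1.norm.congr (Eventually.of_forall fun y => ?_)
    simp [abs_mul]
  have hPc : ∀ v : Euc m → ℝ, Continuous v → Continuous
      (fun x => ∫ y, G y * Real.exp (a * clamp (v y)) * Real.log ‖x - y‖) := fun v hv =>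
    (pot_contDiff hm (hN v hv)).continuous
  have hPb : ∀ v : Euc m → ℝ, Continuous v → ∀ x : Euc m, ‖x‖ ≤ R0 + 1 →
      |∫ y, G y * Real.exp (a * clamp (v y)) * Real.log ‖x - y‖| ≤ 1/2 := by
    intro v hv x hx
    have h1 : |∫ y, G y * Real.exp (a * clamp (v y)) * Real.log ‖x - y‖|
        ≤ ∫ y, Real.exp a * (|G y| * |Real.log ‖x - y‖|) := by
      rw [← Real.norm_eq_abs]
      refine norm_integral_le_of_norm_le ((hI x).const_mul _) (Eventually.of_forall fun y => ?_)
      rw [Real.norm_eq_abs, abs_mul, abs_mul, Real.abs_exp]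
      have : Real.exp (a * clamp (v y)) ≤ Real.exp a := Real.exp_le_exp.2 (by nlinarith [clamp_le (v y)])
      have h3 : 0 ≤ |G y| * |Real.log ‖x - y‖| := by positivity
      nlinarith
    rw [integral_const_mul] at h1
    have h2 := hA x hx
    have h4 : 0 ≤ ∫ y, |G y| * |Real.log ‖x - y‖| := integral_nonneg fun y => by positivity
    have h5 := Real.exp_pos a
    have h6 : Real.exp a * (∫ y, |G y| * |Real.log ‖x - y‖|) ≤ Real.exp a * A := by gcongr
    have h7 : 0 ≤ Real.exp a * A := by
      have := h4.trans h2
      positivity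
    nlinarith
  have hPl : ∀ v w : Euc m → ℝ, Continuous v → Continuous w → ∀ d : ℝ, (∀ y, |v y - w y| ≤ d) →
      ∀ x : Euc m, ‖x‖ ≤ R0 + 1 →
      |(∫ y, G y * Real.exp (a * clamp (v y)) * Real.log ‖x - y‖) -
        (∫ y, G y * Real.exp (a * clamp (w y)) * Real.log ‖x - y‖)| ≤ 1/2 * d := by
    intro v w hv hw d hd x hx
    have hd0 : 0 ≤ d := (abs_nonneg _).trans (hd 0)
    have i1 := conv_int' (log_locInt hm) (hN v hv) x
    have i2 := conv_int' (log_locInt hm) (hN w hw) x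
    simp only [smul_eq_mul] at i1 i2
    rw [← integral_sub i1 i2]
    have h1 : |∫ y, (G y * Real.exp (a * clamp (v y)) * Real.log ‖x - y‖ - G y * Real.exp (a * clamp (w y)) * Real.log ‖x - y‖)|
        ≤ ∫ y, (a * Real.exp a * d) * (|G y| * |Real.log ‖x - y‖|) := by
      rw [← Real.norm_eq_abs]
      refine norm_integral_le_of_norm_le ((hI x).const_mul _) (Eventually.of_forall fun y => ?_)
      have e : G y * Real.exp (a * clamp (v y)) * Real.log ‖x - y‖ - G y * Real.exp (a * clamp (w y)) * Real.log ‖x - y‖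
        = (Real.exp (a * clamp (v y)) - Real.exp (a * clamp (w y))) * (G y * Real.log ‖x - y‖) := by ring
      rw [e, Real.norm_eq_abs, abs_mul, abs_mul (G y)]
      refine mul_le_mul_of_nonneg_right ?_ (by positivity)
      refine (exp_clamp_lip a ha0 _ _).trans ?_
      have := hd y
      gcongr
    rw [integral_const_mul] at h1
    have h2 := hA x hx
    have h8 : (a * Real.exp a * d) * (∫ y, |G y| * |Real.log ‖x - y‖|) ≤ (a * Real.exp a * d) * A := by
      gcongr
    calc _ ≤ _ := h1
      _ ≤ _ := h8
      _ = (a * Real.exp a * A) * d := by ring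
      _ ≤ 1/2 * d := by gcongr
  -- cutoff
  set χ : Euc m → ℝ := fun x => max 0 (min 1 (R0 + 1 - ‖x‖)) with hχ
  have hχc : Continuous χ := by rw [hχ]; fun_prop
  have hχ0 : ∀ x, 0 ≤ χ x := fun x => le_max_left _ _
  have hχ1 : ∀ x, χ x ≤ 1 := fun x => max_le zero_le_one (min_le_left _ _)
  have hχz : ∀ x, R0 + 1 < ‖x‖ → χ x = 0 := fun x hx =>
    max_eq_left ((min_le_right _ _).trans (by linarith))
  have hχo : ∀ x ∈ ball (0 : Euc m) R0, χ x = 1 := by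
    intro x hx
    rw [mem_ball_zero_iff] at hx
    simp only [hχ]
    rw [min_eq_left (by linarith), max_eq_right zero_le_one]
  have hTb : ∀ v : Euc m → ℝ, Continuous v → ∀ x,
      ‖χ x * ∫ y, G y * Real.exp (a * clamp (v y)) * Real.log ‖x - y‖‖ ≤ 1/2 := by
    intro v hv x
    rcases le_or_gt ‖x‖ (R0 + 1) with h | h
    · rw [norm_mul, Real.norm_of_nonneg (hχ0 x), Real.norm_eq_abs]
      have h1 := hPb v hv x h
      have h2 := abs_nonneg (∫ y, G y * Real.exp (a * clamp (v y)) * Real.log ‖x - y‖)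
      nlinarith [hχ0 x, hχ1 x]
    · rw [hχz x h]; norm_num
  let T : BoundedContinuousFunction (Euc m) ℝ → BoundedContinuousFunction (Euc m) ℝ := fun v =>
    BoundedContinuousFunction.ofNormedAddCommGroup
      (fun x => χ x * ∫ y, G y * Real.exp (a * clamp (v y)) * Real.log ‖x - y‖)
      (hχc.mul (hPc v v.continuous)) (1/2) (hTb v v.continuous)
  have hT : ContractingWith (1/2 : NNReal) T := by
    refine ⟨by rw [← NNReal.coe_lt_coe]; norm_num, LipschitzWith.of_dist_le_mul fun v w => ?_⟩
    have hd : 0 ≤ dist v w := dist_nonneg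
    rw [BoundedContinuousFunction.dist_le (by positivity)]
    intro x
    show dist (χ x * _) (χ x * _) ≤ _
    rw [Real.dist_eq, ← mul_sub, abs_mul, abs_of_nonneg (hχ0 x)]
    push_cast
    rcases le_or_gt ‖x‖ (R0 + 1) with h | h
    · have h1 := hPl v w v.continuous w.continuous (dist v w)
        (fun y => by rw [← Real.dist_eq]; exact BoundedContinuousFunction.dist_coe_le_dist y) x h
      calc _ ≤ 1 * _ := mul_le_mul_of_nonneg_right (hχ1 x) (abs_nonneg _)
        _ ≤ _ := by rw [one_mul]; exact h1
    · rw [hχz x h, zero_mul]; positivity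
  obtain ⟨v, hv⟩ : ∃ v, T v = v := ⟨_, hT.fixedPoint_isFixedPt⟩
  have hv' : ∀ x, χ x * (∫ y, G y * Real.exp (a * clamp (v y)) * Real.log ‖x - y‖) = v x := fun x =>
    congrArg (fun f : BoundedContinuousFunction (Euc m) ℝ => f x) hv
  have hvb : ∀ x ∈ ball (0 : Euc m) R0,
      (∫ y, G y * Real.exp (a * clamp (v y)) * Real.log ‖x - y‖) = v x := by
    intro x hx
    have := hv' x
    rwa [hχo x hx, one_mul] at this
  have hv1 : ∀ x, |v x| ≤ 1 := by
    intro x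
    have := hTb v v.continuous x
    rw [hv' x, Real.norm_eq_abs] at this
    linarith
  refine ⟨fun y => G y * Real.exp (a * clamp (v y)), hN v v.continuous, ?_, ?_⟩
  · intro x hx
    rw [hvb x hx]; exact hv1 x
  · intro y
    by_cases hy : y ∈ ball (0 : Euc m) R0
    · simp only [hvb y hy, clamp_eq (hv1 y)]
    · simp only [hG.2.2 y hy, zero_mul]


/-! ### Part 8: assembly -/

theorem logsq_locInt {m : ℕ} (hm : 1 ≤ m) : LocallyIntegrable (fun x : Euc m => (Real.log ‖x‖)^2) := by
  have h1 : LocallyIntegrable (fun x : Euc m => (8:ℝ) • (‖x‖ + (‖x‖^1)⁻¹)) :=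
    ((continuous_norm.locallyIntegrable).add (npow_locInt hm (by omega))).smul (8:ℝ)
  refine h1.mono ((Real.measurable_log.comp measurable_norm).pow_const 2).aestronglyMeasurable ?_
  refine Eventually.of_forall fun x => ?_
  rw [Real.norm_of_nonneg (sq_nonneg _), Real.norm_of_nonneg (by positivity), pow_one, smul_eq_mul]
  set t := ‖x‖ with ht
  have ht0 : 0 ≤ t := norm_nonneg x
  rcases ht0.eq_or_lt with h | h
  · simp [← h]
  have hs : 0 < √t := Real.sqrt_pos.2 h
  have h2 := abs_log_le hs.le
  have h3 : Real.log t = 2 * Real.log √t := by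
    rw [Real.log_sqrt ht0]; ring
  rw [h3, mul_pow, ← sq_abs (Real.log √t)]
  have h4 : (√t)^2 = t := Real.sq_sqrt ht0
  have h5 : |Real.log √t|^2 ≤ (√t + (√t)⁻¹)^2 := by gcongr
  have h6 : (√t + (√t)⁻¹)^2 ≤ 2 * (t + t⁻¹) := by
    have : t⁻¹ = ((√t)⁻¹)^2 := by rw [inv_pow, h4]
    rw [this]
    nlinarith [sq_nonneg (√t - (√t)⁻¹)]
  linarith

theorem young_log {m : ℕ} (hm : 1 ≤ m) (R0 : ℝ) : ∃ D : ℝ, 0 ≤ D ∧ ∀ E : Euc m → ℝ, BddSupp E 1 R0 →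
    (∀ y, 0 ≤ E y) → ∀ t : ℝ, 0 < t → (∫ y, E y) ≤ t^2 → ∀ x : Euc m, ‖x‖ ≤ R0 + 1 →
    ∫ y, E y * |Real.log ‖x - y‖| ≤ (1 + D) * t := by
  set χ : Euc m → ℝ := (ball (0 : Euc m) R0).indicator fun _ => 1 with hχ
  have hχB : BddSupp χ 1 R0 := by
    refine ⟨measurable_const.indicator measurableSet_ball, fun y => ?_, fun y hy => indicator_of_notMem hy _⟩
    by_cases hy : y ∈ ball (0 : Euc m) R0
    · simp [hχ, indicator_of_mem hy]
    · simp [hχ, indicator_of_notMem hy]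
  refine ⟨1 * ∫ z in ball (0 : Euc m) (R0 + 1 + R0), ‖(Real.log ‖z‖)^2‖,
    by rw [one_mul]; exact integral_nonneg fun z => norm_nonneg _, ?_⟩
  intro E hE hE0 t ht hEt x hx
  have hb := conv_bound (logsq_locInt hm) hχB hx
  have hi := conv_int' (logsq_locInt hm) hχB x
  set D := 1 * ∫ z in ball (0 : Euc m) (R0 + 1 + R0), ‖(Real.log ‖z‖)^2‖
  have hi2 : Integrable (fun y => E y * |Real.log ‖x - y‖|) := conv_int' (log_locInt_n hm) hE x
  have h1 : ∫ y, E y * |Real.log ‖x - y‖| ≤ ∫ y, (t⁻¹ * E y + t * (χ y • (Real.log ‖x - y‖)^2)) := by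
    refine integral_mono hi2 ((hE.integrable.const_mul _).add (hi.const_mul _)) fun y => ?_
    simp only [smul_eq_mul]
    by_cases hy : y ∈ ball (0 : Euc m) R0
    · have e1 : χ y = 1 := indicator_of_mem hy _
      rw [e1, one_mul, ← sq_abs (Real.log _)]
      have h2 : E y ≤ 1 := (le_abs_self _).trans (hE.2.1 y)
      have h3 := hE0 y
      set l := |Real.log ‖x - y‖|
      have h5 : E y * l ≤ t⁻¹ * (E y)^2 + t * l^2 := by
        have h6 : t⁻¹ * (E y)^2 + t * l^2 - E y * l = t⁻¹ * ((E y - t*l)^2 + E y * (t * l)) := by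
          field_simp; ring
        have : 0 ≤ t⁻¹ * ((E y - t*l)^2 + E y * (t * l)) := by positivity
        linarith
      have h6 : t⁻¹ * (E y)^2 ≤ t⁻¹ * E y := by
        have := inv_pos.2 ht
        gcongr
        nlinarith
      linarith
    · rw [hE.2.2 y hy]
      have e1 : χ y = 0 := indicator_of_notMem hy _
      rw [e1]; simp
  rw [integral_add (hE.integrable.const_mul _) (hi.const_mul _), integral_const_mul, integral_const_mul] at h1
  have h2 : t⁻¹ * (∫ y, E y) ≤ t := by
    calc t⁻¹ * (∫ y, E y) ≤ t⁻¹ * t^2 := by have := inv_pos.2 ht; gcongr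
      _ = t := by field_simp
  have h3 : t * (∫ y, χ y • (Real.log ‖x - y‖)^2) ≤ t * D := by
    gcongr
    exact (le_abs_self _).trans hb
  linarith

theorem solve_one {m : ℕ} (hm : 1 ≤ m) {c : ℝ} (hc : c ≠ 0)
    (hfund : ∀ ψ : Euc m → ℝ, IsTestOn univ ψ → ∀ z : Euc m,
      ∫ x, Real.log ‖x - z‖ * negLapPow m ψ x = c * ψ z)
    {Ω : Set (Euc m)} (hΩ : IsOpen Ω) {R0 : ℝ} (hR : Ω ⊆ ball 0 R0)
    {φ : Euc m → ℝ} (hφm : Measurable φ) (hφ : ContDiffOn ℝ (⊤ : ℕ∞) φ Ω)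
    (hφh : ∀ x ∈ Ω, lap φ x = 0) (hφ0 : ∀ x ∈ Ω, φ x ≤ 0)
    {V : Euc m → ℝ} (hV : Measurable V) {C : ℝ} (hVC : ∀ x ∈ Ω, |V x| ≤ C) (hC : 0 ≤ C)
    {s κ q : ℝ} (hs : 0 < s) (hκ : 0 ≤ κ)
    (hq : ∀ x : Euc m, ‖x‖ ≤ R0 + 1 →
      ∫ y, Ω.indicator (fun y => Real.exp ((2*m : ℝ) * (κ * φ y))) y * |Real.log ‖x - y‖| ≤ q)
    (hsm : (2*m : ℝ) * Real.exp (2*m) * ((|c⁻¹| * C * s) * q) ≤ 1/2) :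
    ∃ w : Euc m → ℝ, ContDiff ℝ (2*m-1 : ℕ) w ∧ (∀ x ∈ ball (0 : Euc m) R0, |w x| ≤ 1) ∧
      SolvesQ Ω V (fun x => κ * φ x + Real.log s / (2*m) + w x) := by
  have hm1 : (1:ℝ) ≤ m := by exact_mod_cast hm
  set E : Euc m → ℝ := Ω.indicator (fun y => Real.exp ((2*m : ℝ) * (κ * φ y))) with hE
  have hEm : Measurable E := (by fun_prop : Measurable fun y => Real.exp ((2*m : ℝ) * (κ * φ y))).indicator hΩ.measurableSet
  have hE0 : ∀ y, 0 ≤ E y := fun y => indicator_nonneg (fun _ _ => (Real.exp_pos _).le) y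
  have hE1 : ∀ y, E y ≤ 1 := by
    intro y
    by_cases hy : y ∈ Ω
    · rw [hE, indicator_of_mem hy, Real.exp_le_one_iff]
      have : κ * φ y ≤ 0 := mul_nonpos_of_nonneg_of_nonpos hκ (hφ0 y hy)
      nlinarith
    · rw [hE, indicator_of_notMem hy]; exact zero_le_one
  have hEo : ∀ y, y ∉ Ω → E y = 0 := fun y hy => indicator_of_notMem hy _
  have hVE : ∀ y, |V y| * E y ≤ C * E y := by
    intro y
    by_cases hy : y ∈ Ω
    · exact mul_le_mul_of_nonneg_right (hVC y hy) (hE0 y)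
    · rw [hEo y hy]; simp
  set G : Euc m → ℝ := fun y => c⁻¹ * s * (V y * E y) with hG
  have hGabs : ∀ y, |G y| ≤ (|c⁻¹| * C * s) * E y := by
    intro y
    rw [hG]
    simp only
    rw [abs_mul, abs_mul, abs_of_pos hs, abs_mul, abs_of_nonneg (hE0 y)]
    have : |c⁻¹| * s * (|V y| * E y) ≤ |c⁻¹| * s * (C * E y) := by
      have := hVE y
      gcongr
    linarith
  have hK : 0 ≤ |c⁻¹| * C * s := by positivity
  have hGB : BddSupp G (|c⁻¹| * C * s) R0 := by
    refine ⟨measurable_const.mul (hV.mul hEm), fun y => ?_, fun y hy => ?_⟩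
    · exact (hGabs y).trans (mul_le_of_le_one_right hK (hE1 y))
    · simp only [hG]; rw [hEo y (fun h => hy (hR h))]; simp
  have hEB : BddSupp E 1 R0 := by
    refine ⟨hEm, fun y => ?_, fun y hy => hEo y (fun h => hy (hR h))⟩
    rw [abs_of_nonneg (hE0 y)]; exact hE1 y
  have hA : ∀ x : Euc m, ‖x‖ ≤ R0 + 1 → ∫ y, |G y| * |Real.log ‖x - y‖| ≤ (|c⁻¹| * C * s) * q := by
    intro x hx
    have hi2 : Integrable (fun y => E y * |Real.log ‖x - y‖|) := conv_int' (log_locInt_n hm) hEB x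
    calc ∫ y, |G y| * |Real.log ‖x - y‖| ≤ ∫ y, (|c⁻¹| * C * s) * (E y * |Real.log ‖x - y‖|) := by
          refine integral_mono_of_nonneg (Eventually.of_forall fun y => by positivity)
            (hi2.const_mul _) (Eventually.of_forall fun y => ?_)
          simp only
          rw [← mul_assoc]
          exact mul_le_mul_of_nonneg_right (hGabs y) (abs_nonneg _)
      _ = (|c⁻¹| * C * s) * ∫ y, E y * |Real.log ‖x - y‖| := integral_const_mul _ _
      _ ≤ _ := by have := hq x hx; gcongr
  obtain ⟨F, hF, hF1, hFG⟩ := fixpt hm (a := 2*m) (by linarith) hGB hA hsm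
  set w : Euc m → ℝ := fun x => ∫ y, F y * Real.log ‖x - y‖ with hw
  have hwc : ContDiff ℝ (2*m-1 : ℕ) w := pot_contDiff hm hF
  refine ⟨w, hwc, hF1, ?_⟩
  intro ψ hψ
  have hψu : IsTestOn univ ψ := ⟨hψ.1, hψ.2.1, subset_univ _⟩
  have hL := negLapPow_test m hψ
  have hLo : ∀ x, x ∉ Ω → negLapPow m ψ x = 0 := fun x hx =>
    image_eq_zero_of_notMem_tsupport fun h => hx (hL.2.2 h)
  have hψo : ∀ x, x ∉ Ω → ψ x = 0 := fun x hx =>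
    image_eq_zero_of_notMem_tsupport fun h => hx (hψ.2.2 h)
  rw [setIntegral_eq_integral_of_forall_compl_eq_zero (fun x hx => by rw [hLo x hx, mul_zero]),
    setIntegral_eq_integral_of_forall_compl_eq_zero (fun x hx => by rw [hψo x hx, mul_zero])]
  -- smooth part
  have hg : ContDiffOn ℝ (⊤ : ℕ∞) (fun x => κ * φ x + Real.log s / (2*m)) Ω :=
    (contDiffOn_const.mul hφ).add contDiffOn_const
  have hgz : ∫ x, (κ * φ x + Real.log s / (2*m)) * negLapPow m ψ x = 0 := by
    have i1 := mul_test_integrable hΩ hφ.continuousOn hL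
    have i2 := mul_test_integrable hΩ (f := fun _ => (1:ℝ)) continuousOn_const hL
    have z1 : ∫ x, φ x * negLapPow m ψ x = 0 := by
      rw [ibp_pow m hΩ hφ hψ]
      rw [integral_eq_zero_of_ae]
      refine Eventually.of_forall fun x => ?_
      by_cases hx : x ∈ Ω
      · simp [negLapPow_zero_of_harmonic hΩ hφh m hm x hx]
      · simp [hψo x hx]
    have z2 : ∫ x, (1:ℝ) * negLapPow m ψ x = 0 := by
      rw [ibp_pow m hΩ (f := fun _ => (1:ℝ)) contDiffOn_const hψ]
      rw [integral_eq_zero_of_ae]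
      refine Eventually.of_forall fun x => ?_
      have h0 : ∀ x ∈ (univ : Set (Euc m)), lap (fun _ : Euc m => (1:ℝ)) x = 0 := by
        intro x _; simp [lap]
      simp [negLapPow_zero_of_harmonic isOpen_univ h0 m hm x (mem_univ x)]
    have e : (fun x => (κ * φ x + Real.log s / (2*m)) * negLapPow m ψ x)
      = fun x => κ * (φ x * negLapPow m ψ x) + Real.log s / (2*m) * (1 * negLapPow m ψ x) := by
      funext x; ring
    rw [e, integral_add (i1.const_mul _) (i2.const_mul _), integral_const_mul, integral_const_mul, z1, z2]
    simp
  have hpot := pot_weak hm hfund hF hψu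
  have i3 := mul_test_integrable hΩ hg.continuousOn hL
  have i4 := mul_test_integrable hΩ hwc.continuous.continuousOn hL
  have e : (fun x => (κ * φ x + Real.log s / (2*m) + w x) * negLapPow m ψ x)
      = fun x => (κ * φ x + Real.log s / (2*m)) * negLapPow m ψ x + w x * negLapPow m ψ x := by
    funext x; ring
  rw [e, integral_add i3 i4, hgz, zero_add]
  refine hpot.trans ?_
  rw [← integral_const_mul]
  refine integral_congr_ae (Eventually.of_forall fun x => ?_)
  simp only
  by_cases hx : x ∈ Ω
  · rw [hFG x]
    have h1 : E x = Real.exp ((2*m : ℝ) * (κ * φ x)) := indicator_of_mem hx _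
    have h2 : Real.exp ((2*m : ℝ) * (κ * φ x + Real.log s / (2*m) + w x))
        = Real.exp ((2*m : ℝ) * (κ * φ x)) * s * Real.exp ((2*m : ℝ) * w x) := by
      have e3 : (2*m : ℝ) * (κ * φ x + Real.log s / (2*m) + w x)
        = (2*m : ℝ) * (κ * φ x) + Real.log s + (2*m : ℝ) * w x := by
        field_simp
      rw [e3, Real.exp_add, Real.exp_add, Real.exp_log hs]
    rw [h2]
    simp only [hG, h1, hw]
    field_simp
  · rw [hψo x hx]; simp


theorem statement2 (m : ℕ) (hm : 1 ≤ m) (Ω : Set (Euc m)) (hΩ : SmoothBoundedDomain Ω)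
    (Γ : Set (Euc m)) (hΓsub : Γ ⊆ frontier Ω) (hΓcl : IsClosed Γ) (hΓne : Γ ≠ frontier Ω)
    (V : ℕ → Euc m → ℝ) (hVmeas : ∀ k, Measurable (V k))
    (hVbd : ∃ C : ℝ, ∀ k, ∀ x ∈ Ω, |V k x| ≤ C) :
    ∃ φ : Euc m → ℝ, memK Ω φ ∧ (∀ x ∈ Ω, φ x < 0) ∧ SphiStar Ω φ = Γ ∧
      ∃ u : ℕ → Euc m → ℝ,
        (∀ k, ContDiffOn ℝ (2*m - 1 : ℕ) (u k) Ω) ∧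
        (∀ k, ContinuousOn (u k) (Ω ∪ Γ)) ∧
        (∀ k, SolvesQ Ω (V k) (u k)) ∧
        (∀ k, IntegrableOn (fun x => Real.exp ((2*m : ℝ) * u k x)) Ω) ∧
        Tendsto (fun k => ∫ x in Ω, Real.exp ((2*m : ℝ) * u k x)) atTop (𝓝 0) ∧
        LocUnifBot u Ω ∧
        LocUnifTop u Γ := by
  obtain ⟨φ, hφ, hφh, hφneg, hφΓ, hφnΓ, hφout⟩ := exists_phi hm hΩ hΓsub hΓcl hΓne
  obtain ⟨hΩo, hΩc, hΩb, -⟩ := hΩ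
  obtain ⟨x0, hx0⟩ := hΩc.nonempty
  have hm1 : (1:ℝ) ≤ m := by exact_mod_cast hm
  have hdisj : ∀ x ∈ frontier Ω, x ∉ Ω := fun x hx h => by
    have := hx.2
    rw [hΩo.interior_eq] at this
    exact this h
  refine ⟨φ, ⟨hφ, fun x hx => (hφneg x hx).le, ⟨x0, hx0, (hφneg x0 hx0).ne⟩,
    negLapPow_zero_of_harmonic hΩo hφh m hm⟩, hφneg, ?_, ?_⟩
  · ext x
    constructor
    · rintro (⟨h1, h2⟩ | ⟨h1, h2⟩)
      · exact absurd h2 (hφneg x h1).ne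
      · by_contra h3
        exact hφnΓ x h1 h3 h2
    · intro hx
      exact Or.inr ⟨hΓsub hx, hφΓ x hx⟩
  obtain ⟨C0, hC0⟩ := hVbd
  have hC : 0 ≤ C0 := (abs_nonneg _).trans (hC0 0 x0 hx0)
  obtain ⟨R0, hR0⟩ := hΩb.closure.subset_ball (0 : Euc m)
  have hRΩ : Ω ⊆ ball 0 R0 := subset_closure.trans hR0
  obtain ⟨c, hc, hfund⟩ := fund hm
  obtain ⟨D, hD, hyoung⟩ := young_log hm R0
  have hφm : Measurable φ := by
    have h1 : φ = Ω.indicator φ := by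
      funext x
      by_cases hx : x ∈ Ω
      · rw [indicator_of_mem hx]
      · rw [indicator_of_notMem hx, hφout x hx]
    rw [h1]
    classical
    rw [← piecewise_eq_indicator]
    exact hφ.continuousOn.measurable_piecewise continuousOn_const hΩo.measurableSet
  have hfin : volume Ω ≠ ⊤ := hΩb.measure_lt_top.ne
  -- weights
  set E : ℕ → Euc m → ℝ := fun k => Ω.indicator (fun y => Real.exp ((2*m : ℝ) * (k * φ y))) with hE
  have hEm : ∀ k, Measurable (E k) := fun k =>
    (by fun_prop : Measurable fun y => Real.exp ((2*m : ℝ) * (k * φ y))).indicator hΩo.measurableSet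
  have hE0 : ∀ k y, 0 ≤ E k y := fun k y => indicator_nonneg (fun _ _ => (Real.exp_pos _).le) y
  have hexp1 : ∀ k : ℕ, ∀ y ∈ Ω, Real.exp ((2*m : ℝ) * (k * φ y)) ≤ 1 := by
    intro k y hy
    rw [Real.exp_le_one_iff]
    have : (k:ℝ) * φ y ≤ 0 := mul_nonpos_of_nonneg_of_nonpos (Nat.cast_nonneg k) (hφneg y hy).le
    nlinarith
  have hE1 : ∀ k y, E k y ≤ 1 := by
    intro k y
    by_cases hy : y ∈ Ω
    · simp only [hE]
      rw [indicator_of_mem hy]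
      exact hexp1 k y hy
    · simp only [hE]
      rw [indicator_of_notMem hy]; exact zero_le_one
  have hEB : ∀ k, BddSupp (E k) 1 R0 := by
    intro k
    refine ⟨hEm k, fun y => ?_, fun y hy => indicator_of_notMem (fun h => hy (hRΩ h)) _⟩
    rw [abs_of_nonneg (hE0 k y)]; exact hE1 k y
  set b : ℕ → ℝ := fun k => ∫ y, E k y with hb
  have hb0 : ∀ k, 0 ≤ b k := fun k => integral_nonneg (hE0 k)
  have hbt : Tendsto b atTop (𝓝 0) := by
    have h : Tendsto b atTop (𝓝 (∫ _ : Euc m, (0:ℝ))) := by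
      refine tendsto_integral_of_dominated_convergence (Ω.indicator fun _ => (1:ℝ)) ?_ ?_ ?_ ?_
      · exact fun k => (hEm k).aestronglyMeasurable
      · exact (integrable_indicator_iff hΩo.measurableSet).2 (integrableOn_const hfin)
      · intro k
        refine Eventually.of_forall fun y => ?_
        rw [Real.norm_of_nonneg (hE0 k y)]
        by_cases hy : y ∈ Ω
        · rw [indicator_of_mem hy]; exact hE1 k y
        · simp only [hE]
          rw [indicator_of_notMem hy, indicator_of_notMem hy]
      · refine Eventually.of_forall fun y => ?_
        by_cases hy : y ∈ Ω
        · simp only [hE, indicator_of_mem hy]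
          refine Real.tendsto_exp_atBot.comp ?_
          have h1 : Tendsto (fun k : ℕ => (k:ℝ) * ((2*m:ℝ) * φ y)) atTop atBot :=
            tendsto_natCast_atTop_atTop.atTop_mul_const_of_neg (by nlinarith [hφneg y hy])
          refine h1.congr fun k => ?_
          ring
        · simp only [hE, indicator_of_notMem hy]
          exact tendsto_const_nhds
    simpa using h
  set θ : ℕ → ℝ := fun k => √(b k) + een k with hθ
  have hθ0 : ∀ k, 0 < θ k := fun k => add_pos_of_nonneg_of_pos (Real.sqrt_nonneg _) (een_pos k)
  have hθt : Tendsto θ atTop (𝓝 0) := by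
    have := (hbt.sqrt).add een_tendsto
    simpa using this
  have hbθ : ∀ k, b k ≤ (θ k)^2 := by
    intro k
    have h1 := Real.sq_sqrt (hb0 k)
    have h2 := Real.sqrt_nonneg (b k)
    have h3 := een_pos k
    simp only [hθ]
    nlinarith
  obtain ⟨Θ, hΘ⟩ := hθt.bddAbove_range
  have hΘ' : ∀ k, θ k ≤ Θ := fun k => hΘ (mem_range_self k)
  set H : ℝ := (2*m : ℝ) * Real.exp (2*m) * (|c⁻¹| * C0 * (1 + D)) * √Θ with hH
  have hH0 : 0 ≤ H := by positivity
  set δ : ℝ := 1 / (2 * (H + 1)) with hδ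
  have hδ0 : 0 < δ := by positivity
  have hδ1 : δ ≤ 1 := by
    rw [hδ, div_le_one (by positivity)]; linarith
  have hHδ : H * δ ≤ 1/2 := by
    rw [hδ, mul_one_div, div_le_iff₀ (by positivity)]; linarith
  set s : ℕ → ℝ := fun k => δ / √(θ k) with hs
  have hs0 : ∀ k, 0 < s k := fun k => div_pos hδ0 (Real.sqrt_pos.2 (hθ0 k))
  have hsθ : ∀ k, s k * θ k = δ * √(θ k) := by
    intro k
    have h1 := Real.sqrt_pos.2 (hθ0 k)
    have h2 := Real.sq_sqrt (hθ0 k).le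
    simp only [hs]
    rw [div_mul_eq_mul_div, div_eq_iff h1.ne']
    nlinarith
  have hst : Tendsto s atTop atTop := by
    have h1 : Tendsto (fun k => √(θ k)) atTop (𝓝[>] 0) := by
      rw [tendsto_nhdsWithin_iff]
      refine ⟨by simpa using hθt.sqrt, Eventually.of_forall fun k => Real.sqrt_pos.2 (hθ0 k)⟩
    have h2 := h1.inv_tendsto_nhdsGT_zero.const_mul_atTop hδ0
    exact h2
  have hsle : ∀ k : ℕ, s k ≤ k + 1 := by
    intro k
    have h1 := een_pos k
    have h2 := een_le k
    have h3 : een k ≤ √(θ k) := by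
      apply Real.le_sqrt_of_sq_le
      have := Real.sqrt_nonneg (b k)
      simp only [hθ]
      nlinarith
    simp only [hs]
    rw [div_le_iff₀ (h1.trans_le h3)]
    have h4 : ((k:ℝ) + 1) * een k = 1 := by unfold een; field_simp
    have h5 : ((k:ℝ) + 1) * een k ≤ ((k:ℝ) + 1) * √(θ k) := by gcongr
    linarith
  have hsol : ∀ k : ℕ, ∃ w : Euc m → ℝ, ContDiff ℝ (2*m-1 : ℕ) w ∧ (∀ x ∈ ball (0 : Euc m) R0, |w x| ≤ 1) ∧
      SolvesQ Ω (V k) (fun x => k * φ x + Real.log (s k) / (2*m) + w x) := by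
    intro k
    refine solve_one hm hc hfund hΩo hRΩ hφm hφ hφh (fun x hx => (hφneg x hx).le) (hVmeas k) (hC0 k) hC
      (hs0 k) (Nat.cast_nonneg k) (q := (1 + D) * θ k)
      (hyoung (E k) (hEB k) (hE0 k) (θ k) (hθ0 k) (hbθ k)) ?_
    have h1 : √(θ k) ≤ √Θ := Real.sqrt_le_sqrt (hΘ' k)
    calc (2*m : ℝ) * Real.exp (2*m) * ((|c⁻¹| * C0 * s k) * ((1 + D) * θ k))
        = (2*m : ℝ) * Real.exp (2*m) * (|c⁻¹| * C0 * (1 + D)) * (s k * θ k) := by ring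
      _ = (2*m : ℝ) * Real.exp (2*m) * (|c⁻¹| * C0 * (1 + D)) * (δ * √(θ k)) := by rw [hsθ]
      _ ≤ (2*m : ℝ) * Real.exp (2*m) * (|c⁻¹| * C0 * (1 + D)) * (δ * √Θ) := by gcongr
      _ = H * δ := by rw [hH]; ring
      _ ≤ 1/2 := hHδ
  choose w hwc hw1 hwS using hsol
  have hexpu : ∀ k x, Real.exp ((2*m : ℝ) * (k * φ x + Real.log (s k) / (2*m) + w k x))
      = Real.exp ((2*m : ℝ) * (k * φ x)) * s k * Real.exp ((2*m : ℝ) * w k x) := by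
    intro k x
    have e3 : (2*m : ℝ) * (k * φ x + Real.log (s k) / (2*m) + w k x)
      = (2*m : ℝ) * (k * φ x) + Real.log (s k) + (2*m : ℝ) * w k x := by
      field_simp
    rw [e3, Real.exp_add, Real.exp_add, Real.exp_log (hs0 k)]
  have hexpb : ∀ k, ∀ x ∈ Ω, Real.exp ((2*m : ℝ) * (k * φ x + Real.log (s k) / (2*m) + w k x))
      ≤ (Real.exp (2*m) * s k) * Real.exp ((2*m : ℝ) * (k * φ x)) := by
    intro k x hx
    rw [hexpu]
    have h1 : Real.exp ((2*m : ℝ) * w k x) ≤ Real.exp (2*m) := by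
      apply Real.exp_le_exp.2
      have := (abs_le.1 (hw1 k x (hRΩ hx))).2
      nlinarith
    have h2 := hs0 k
    calc _ ≤ Real.exp ((2*m : ℝ) * (k * φ x)) * s k * Real.exp (2*m) := by gcongr
      _ = _ := by ring
  have hInteg : ∀ k : ℕ, IntegrableOn (fun x => Real.exp ((2*m : ℝ) * (k * φ x + Real.log (s k) / (2*m) + w k x))) Ω := by
    intro k
    have hwm : Measurable (w k) := (hwc k).continuous.measurable
    refine Measure.integrableOn_of_bounded (M := Real.exp (2*m) * s k) hfin ?_ ?_
    · exact (by fun_prop : Measurable (fun x => Real.exp ((2*m : ℝ) * (k * φ x + Real.log (s k) / (2*m) + w k x)))).aestronglyMeasurable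
    · rw [ae_restrict_iff' hΩo.measurableSet]
      refine Eventually.of_forall fun x hx => ?_
      rw [Real.norm_of_nonneg (Real.exp_pos _).le]
      refine (hexpb k x hx).trans ?_
      have h2 := hs0 k
      exact mul_le_of_le_one_right (by positivity) (hexp1 k x hx)
  refine ⟨fun k x => k * φ x + Real.log (s k) / (2*m) + w k x, ?_, ?_, hwS, hInteg, ?_, ?_, ?_⟩
  · intro k
    exact ((contDiffOn_const.mul (contDiffOn_infty.1 hφ (2*m-1))).add contDiffOn_const).add (hwc k).contDiffOn
  · intro k
    have hφc : ContinuousOn φ (Ω ∪ Γ) := by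
      intro x hx
      rcases hx with hx | hx
      · exact (hφ.continuousOn.continuousAt (hΩo.mem_nhds hx)).continuousWithinAt
      · have hx0 : φ x = 0 := hφout x (hdisj x (hΓsub hx))
        refine ContinuousWithinAt.union ?_ ?_
        · have := hφΓ x hx
          rw [← hx0] at this
          exact this
        · refine (continuousWithinAt_const (b := (0:ℝ))).congr (fun y hy => ?_) hx0
          exact hφout y (hdisj y (hΓsub hy))
    exact ((continuousOn_const.mul hφc).add continuousOn_const).add (hwc k).continuous.continuousOn
  · have h1 : ∀ k, ∫ x in Ω, Real.exp ((2*m : ℝ) * (k * φ x + Real.log (s k) / (2*m) + w k x))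
        ≤ Real.exp (2*m) * (δ * √(θ k) * θ k) := by
      intro k
      have hEi : IntegrableOn (fun y => Real.exp ((2*m : ℝ) * (k * φ y))) Ω :=
        (integrable_indicator_iff hΩo.measurableSet).1 (hEB k).integrable
      have h2 : ∫ x in Ω, Real.exp ((2*m : ℝ) * (k * φ x + Real.log (s k) / (2*m) + w k x))
          ≤ ∫ x in Ω, (Real.exp (2*m) * s k) * Real.exp ((2*m : ℝ) * (k * φ x)) :=
        setIntegral_mono_on (hInteg k) (hEi.const_mul _) hΩo.measurableSet (hexpb k)
      have hbk : b k = ∫ x in Ω, Real.exp ((2*m : ℝ) * (k * φ x)) :=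
        integral_indicator hΩo.measurableSet
      rw [integral_const_mul, ← hbk] at h2
      have h3 : (Real.exp (2*m) * s k) * b k ≤ (Real.exp (2*m) * s k) * (θ k)^2 := by
        have := hbθ k
        have := hs0 k
        gcongr
      calc _ ≤ _ := h2
        _ ≤ _ := h3
        _ = Real.exp (2*m) * (s k * θ k * θ k) := by ring
        _ = _ := by rw [hsθ]
    have h2 : Tendsto (fun k => Real.exp (2*m) * (δ * √(θ k) * θ k)) atTop (𝓝 0) := by
      have := ((hθt.sqrt.const_mul δ).mul hθt).const_mul (Real.exp (2*m))
      simpa using this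
    exact squeeze_zero (fun k => integral_nonneg fun x => (Real.exp_pos _).le) h1 h2
  · intro K hKΩ hK C
    rcases K.eq_empty_or_nonempty with h | h
    · simp [h]
    obtain ⟨z, hz, hzmax⟩ := hK.exists_isMaxOn h (hφ.continuousOn.mono hKΩ)
    set d := - φ z with hd
    have hd0 : 0 < d := by have := hφneg z (hKΩ hz); linarith
    have hKd : ∀ x ∈ K, φ x ≤ -d := fun x hx => by
      have : φ x ≤ φ z := hzmax hx
      linarith
    have h1 : Tendsto (fun k : ℕ => (k:ℝ) * (-(d/2)) + (d/2 - 1 - Real.log (d/2) + 1)) atTop atBot :=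
      tendsto_atBot_add_const_right _ _
        (tendsto_natCast_atTop_atTop.atTop_mul_const_of_neg (by linarith))
    filter_upwards [h1.eventually_le_atBot C] with k hk x hx
    refine le_trans ?_ hk
    have h2 := (abs_le.1 (hw1 k x (hRΩ (hKΩ hx)))).2
    have hk1 : (0:ℝ) < (k:ℝ) + 1 := by positivity
    have h3 : Real.log (s k) / (2*m) ≤ Real.log ((k:ℝ) + 1) := by
      rw [div_le_iff₀ (by positivity)]
      have e1 := Real.log_le_log (hs0 k) (hsle k)
      have e2 : 0 ≤ Real.log ((k:ℝ) + 1) := Real.log_nonneg (by linarith [Nat.cast_nonneg (α := ℝ) k])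
      nlinarith
    have h4 : Real.log ((k:ℝ) + 1) ≤ d/2 * (k + 1) - 1 - Real.log (d/2) := by
      have e1 := Real.log_le_sub_one_of_pos (by positivity : 0 < d/2 * ((k:ℝ) + 1))
      rw [Real.log_mul (by positivity) (by positivity)] at e1
      linarith
    have h5 : (k:ℝ) * φ x ≤ k * (-d) := mul_le_mul_of_nonneg_left (hKd x hx) (Nat.cast_nonneg k)
    nlinarith
  · intro K hKΓ hK C
    have h1 : Tendsto (fun k => Real.log (s k) / (2*m) - 1) atTop atTop :=
      tendsto_atTop_add_const_right _ (-1) ((Real.tendsto_log_atTop.comp hst).atTop_div_const (by positivity))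
    filter_upwards [h1.eventually_ge_atTop C] with k hk x hx
    have hxf := hΓsub (hKΓ hx)
    have h2 := (abs_le.1 (hw1 k x (hR0 (frontier_subset_closure hxf)))).1
    have h3 : φ x = 0 := hφout x (hdisj x hxf)
    simp only [h3, mul_zero]
    linarith
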